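/- Let m ≡ 1 mod 4 with m > 7 and let n ≥ 1. If the group (ℤ/2ℤ)^r acts freely and continuously on the product (ℝP^m)^n, then r ≤ n. -/

import Mathlib

noncomputable section

/-- The unit sphere `S^m` in `ℝ^{m+1}`. -/
abbrev Sph (m : ℕ) : Type := Metric.sphere (0 : EuclideanSpace ℝ (Fin (m + 1))) 1

/-- The antipodal relation on the sphere `S^m`. -/
def antipodal (m : ℕ) (x y : Sph m) : Prop :=
  (y : EuclideanSpace ℝ (Fin (m + 1))) = (x : EuclideanSpace ℝ (Fin (m + 1))) ∨
    (y : EuclideanSpace ℝ (Fin (m + 1))) = -(x : EuclideanSpace ℝ (Fin (m + 1)))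

/-- Real projective `m`-space: the quotient of `S^m` by the antipodal map,
with the quotient topology. -/
abbrev RP (m : ℕ) : Type := Quot (antipodal m)

namespace ASp
open Set

section Algebra
variable {X X' X'' Λ : Type*} [CommRing Λ]

/-- The (augmented, unordered) Alexander coboundary, computed by recursion on the list. -/
def cobdAux : List X → (List X → Λ) → Λ
  | [], _ => 0
  | x :: l, φ => φ l - cobdAux l (fun l' => φ (x :: l'))

lemma cobdAux_add (l : List X) (φ ψ : List X → Λ) :
    cobdAux l (φ + ψ) = cobdAux l φ + cobdAux l ψ := by
  induction l generalizing φ ψ with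
  | nil => simp [cobdAux]
  | cons x l ih =>
    have := ih (fun l' => φ (x :: l')) (fun l' => ψ (x :: l'))
    simp only [cobdAux, Pi.add_apply]
    rw [show (fun l' => φ (x :: l') + ψ (x :: l')) =
      (fun l' => φ (x :: l')) + (fun l' => ψ (x :: l')) from rfl, this]
    ring

lemma cobdAux_smul (l : List X) (c : Λ) (φ : List X → Λ) :
    cobdAux l (c • φ) = c * cobdAux l φ := by
  induction l generalizing φ with
  | nil => simp [cobdAux]
  | cons x l ih =>
    have := ih (fun l' => φ (x :: l'))
    simp only [cobdAux, Pi.smul_apply, smul_eq_mul]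
    rw [show (fun l' => c * φ (x :: l')) = c • (fun l' => φ (x :: l')) from rfl, this]
    ring

/-- The coboundary as a linear map. -/
def cobd : (List X → Λ) →ₗ[Λ] (List X → Λ) where
  toFun φ l := cobdAux l φ
  map_add' φ ψ := funext fun l => cobdAux_add l φ ψ
  map_smul' c φ := funext fun l => cobdAux_smul l c φ

@[simp] lemma cobd_nil (φ : List X → Λ) : cobd φ [] = 0 := rfl

lemma cobd_cons (φ : List X → Λ) (x : X) (l : List X) :
    cobd φ (x :: l) = φ l - cobd (fun l' => φ (x :: l')) l := rfl

@[simp] lemma cobd_singleton (φ : List X → Λ) (x : X) : cobd φ [x] = φ [] := by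
  simp [cobd_cons]

lemma cobd_cobd (φ : List X → Λ) : cobd (cobd φ) = 0 := by
  funext l
  induction l generalizing φ with
  | nil => rfl
  | cons x l ih =>
    have h : (fun l' => cobd φ (x :: l')) = φ - cobd (fun l' => φ (x :: l')) := by
      funext l'; simp [cobd_cons]
    rw [cobd_cons, h, map_sub, Pi.sub_apply, ih]; simp

lemma cobd_eq_zero_of_subset (l : List X) (φ : List X → Λ)
    (h : ∀ l', (∀ x ∈ l', x ∈ l) → φ l' = 0) : cobd φ l = 0 := by
  induction l generalizing φ with
  | nil => rfl
  | cons x l ih =>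
    rw [cobd_cons, h l (fun y hy => by simp [hy]), ih, sub_zero]
    intro l' hl'
    apply h
    intro y hy
    rcases List.mem_cons.1 hy with rfl | hy
    · simp
    · simp [hl' y hy]

/-- Pullback of a cochain along a map. -/
def pb (f : X → X') : (List X' → Λ) →ₗ[Λ] (List X → Λ) where
  toFun φ l := φ (l.map f)
  map_add' _ _ := rfl
  map_smul' _ _ := rfl

@[simp] lemma pb_apply (f : X → X') (φ : List X' → Λ) (l : List X) :
    pb f φ l = φ (l.map f) := rfl

lemma pb_pb (f : X → X') (g : X' → X'') (φ : List X'' → Λ) :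
    pb f (pb g φ) = pb (g ∘ f) φ := by
  funext l; simp

lemma pb_id (φ : List X → Λ) : pb id φ = φ := by
  funext l; simp

lemma cobd_pb (f : X → X') (φ : List X' → Λ) : cobd (pb f φ) = pb f (cobd φ) := by
  funext l
  induction l generalizing φ with
  | nil => rfl
  | cons x l ih =>
    have := ih (fun l' => φ (f x :: l'))
    simp only [pb_apply, List.map_cons, cobd_cons] at this ⊢
    rw [← this]; rfl

/-- The prism operator between the pullbacks along two maps. -/
def prismAux (f g : X → X') : List X → (List X' → Λ) → Λ
  | [], _ => 0
  | x :: l, φ => φ (f x :: g x :: l.map g) - prismAux f g l (fun l' => φ (f x :: l'))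

/-- The prism operator as a linear map. -/
def prism (f g : X → X') : (List X' → Λ) →ₗ[Λ] (List X → Λ) where
  toFun φ l := prismAux f g l φ
  map_add' φ ψ := by
    funext l
    simp only [Pi.add_apply]
    induction l generalizing φ ψ with
    | nil => simp [prismAux]
    | cons x l ih =>
      have := ih (fun l' => φ (f x :: l')) (fun l' => ψ (f x :: l'))
      simp only [prismAux, Pi.add_apply]
      rw [show (fun l' => φ (f x :: l') + ψ (f x :: l')) =
        (fun l' => φ (f x :: l')) + (fun l' => ψ (f x :: l')) from rfl, this]
      ring
  map_smul' c φ := by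
    funext l
    simp only [Pi.smul_apply, RingHom.id_apply, smul_eq_mul]
    induction l generalizing φ with
    | nil => simp [prismAux]
    | cons x l ih =>
      have := ih (fun l' => φ (f x :: l'))
      simp only [prismAux, Pi.smul_apply, smul_eq_mul]
      rw [show (fun l' => c * φ (f x :: l')) = c • (fun l' => φ (f x :: l')) from rfl, this]
      ring

@[simp] lemma prism_nil (f g : X → X') (φ : List X' → Λ) : prism f g φ [] = 0 := rfl

lemma prism_cons (f g : X → X') (φ : List X' → Λ) (x : X) (l : List X) :
    prism f g φ (x :: l) =
      φ (f x :: g x :: l.map g) - prism f g (fun l' => φ (f x :: l')) l := rfl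

lemma cobd_prism (f g : X → X') (φ : List X' → Λ) :
    cobd (prism f g φ) + prism f g (cobd φ) = pb g φ - pb f φ := by
  funext l
  induction l generalizing φ with
  | nil => simp
  | cons x l ih =>
    have h1 := ih (fun l' => φ (f x :: l'))
    have e1 : (fun l' => prism f g φ (x :: l')) =
        pb g (fun l' => φ (f x :: g x :: l')) - prism f g (fun l' => φ (f x :: l')) := by
      funext l'; simp [prism_cons]
    have e2 : (fun l' => cobd φ (f x :: l')) = φ - cobd (fun l' => φ (f x :: l')) := by
      funext l'; simp [cobd_cons]
    simp only [Pi.add_apply, Pi.sub_apply, pb_apply] at h1 ⊢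
    rw [cobd_cons, e1, map_sub, cobd_pb, prism_cons, e2, map_sub, cobd_cons, cobd_cons]
    simp only [Pi.sub_apply, pb_apply, List.map_cons]
    linear_combination h1

lemma prism_eq_zero_of_subset (f g : X → X') (l : List X) (φ : List X' → Λ)
    (h : ∀ l', (∀ y ∈ l', y ∈ l.map f ++ l.map g) → φ l' = 0) : prism f g φ l = 0 := by
  induction l generalizing φ with
  | nil => rfl
  | cons x l ih =>
    rw [prism_cons, h, ih, sub_zero]
    · intro l' hl'
      apply h
      intro y hy
      rcases List.mem_cons.1 hy with rfl | hy
      · simp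
      · have := hl' y hy
        simp only [List.map_cons, List.mem_append, List.mem_cons] at this ⊢
        tauto
    · intro y hy
      simp only [List.map_cons, List.mem_append, List.mem_cons] at hy ⊢
      tauto

lemma prism_pb {X₁ X₁' : Type*} (f g : X → X') (u : X₁ → X) (u' : X₁' → X') (f₁ g₁ : X₁ → X₁')
    (hf : ∀ x, f (u x) = u' (f₁ x)) (hg : ∀ x, g (u x) = u' (g₁ x)) (φ : List X' → Λ) :
    pb u (prism f g φ) = prism f₁ g₁ (pb u' φ) := by
  funext l
  induction l generalizing φ with
  | nil => rfl
  | cons x l ih =>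
    have := ih (fun l' => φ (f (u x) :: l'))
    simp only [pb_apply, List.map_cons, prism_cons, hf, hg, List.map_map] at this ⊢
    rw [this]
    congr 2
    have : (g ∘ u) = (u' ∘ g₁) := funext hg
    rw [this]

/-- Multiplication by a function of the first vertex. -/
def mulv (c : X → Λ) : (List X → Λ) →ₗ[Λ] (List X → Λ) where
  toFun φ l := match l with
    | [] => 0
    | x :: l => c x * φ (x :: l)
  map_add' φ ψ := by
    funext l; cases l <;> simp [mul_add]
  map_smul' k φ := by
    funext l; cases l <;> simp [mul_left_comm]

@[simp] lemma mulv_nil (c : X → Λ) (φ : List X → Λ) : mulv c φ [] = 0 := rfl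
@[simp] lemma mulv_cons (c : X → Λ) (φ : List X → Λ) (x : X) (l : List X) :
  mulv c φ (x :: l) = c x * φ (x :: l) := rfl

/-- Cup product (on the left) with the coboundary of a function. -/
def dcup (c : X → Λ) : (List X → Λ) →ₗ[Λ] (List X → Λ) where
  toFun φ l := match l with
    | [] => 0
    | [_] => 0
    | x :: y :: l => (c y - c x) * φ (y :: l)
  map_add' φ ψ := by
    funext l; rcases l with _ | ⟨x, _ | ⟨y, l⟩⟩ <;> simp [mul_add]
  map_smul' k φ := by
    funext l; rcases l with _ | ⟨x, _ | ⟨y, l⟩⟩ <;> simp [mul_left_comm]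

@[simp] lemma dcup_nil (c : X → Λ) (φ : List X → Λ) : dcup c φ [] = 0 := rfl
@[simp] lemma dcup_singleton (c : X → Λ) (φ : List X → Λ) (x : X) : dcup c φ [x] = 0 := rfl
@[simp] lemma dcup_cons_cons (c : X → Λ) (φ : List X → Λ) (x y : X) (l : List X) :
  dcup c φ (x :: y :: l) = (c y - c x) * φ (y :: l) := rfl

lemma cobd_mulv (c : X → Λ) (φ : List X → Λ) (h0 : φ [] = 0) :
    cobd (mulv c φ) = dcup c φ + mulv c (cobd φ) := by
  funext l
  rcases l with _ | ⟨x, _ | ⟨y, l⟩⟩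
  · simp
  · simp [h0]
  · have e : (fun l' => mulv c φ (x :: l')) = c x • (fun l' => φ (x :: l')) := by
      funext l'; simp
    simp only [Pi.add_apply, mulv_cons, dcup_cons_cons]
    rw [cobd_cons, e, map_smul, cobd_cons φ x]
    simp only [mulv_cons, Pi.smul_apply, smul_eq_mul]
    ring

lemma cobd_dcup (c : X → Λ) (φ : List X → Λ) (h0 : φ [] = 0) :
    cobd (dcup c φ) = - dcup c (cobd φ) := by
  have e := cobd_mulv c φ h0
  have h2 := congrArg cobd e
  rw [cobd_cobd, map_add, cobd_mulv c (cobd φ) rfl, cobd_cobd, map_zero, add_zero] at h2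
  exact eq_neg_of_add_eq_zero_left h2.symm

lemma dcup_pb (f : X → X') (c : X' → Λ) (φ : List X' → Λ) :
    pb f (dcup c φ) = dcup (c ∘ f) (pb f φ) := by
  funext l; rcases l with _ | ⟨x, _ | ⟨y, l⟩⟩ <;> simp

lemma mulv_pb (f : X → X') (c : X' → Λ) (φ : List X' → Λ) :
    pb f (mulv c φ) = mulv (c ∘ f) (pb f φ) := by
  funext l; rcases l with _ | ⟨x, l⟩ <;> simp

/-- Insertion of a fixed first vertex. -/
def ins (e : X) : (List X → Λ) →ₗ[Λ] (List X → Λ) where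
  toFun φ l := φ (e :: l)
  map_add' _ _ := rfl
  map_smul' _ _ := rfl

@[simp] lemma ins_apply (e : X) (φ : List X → Λ) (l : List X) : ins e φ l = φ (e :: l) := rfl

lemma cone_formula (e : X) (φ : List X → Λ) : φ = ins e (cobd φ) + cobd (ins e φ) := by
  funext l
  simp only [Pi.add_apply, ins_apply, cobd_cons]
  rw [show (fun l' => φ (e :: l')) = ins e φ from rfl]; ring

/-- The unit cocycle. -/
def one : List X → Λ := fun l => if l.length = 1 then 1 else 0

@[simp] lemma one_nil : (one : List X → Λ) [] = 0 := by simp [one]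
@[simp] lemma one_singleton (x : X) : (one : List X → Λ) [x] = 1 := by simp [one]
@[simp] lemma one_cons_cons (x y : X) (l : List X) : (one : List X → Λ) (x :: y :: l) = 0 := by
  simp [one]

/-- The cochain concentrated on the empty list. -/
def aug : List X → Λ := fun l => if l.length = 0 then 1 else 0

@[simp] lemma aug_nil : (aug : List X → Λ) [] = 1 := by simp [aug]
@[simp] lemma aug_cons (x : X) (l : List X) : (aug : List X → Λ) (x :: l) = 0 := by simp [aug]

lemma cobd_aug : cobd (aug : List X → Λ) = one := by
  funext l
  rcases l with _ | ⟨x, l⟩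
  · simp
  · rw [cobd_cons, show (fun l' => (aug : List X → Λ) (x :: l')) = 0 by funext; simp, map_zero]
    cases l <;> simp

lemma cobd_one : cobd (one : List X → Λ) = 0 := by rw [← cobd_aug, cobd_cobd]

@[simp] lemma pb_one (f : X → X') : pb f (one : List X' → Λ) = one := by
  funext l; simp [one]

@[simp] lemma pb_aug (f : X → X') : pb f (aug : List X' → Λ) = aug := by
  funext l; simp [aug]

/-- Cochains supported on lists of length at most `d`. -/
def supp (d : ℕ) : Submodule Λ (List X → Λ) where
  carrier := {φ | ∀ l, d < l.length → φ l = 0}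
  add_mem' ha hb l hl := by simp [ha l hl, hb l hl]
  zero_mem' _ _ := rfl
  smul_mem' c φ h l hl := by simp [h l hl]

/-- Truncation to lists of length at most `d`. -/
def trunc (d : ℕ) : (List X → Λ) →ₗ[Λ] (List X → Λ) where
  toFun φ l := if l.length ≤ d then φ l else 0
  map_add' φ ψ := by funext l; by_cases h : l.length ≤ d <;> simp [h]
  map_smul' c φ := by funext l; by_cases h : l.length ≤ d <;> simp [h]

lemma trunc_apply (d : ℕ) (φ : List X → Λ) (l : List X) :
    trunc d φ l = if l.length ≤ d then φ l else 0 := rfl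

lemma trunc_mem_supp (d : ℕ) (φ : List X → Λ) : trunc d φ ∈ supp (Λ := Λ) d := by
  intro l hl
  rw [trunc_apply, if_neg (by omega)]

lemma trunc_of_mem {d : ℕ} {φ : List X → Λ} (h : φ ∈ supp (Λ := Λ) d) : trunc d φ = φ := by
  funext l
  rw [trunc_apply]
  split_ifs with hl
  · rfl
  · exact (h l (by omega)).symm

lemma trunc_cobd (d : ℕ) (φ : List X → Λ) : trunc (d + 1) (cobd φ) = cobd (trunc d φ) := by
  funext l
  induction l generalizing φ d with
  | nil => simp [trunc_apply]
  | cons x l ih =>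
    rw [cobd_cons, trunc_apply, trunc_apply]
    rcases d with _ | d
    · rcases l with _ | ⟨y, l⟩
      · simp
      · have : (fun l' => trunc 0 φ (x :: l')) = 0 := by funext l'; simp [trunc_apply]
        rw [this]; simp
    · have := ih d (fun l' => φ (x :: l'))
      have e : (fun l' => trunc (d+1) φ (x :: l')) = trunc d (fun l' => φ (x :: l')) := by
        funext l'; simp [trunc_apply]
      rw [e, ← this, trunc_apply, cobd_cons]
      by_cases h : l.length ≤ d + 1 <;> simp [h]

lemma trunc_pb (d : ℕ) (f : X → X') (φ : List X' → Λ) :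
    trunc d (pb f φ) = pb f (trunc d φ) := by
  funext l; simp [trunc_apply]

lemma supp_mono {d e : ℕ} (h : d ≤ e) : supp (X := X) (Λ := Λ) d ≤ supp e :=
  fun _ hφ l hl => hφ l (by omega)

lemma cobd_mem_supp {d : ℕ} {φ : List X → Λ} (h : φ ∈ supp (Λ := Λ) d) :
    cobd φ ∈ supp (Λ := Λ) (d + 1) := by
  rw [← trunc_of_mem h, ← trunc_cobd]; exact trunc_mem_supp _ _

lemma pb_mem_supp {d : ℕ} (f : X → X') {φ : List X' → Λ} (h : φ ∈ supp (Λ := Λ) d) :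
    pb f φ ∈ supp (Λ := Λ) d := fun l hl => h _ (by simpa using hl)

lemma prism_eq_zero_of_length (f g : X → X') (l : List X) (φ : List X' → Λ)
    (h : ∀ l' : List X', l'.length = l.length + 1 → φ l' = 0) : prism f g φ l = 0 := by
  induction l generalizing φ with
  | nil => rfl
  | cons x l ih =>
    rw [prism_cons, h _ (by simp), ih _ (fun l' hl' => h _ (by simp [hl'])), sub_zero]

lemma mulv_mem_supp {d : ℕ} (c : X → Λ) {φ : List X → Λ} (h : φ ∈ supp (Λ := Λ) d) :
    mulv c φ ∈ supp (Λ := Λ) d := by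
  intro l hl
  cases l with
  | nil => rfl
  | cons x l => simp [h _ hl]

lemma dcup_mem_supp {d : ℕ} (c : X → Λ) {φ : List X → Λ} (h : φ ∈ supp (Λ := Λ) d) :
    dcup c φ ∈ supp (Λ := Λ) (d + 1) := by
  intro l hl
  rcases l with _ | ⟨x, _ | ⟨y, l⟩⟩
  · rfl
  · rfl
  · simp [h (y :: l) (by simpa using hl)]

lemma one_mem_supp : (one : List X → Λ) ∈ supp (Λ := Λ) 1 := by
  intro l hl; simp [one]; omega

/-- Cochains invariant under a set of self-maps. -/
def inv (F : Set (X → X)) : Submodule Λ (List X → Λ) where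
  carrier := {φ | ∀ f ∈ F, pb f φ = φ}
  add_mem' ha hb f hf := by rw [map_add, ha f hf, hb f hf]
  zero_mem' _ _ := map_zero _
  smul_mem' c φ h f hf := by rw [map_smul, h f hf]

lemma mem_inv {F : Set (X → X)} {φ : List X → Λ} : φ ∈ inv F ↔ ∀ f ∈ F, pb f φ = φ := Iff.rfl

lemma trunc_mem_inv {F : Set (X → X)} {φ : List X → Λ} (d : ℕ) (h : φ ∈ inv F) :
    trunc d φ ∈ inv (Λ := Λ) F := fun f hf => by rw [← trunc_pb, h f hf]

lemma one_mem_inv (F : Set (X → X)) : one ∈ inv (Λ := Λ) F := fun _ _ => pb_one _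

lemma dcup_mem_inv {F : Set (X → X)} {c : X → Λ} (hc : ∀ f ∈ F, c ∘ f = c) {φ : List X → Λ}
    (h : φ ∈ inv F) : dcup c φ ∈ inv (Λ := Λ) F := fun f hf => by rw [dcup_pb, hc f hf, h f hf]

lemma mulv_mem_inv {F : Set (X → X)} {c : X → Λ} (hc : ∀ f ∈ F, c ∘ f = c) {φ : List X → Λ}
    (h : φ ∈ inv F) : mulv c φ ∈ inv (Λ := Λ) F := fun f hf => by rw [mulv_pb, hc f hf, h f hf]

lemma pb_mem_inv {F : Set (X → X)} {F' : Set (X' → X')} {u : X → X'}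
    (hu : ∀ f ∈ F, ∃ f' ∈ F', u ∘ f = f' ∘ u) {φ : List X' → Λ}
    (h : φ ∈ inv F') : pb u φ ∈ inv (Λ := Λ) F := fun f hf => by
  obtain ⟨f', hf', e⟩ := hu f hf
  rw [pb_pb, e, ← pb_pb, h f' hf']

lemma inv_anti {F F' : Set (X → X)} (h : F ⊆ F') : inv (Λ := Λ) F' ≤ inv F :=
  fun _ hφ f hf => hφ f (h hf)

end Algebra

section Local
variable {X X' Λ : Type*} [CommRing Λ] [PseudoMetricSpace X] [PseudoMetricSpace X']

/-- A list of points of `Y` whose mutual distances are less than `ε`. -/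
def Small (ε : ℝ) (Y : Set X) (l : List X) : Prop :=
  (∀ x ∈ l, x ∈ Y) ∧ ∀ x ∈ l, ∀ y ∈ l, dist x y < ε

lemma Small.mono {ε ε' : ℝ} {Y Y' : Set X} {l l' : List X} (h : Small ε Y l) (hε : ε ≤ ε')
    (hY : Y ⊆ Y') (hl : ∀ x ∈ l', x ∈ l) : Small ε' Y' l' :=
  ⟨fun x hx => hY (h.1 x (hl x hx)),
    fun x hx y hy => (h.2 x (hl x hx) y (hl y hy)).trans_le hε⟩

/-- Cochains vanishing on all sufficiently small lists of points of `Y`. -/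
def LZ (Y : Set X) : Submodule Λ (List X → Λ) where
  carrier := {φ | ∃ ε > 0, ∀ l, Small ε Y l → φ l = 0}
  add_mem' := by
    rintro φ ψ ⟨ε, hε, h⟩ ⟨ε', hε', h'⟩
    refine ⟨min ε ε', lt_min hε hε', fun l hl => ?_⟩
    rw [Pi.add_apply, h l (hl.mono (min_le_left _ _) subset_rfl fun _ h => h),
      h' l (hl.mono (min_le_right _ _) subset_rfl fun _ h => h), add_zero]
  zero_mem' := ⟨1, one_pos, fun _ _ => rfl⟩
  smul_mem' := by
    rintro c φ ⟨ε, hε, h⟩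
    exact ⟨ε, hε, fun l hl => by rw [Pi.smul_apply, h l hl, smul_zero]⟩

lemma LZ_anti {Y Y' : Set X} (h : Y ⊆ Y') : LZ (Λ := Λ) Y' ≤ LZ Y := by
  rintro φ ⟨ε, hε, hφ⟩
  exact ⟨ε, hε, fun l hl => hφ l (hl.mono le_rfl h fun _ h => h)⟩

lemma nil_of_mem_LZ {Y : Set X} {φ : List X → Λ} (h : φ ∈ LZ Y) : φ [] = 0 := by
  obtain ⟨ε, _, h⟩ := h
  exact h [] ⟨by simp, by simp⟩

lemma singleton_of_mem_LZ {Y : Set X} {φ : List X → Λ} (h : φ ∈ LZ Y) {x : X} (hx : x ∈ Y) :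
    φ [x] = 0 := by
  obtain ⟨ε, hε, h⟩ := h
  exact h [x] ⟨by simpa using hx, by simpa using hε⟩

lemma nil_of_cobd_mem_LZ {Y : Set X} {φ : List X → Λ} (h : cobd φ ∈ LZ Y) (hY : Y.Nonempty) :
    φ [] = 0 := by
  obtain ⟨x, hx⟩ := hY
  have := singleton_of_mem_LZ h hx
  simpa using this

lemma cobd_mem_LZ {Y : Set X} {φ : List X → Λ} (h : φ ∈ LZ Y) : cobd φ ∈ LZ (Λ := Λ) Y := by
  obtain ⟨ε, hε, h⟩ := h
  exact ⟨ε, hε, fun l hl => cobd_eq_zero_of_subset l φ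
    fun l' hl' => h l' (hl.mono le_rfl subset_rfl hl')⟩

lemma trunc_mem_LZ {Y : Set X} {φ : List X → Λ} (d : ℕ) (h : φ ∈ LZ Y) :
    trunc d φ ∈ LZ (Λ := Λ) Y := by
  obtain ⟨ε, hε, h⟩ := h
  refine ⟨ε, hε, fun l hl => ?_⟩
  rw [trunc_apply, h l hl, ite_self]

lemma Small.map {Y : Set X} {Y' : Set X'} {f : X → X'} (hf : UniformContinuousOn f Y)
    (hY : Set.MapsTo f Y Y') {ε : ℝ} (hε : 0 < ε) :
    ∃ δ > 0, ∀ l, Small δ Y l → Small ε Y' (l.map f) := by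
  obtain ⟨δ, hδ, h⟩ := Metric.uniformContinuousOn_iff.1 hf ε hε
  refine ⟨δ, hδ, fun l hl => ⟨?_, ?_⟩⟩
  · simpa using fun x hx => hY (hl.1 x hx)
  · simpa using fun x hx y hy => h x (hl.1 x hx) y (hl.1 y hy) (hl.2 x hx y hy)

lemma pb_mem_LZ {Y : Set X} {Y' : Set X'} {f : X → X'} (hf : UniformContinuousOn f Y)
    (hY : Set.MapsTo f Y Y') {φ : List X' → Λ} (h : φ ∈ LZ Y') : pb f φ ∈ LZ (Λ := Λ) Y := by
  obtain ⟨ε, hε, h⟩ := h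
  obtain ⟨δ, hδ, h'⟩ := Small.map hf hY hε
  exact ⟨δ, hδ, fun l hl => h _ (h' l hl)⟩

lemma mulv_mem_LZ {Y : Set X} (c : X → Λ) {φ : List X → Λ} (h : φ ∈ LZ Y) :
    mulv c φ ∈ LZ (Λ := Λ) Y := by
  obtain ⟨ε, hε, h⟩ := h
  refine ⟨ε, hε, fun l hl => ?_⟩
  cases l with
  | nil => rfl
  | cons x l => rw [mulv_cons, h _ hl, mul_zero]

lemma dcup_mem_LZ {Y : Set X} (c : X → Λ) {φ : List X → Λ} (h : φ ∈ LZ Y) :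
    dcup c φ ∈ LZ (Λ := Λ) Y := by
  obtain ⟨ε, hε, h⟩ := h
  refine ⟨ε, hε, fun l hl => ?_⟩
  rcases l with _ | ⟨x, _ | ⟨y, l⟩⟩
  · rfl
  · rfl
  · rw [dcup_cons_cons, h _ (hl.mono le_rfl subset_rfl (by simp +contextual)), mul_zero]

/-- A cut function locally constant along `Y` multiplies trivially. -/
lemma dcup_mem_LZ_of_const {Y : Set X} (c : X → Λ)
    (hc : ∃ ε > 0, ∀ x ∈ Y, ∀ y ∈ Y, dist x y < ε → c x = c y) (φ : List X → Λ) :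
    dcup c φ ∈ LZ (Λ := Λ) Y := by
  obtain ⟨ε, hε, h⟩ := hc
  refine ⟨ε, hε, fun l hl => ?_⟩
  rcases l with _ | ⟨x, _ | ⟨y, l⟩⟩
  · rfl
  · rfl
  · rw [dcup_cons_cons, h x (hl.1 x (by simp)) y (hl.1 y (by simp))
      (hl.2 x (by simp) y (by simp)), sub_self, zero_mul]

/-- Coboundaries near `Y` of reduced `F`-invariant cochains. -/
def Bd (F : Set (X → X)) (Y : Set X) : Submodule Λ (List X → Λ) where
  carrier := {φ | ∃ ψ ∈ inv (Λ := Λ) F, ψ [] = 0 ∧ φ - cobd ψ ∈ LZ (Λ := Λ) Y}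
  add_mem' := by
    rintro φ φ' ⟨ψ, h1, h2, h3⟩ ⟨ψ', h1', h2', h3'⟩
    refine ⟨ψ + ψ', add_mem h1 h1', by simp [h2, h2'], ?_⟩
    rw [map_add, add_sub_add_comm]
    exact add_mem h3 h3'
  zero_mem' := ⟨0, zero_mem _, rfl, by simp⟩
  smul_mem' := by
    rintro c φ ⟨ψ, h1, h2, h3⟩
    refine ⟨c • ψ, Submodule.smul_mem _ _ h1, by simp [h2], ?_⟩
    rw [map_smul, ← smul_sub]
    exact Submodule.smul_mem _ _ h3

lemma LZ_le_Bd {F : Set (X → X)} {Y : Set X} : LZ (Λ := Λ) Y ≤ Bd F Y :=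
  fun φ h => ⟨0, zero_mem _, rfl, by simpa using h⟩

lemma exists_supp_of_mem_Bd {F : Set (X → X)} {Y : Set X} {φ : List X → Λ} {d : ℕ}
    (h : φ ∈ Bd F Y) (hd : φ ∈ supp (Λ := Λ) (d + 1)) :
    ∃ ψ ∈ inv (Λ := Λ) F, ψ [] = 0 ∧ ψ ∈ supp (Λ := Λ) d ∧ φ - cobd ψ ∈ LZ (Λ := Λ) Y := by
  obtain ⟨ψ, h1, h2, h3⟩ := h
  refine ⟨trunc d ψ, trunc_mem_inv d h1, by simp [trunc_apply, h2], trunc_mem_supp _ _, ?_⟩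
  have := trunc_mem_LZ (d + 1) h3
  rwa [map_sub, trunc_cobd, trunc_of_mem hd] at this

lemma pb_mem_Bd {F : Set (X → X)} {F' : Set (X' → X')} {Y : Set X} {Y' : Set X'} {u : X → X'}
    (huc : UniformContinuousOn u Y) (hY : Set.MapsTo u Y Y')
    (hu : ∀ f ∈ F, ∃ f' ∈ F', u ∘ f = f' ∘ u) {φ : List X' → Λ} (h : φ ∈ Bd F' Y') :
    pb u φ ∈ Bd (Λ := Λ) F Y := by
  obtain ⟨ψ, h1, h2, h3⟩ := h
  refine ⟨pb u ψ, pb_mem_inv hu h1, by simpa using h2, ?_⟩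
  rw [cobd_pb, ← map_sub]
  exact pb_mem_LZ huc hY h3

/-- Homotopic maps induce cohomologous pullbacks. -/
lemma homotopy_prism {Y : Set X} {Y' : Set X'} (h : ℝ × X → X')
    (huc : UniformContinuousOn h (Set.Icc 0 1 ×ˢ Y))
    (hY : ∀ t ∈ Set.Icc (0 : ℝ) 1, ∀ x ∈ Y, h (t, x) ∈ Y') {φ : List X' → Λ}
    (hφ : cobd φ ∈ LZ (Λ := Λ) Y') :
    ∃ N : ℕ, pb (fun x => h (1, x)) φ - pb (fun x => h (0, x)) φ -
      cobd (∑ i ∈ Finset.range N,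
        prism (fun x => h ((i : ℝ) / N, x)) (fun x => h (((i + 1 : ℕ) : ℝ) / N, x)) φ) ∈
        LZ (Λ := Λ) Y := by
  obtain ⟨ε, hε, hφ⟩ := hφ
  obtain ⟨δ, hδ, h'⟩ := Metric.uniformContinuousOn_iff.1 huc ε hε
  obtain ⟨N, hN⟩ := exists_nat_one_div_lt hδ
  have hN0 : (0 : ℝ) < (N + 1 : ℕ) := by positivity
  refine ⟨N + 1, ?_⟩
  set H : ℕ → X → X' := fun i x => h ((i : ℝ) / (N + 1 : ℕ), x) with hH
  have e1 : (fun x => h (1, x)) = H (N + 1) := by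
    funext x; simp only [hH]; rw [div_self hN0.ne']
  have e0 : (fun x => h (0, x)) = H 0 := by
    funext x; simp [hH]
  rw [e1, e0]
  have key : pb (H (N + 1)) φ - pb (H 0) φ - cobd (∑ i ∈ Finset.range (N + 1),
      prism (H i) (H (i + 1)) φ) =
      ∑ i ∈ Finset.range (N + 1), prism (H i) (H (i + 1)) (cobd φ) := by
    rw [← Finset.sum_range_sub (fun i => pb (H i) φ), map_sum, ← Finset.sum_sub_distrib]
    refine Finset.sum_congr rfl fun i _ => ?_
    rw [← cobd_prism]; abel
  change pb (H (N + 1)) φ - pb (H 0) φ - cobd (∑ i ∈ Finset.range (N + 1),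
      prism (H i) (H (i + 1)) φ) ∈ _
  rw [key]
  refine sum_mem fun i hi => ⟨δ, hδ, fun l hl => ?_⟩
  refine prism_eq_zero_of_subset _ _ _ _ fun l' hl' => hφ l' ?_
  have hi' : i + 1 ≤ N + 1 := by simpa [Nat.lt_succ_iff] using hi
  have hmem : ∀ j ≤ N + 1, (j : ℝ) / (N + 1 : ℕ) ∈ Set.Icc (0 : ℝ) 1 := fun j hj =>
    ⟨by positivity, by rw [div_le_one hN0]; exact_mod_cast hj⟩
  have hrep : ∀ y ∈ l', ∃ x ∈ l, ∃ j, (j = i ∨ j = i + 1) ∧ H j x = y := by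
    intro y hy
    have := hl' y hy
    simp only [List.mem_append, List.mem_map] at this
    rcases this with ⟨x, hx, rfl⟩ | ⟨x, hx, rfl⟩
    · exact ⟨x, hx, i, Or.inl rfl, rfl⟩
    · exact ⟨x, hx, i + 1, Or.inr rfl, rfl⟩
  have hjle : ∀ j, (j = i ∨ j = i + 1) → j ≤ N + 1 := by omega
  have hdist : ∀ j k, (j = i ∨ j = i + 1) → (k = i ∨ k = i + 1) →
      dist ((j : ℝ) / (N + 1 : ℕ)) ((k : ℝ) / (N + 1 : ℕ)) < δ := by
    intro j k hj hk
    have h1 : |(j : ℝ) - k| ≤ 1 := by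
      rcases hj with rfl | rfl <;> rcases hk with rfl | rfl <;> simp
    rw [Real.dist_eq, ← sub_div, abs_div, abs_of_pos hN0]
    refine lt_of_le_of_lt ?_ hN
    rw [show ((N : ℝ) + 1) = (N + 1 : ℕ) by push_cast; rfl]
    gcongr
  refine ⟨fun y hy => ?_, fun y hy y' hy' => ?_⟩
  · obtain ⟨x, hx, j, hj, rfl⟩ := hrep y hy
    exact hY _ (hmem j (hjle j hj)) x (hl.1 x hx)
  · obtain ⟨x, hx, j, hj, rfl⟩ := hrep y hy
    obtain ⟨x', hx', j', hj', rfl⟩ := hrep y' hy'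
    refine h' _ ⟨hmem j (hjle j hj), hl.1 x hx⟩ _ ⟨hmem j' (hjle j' hj'), hl.1 x' hx'⟩ ?_
    rw [Prod.dist_eq]
    exact max_lt (hdist j j' hj hj') (hl.2 x hx x' hx')

lemma homotopy_mem_Bd {F : Set (X → X)} {F' : Set (X' → X')} {Y : Set X} {Y' : Set X'}
    (h : ℝ × X → X') (huc : UniformContinuousOn h (Set.Icc 0 1 ×ˢ Y))
    (hY : ∀ t ∈ Set.Icc (0 : ℝ) 1, ∀ x ∈ Y, h (t, x) ∈ Y')
    (hF : ∀ f ∈ F, ∃ f' ∈ F', ∀ t x, h (t, f x) = f' (h (t, x))) {φ : List X' → Λ}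
    (hφ : cobd φ ∈ LZ (Λ := Λ) Y') (hinv : φ ∈ inv (Λ := Λ) F') :
    pb (fun x => h (1, x)) φ - pb (fun x => h (0, x)) φ ∈ Bd (Λ := Λ) F Y := by
  obtain ⟨N, hN⟩ := homotopy_prism h huc hY hφ
  refine ⟨_, sum_mem fun i _ => ?_, by simp [Finset.sum_apply], hN⟩
  intro f hf
  obtain ⟨f', hf', e⟩ := hF f hf
  rw [prism_pb _ _ f f' (fun x => h ((i : ℝ) / N, x)) (fun x => h (((i + 1 : ℕ) : ℝ) / N, x))
    (fun x => e _ _) (fun x => e _ _), hinv f' hf']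

/-- Cocycles that become coboundaries on two pieces are, on the union, given by a cut. -/
lemma glue {E D₁ D₂ B : Set X} {c : X → Λ}
    (hcov : ∃ ε > 0, ∀ l, Small ε E l → (∀ x ∈ l, x ∈ D₁ ∧ c x = 1) ∨
      (∀ x ∈ l, x ∈ D₂ ∧ c x = 0) ∨ (∀ x ∈ l, x ∈ D₁ ∧ x ∈ D₂ ∧ x ∈ B))
    {α ψ₁ ψ₂ ω : List X → Λ} (h₁ : α - cobd ψ₁ ∈ LZ (Λ := Λ) D₁)
    (h₂ : α - cobd ψ₂ ∈ LZ (Λ := Λ) D₂) (hB : ψ₁ - ψ₂ - ω ∈ LZ (Λ := Λ) B)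
    (h1 : ψ₁ [] = 0) (h2 : ψ₂ [] = 0) :
    α - cobd (ψ₂ + mulv c (ψ₁ - ψ₂)) + dcup c ω ∈ LZ (Λ := Λ) E := by
  obtain ⟨ε₀, hε₀, hcov⟩ := hcov
  obtain ⟨ε₁, hε₁, h₁⟩ := h₁
  obtain ⟨ε₂, hε₂, h₂⟩ := h₂
  obtain ⟨ε₃, hε₃, hB⟩ := hB
  have e : α - cobd (ψ₂ + mulv c (ψ₁ - ψ₂)) + dcup c ω =
      (α - cobd ψ₂) - mulv c (cobd ψ₁ - cobd ψ₂) - dcup c (ψ₁ - ψ₂ - ω) := by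
    rw [map_add, cobd_mulv _ _ (by simp [h1, h2])]
    simp only [map_sub]; abel
  rw [e]
  refine ⟨min (min ε₀ ε₁) (min ε₂ ε₃), by positivity, fun l hl => ?_⟩
  have s0 := hl.mono ((min_le_left _ _).trans (min_le_left _ _)) subset_rfl fun _ h => h
  have s1 : ∀ l', (∀ x ∈ l', x ∈ D₁) → (∀ x ∈ l', x ∈ l) → Small ε₁ D₁ l' := fun l' h hs =>
    ⟨h, (hl.mono ((min_le_left _ _).trans (min_le_right _ _)) subset_rfl hs).2⟩
  have s2 : ∀ l', (∀ x ∈ l', x ∈ D₂) → (∀ x ∈ l', x ∈ l) → Small ε₂ D₂ l' := fun l' h hs =>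
    ⟨h, (hl.mono ((min_le_right _ _).trans (min_le_left _ _)) subset_rfl hs).2⟩
  have s3 : ∀ l', (∀ x ∈ l', x ∈ B) → (∀ x ∈ l', x ∈ l) → Small ε₃ B l' := fun l' h hs =>
    ⟨h, (hl.mono ((min_le_right _ _).trans (min_le_right _ _)) subset_rfl hs).2⟩
  have hd : ∀ χ : List X → Λ, ∀ k : Λ, (∀ x ∈ l, c x = k) → dcup c χ l = 0 := by
    intro χ k hk
    rcases l with _ | ⟨x, _ | ⟨y, l⟩⟩
    · rfl
    · rfl
    · rw [dcup_cons_cons, hk x (by simp), hk y (by simp)]; ring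
  have hm : ∀ χ : List X → Λ, χ [] = 0 → ∀ k : Λ, (∀ x ∈ l, c x = k) → mulv c χ l = k * χ l := by
    intro χ h0 k hk
    rcases l with _ | ⟨x, l⟩
    · simp [h0]
    · rw [mulv_cons, hk x (by simp)]
  simp only [Pi.sub_apply]
  rcases hcov l s0 with h | h | h
  · rw [hd _ 1 fun x hx => (h x hx).2, hm _ (by simp) 1 fun x hx => (h x hx).2]
    have := h₁ l (s1 l (fun x hx => (h x hx).1) fun _ h => h)
    simp only [Pi.sub_apply] at this ⊢
    linear_combination this
  · rw [hd _ 0 fun x hx => (h x hx).2, hm _ (by simp) 0 fun x hx => (h x hx).2]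
    have := h₂ l (s2 l (fun x hx => (h x hx).1) fun _ h => h)
    simp only [Pi.sub_apply] at this ⊢
    linear_combination this
  · have t1 := h₁ l (s1 l (fun x hx => (h x hx).1) fun _ h => h)
    have t2 := h₂ l (s2 l (fun x hx => (h x hx).2.1) fun _ h => h)
    have t3 : ∀ l', (∀ x ∈ l', x ∈ l) → (ψ₁ - ψ₂ - ω) l' = 0 := fun l' hs =>
      hB l' (s3 l' (fun x hx => (h x (hs x hx)).2.2) hs)
    simp only [Pi.sub_apply] at t1 t2
    rw [t2]
    rcases l with _ | ⟨x, _ | ⟨y, l⟩⟩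
    · simp
    · simp only [mulv_cons, dcup_singleton, Pi.sub_apply]
      linear_combination (c x) * (t1 - t2)
    · rw [dcup_cons_cons, t3 _ (by simp +contextual)]
      simp only [mulv_cons, Pi.sub_apply]
      linear_combination (c x) * (t1 - t2)

end Local

section Sphere
variable {m : ℕ}

/-- Normalization of `v`, with the default value `x` when `v = 0`. -/
def nrm (x : Sph m) (v : EuclideanSpace ℝ (Fin (m + 1))) : Sph m :=
  if h : v = 0 then x else ⟨‖v‖⁻¹ • v, by
    rw [mem_sphere_zero_iff_norm, norm_smul, norm_inv, norm_norm,
      inv_mul_cancel₀ (norm_ne_zero_iff.2 h)]⟩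

lemma nrm_coe (x : Sph m) {v : EuclideanSpace ℝ (Fin (m + 1))} (h : v ≠ 0) :
    (nrm x v : EuclideanSpace ℝ (Fin (m + 1))) = ‖v‖⁻¹ • v := by
  rw [nrm, dif_neg h]

lemma sph_norm (x : Sph m) : ‖(x : EuclideanSpace ℝ (Fin (m + 1)))‖ = 1 :=
  mem_sphere_zero_iff_norm.1 x.2

lemma nrm_of_norm_one (x : Sph m) (y : Sph m) : nrm x y.1 = y := by
  have h : (y : EuclideanSpace ℝ (Fin (m + 1))) ≠ 0 := by
    rw [← norm_ne_zero_iff, sph_norm]; exact one_ne_zero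
  ext1
  rw [nrm_coe x h, sph_norm, inv_one, one_smul]

lemma nrm_neg (x : Sph m) (v : EuclideanSpace ℝ (Fin (m + 1))) : nrm (-x) (-v) = -nrm x v := by
  by_cases h : v = 0
  · simp [nrm, h]
  · ext1
    rw [nrm_coe _ (neg_ne_zero.2 h), coe_neg_sphere, nrm_coe _ h, norm_neg, smul_neg]

lemma ucOn_nrm {T : Type*} [UniformSpace T] {K : Set T} (hK : IsCompact K) (x : T → Sph m)
    {v : T → EuclideanSpace ℝ (Fin (m + 1))} (hv : ContinuousOn v K) (h0 : ∀ t ∈ K, v t ≠ 0) :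
    UniformContinuousOn (fun t => nrm (x t) (v t)) K := by
  apply hK.uniformContinuousOn_of_continuous
  rw [Topology.IsInducing.subtypeVal.continuousOn_iff]
  have : ContinuousOn (fun t => ‖v t‖⁻¹ • v t) K :=
    (hv.norm.inv₀ fun t ht => norm_ne_zero_iff.2 (h0 t ht)).smul hv
  exact this.congr fun t ht => nrm_coe _ (h0 t ht)

/-- The point with coordinate `k` equal to one. -/
def pole (k : Fin (m + 1)) : Sph m :=
  ⟨EuclideanSpace.single k 1, by simp⟩

/-- The subsphere where all coordinates beyond `k` vanish. -/
def sub (k : Fin (m + 1)) : Set (Sph m) := {x | ∀ i, k < i → x.1 i = 0}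

lemma continuous_coord (k : Fin (m + 1)) : Continuous fun x : Sph m => x.1 k := by fun_prop

lemma isClosed_sub (k : Fin (m + 1)) : IsClosed (sub k) := by
  have : sub k = ⋂ i, ⋂ (_ : k < i), {x : Sph m | x.1 i = 0} := by
    ext x; simp [sub]
  rw [this]
  exact isClosed_iInter fun i => isClosed_iInter fun _ =>
    isClosed_eq (continuous_coord i) continuous_const

lemma sub_mono {k k' : Fin (m + 1)} (h : k ≤ k') : sub k ⊆ sub k' :=
  fun _ hx i hi => hx i (h.trans_lt hi)

lemma pole_mem_sub {j k : Fin (m + 1)} (h : j ≤ k) : pole j ∈ sub k := by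
  intro i hi
  have : i ≠ j := (h.trans_lt hi).ne'
  simp [pole, this]

lemma neg_mem_sub {k : Fin (m + 1)} {x : Sph m} (h : x ∈ sub k) : -x ∈ sub k := by
  intro i hi
  simp [h i hi]

lemma nrm_mem_sub {k : Fin (m + 1)} {x : Sph m} {v : EuclideanSpace ℝ (Fin (m + 1))}
    (hv : v ≠ 0) (h : ∀ i, k < i → v i = 0) : nrm x v ∈ sub k := by
  intro i hi
  rw [nrm_coe x hv]
  simp [h i hi]

lemma norm_sq_eq (x : Sph m) : ∑ i, x.1 i ^ 2 = 1 := by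
  have := EuclideanSpace.real_norm_sq_eq x.1
  rw [sph_norm] at this
  rw [← this]; norm_num

lemma abs_coord_sub_le (x y : Sph m) (i : Fin (m + 1)) : |x.1 i - y.1 i| ≤ dist x y := by
  rw [Subtype.dist_eq, dist_eq_norm]
  have := PiLp.norm_apply_le (x.1 - y.1) i
  simpa using this

/-- Straight-line contraction towards the pole `σ • pole k`. -/
def towards (k : Fin (m + 1)) (σ t : ℝ) (x : Sph m) : EuclideanSpace ℝ (Fin (m + 1)) :=
  (1 - t) • x.1 + (t * σ) • EuclideanSpace.single k 1

lemma continuous_towards (k : Fin (m + 1)) (σ : ℝ) :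
    Continuous fun p : ℝ × Sph m => towards k σ p.1 p.2 := by
  unfold towards; fun_prop

lemma towards_ne_zero {k : Fin (m + 1)} {σ t : ℝ} (hσ : σ ^ 2 = 1) (ht : t ∈ Icc (0 : ℝ) 1)
    {x : Sph m} (hx : -(1 / 2) ≤ σ * x.1 k) : towards k σ t x ≠ 0 := by
  intro h
  have hk : (1 - t) * x.1 k + t * σ = 0 := by
    have := congrArg (fun v : EuclideanSpace ℝ (Fin (m + 1)) => v k) h
    simpa [towards] using this
  have hn : (1 - t) * 1 = t := by
    have h1 : (1 - t) • x.1 = -((t * σ) • EuclideanSpace.single k 1) :=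
      eq_neg_of_add_eq_zero_left h
    have h2 := congrArg norm h1
    have hs : |σ| = 1 := by
      rw [← Real.sqrt_sq_eq_abs, hσ, Real.sqrt_one]
    rw [norm_neg, norm_smul, norm_smul, sph_norm] at h2
    simpa [abs_of_nonneg (sub_nonneg.2 ht.2), abs_of_nonneg ht.1, abs_mul, hs] using h2
  have ht2 : t = 1 / 2 := by linarith
  subst ht2
  have : x.1 k = -σ := by linarith
  rw [this] at hx
  nlinarith

lemma towards_zero (k : Fin (m + 1)) (σ : ℝ) (x : Sph m) : towards k σ 0 x = x.1 := by
  simp [towards]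

/-- The large cap of `sub k` around the pole of sign `σ`. -/
def cap (k : Fin (m + 1)) (σ : ℝ) : Set (Sph m) := sub k ∩ {x | -(1 / 2) ≤ σ * x.1 k}

/-- The hemisphere of `sub k` around the pole of sign `σ`. -/
def hemi (k : Fin (m + 1)) (σ : ℝ) : Set (Sph m) := sub k ∩ {x | 0 ≤ σ * x.1 k}

/-- The equatorial band of `sub k`. -/
def band (k : Fin (m + 1)) : Set (Sph m) := sub k ∩ {x | |x.1 k| ≤ 1 / 2}

lemma isCompact_cap (k : Fin (m + 1)) (σ : ℝ) : IsCompact (cap k σ) :=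
  ((isClosed_sub k).inter (isClosed_le continuous_const
    (continuous_const.mul (continuous_coord k)))).isCompact

lemma isCompact_band (k : Fin (m + 1)) : IsCompact (band k) :=
  ((isClosed_sub k).inter (isClosed_le (continuous_coord k).abs continuous_const)).isCompact

lemma hemi_subset_cap (k : Fin (m + 1)) (σ : ℝ) : hemi k σ ⊆ cap k σ :=
  fun _ hx => ⟨hx.1, by have := hx.2; simp only [mem_ofPred_eq] at this ⊢; linarith⟩

lemma band_subset_cap {k : Fin (m + 1)} {σ : ℝ} (hσ : σ = 1 ∨ σ = -1) : band k ⊆ cap k σ := by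
  intro x hx
  have hb : |x.1 k| ≤ 1 / 2 := hx.2
  obtain ⟨h1, h2⟩ := abs_le.1 hb
  refine ⟨hx.1, ?_⟩
  show -(1 / 2) ≤ σ * x.1 k
  rcases hσ with rfl | rfl <;> linarith

lemma uniformContinuous_neg_sph : UniformContinuous (Neg.neg : Sph m → Sph m) :=
  CompactSpace.uniformContinuous_of_continuous continuous_neg

/-- The contraction of a cap to its pole. -/
def capHtpy (k : Fin (m + 1)) (σ : ℝ) (p : ℝ × Sph m) : Sph m := nrm p.2 (towards k σ p.1 p.2)

lemma ucOn_capHtpy (k : Fin (m + 1)) {σ : ℝ} (hσ : σ ^ 2 = 1) :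
    UniformContinuousOn (capHtpy k σ) (Icc 0 1 ×ˢ cap k σ) :=
  ucOn_nrm (isCompact_Icc.prod (isCompact_cap k σ)) _ (continuous_towards k σ).continuousOn
    fun _ hp => towards_ne_zero hσ hp.1 hp.2.2

lemma capHtpy_mem_sub {k : Fin (m + 1)} {σ : ℝ} (hσ : σ ^ 2 = 1) {t : ℝ} (ht : t ∈ Icc (0 : ℝ) 1)
    {x : Sph m} (hx : x ∈ cap k σ) : capHtpy k σ (t, x) ∈ sub k := by
  refine nrm_mem_sub (towards_ne_zero hσ ht hx.2) fun i hi => ?_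
  simp [towards, hx.1 i hi, hi.ne']

lemma capHtpy_mem_hemi {k : Fin (m + 1)} {σ : ℝ} (hσ : σ ^ 2 = 1) {t : ℝ}
    (ht : t ∈ Icc (0 : ℝ) 1) {x : Sph m} (hx : x ∈ hemi k σ) : capHtpy k σ (t, x) ∈ hemi k σ := by
  have hc := hemi_subset_cap k σ hx
  refine ⟨capHtpy_mem_sub hσ ht hc, ?_⟩
  have h1 := hx.2
  have h2 := ht.1
  have h3 := sub_nonneg.2 ht.2
  simp only [mem_ofPred_eq] at h1 ⊢
  rw [capHtpy, nrm_coe _ (towards_ne_zero hσ ht hc.2)]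
  simp only [towards, PiLp.smul_apply, PiLp.add_apply, smul_eq_mul, PiLp.single_apply, if_true]
  have : 0 ≤ (1 - t) * (σ * x.1 k) + t * σ ^ 2 := by rw [hσ]; positivity
  calc (0 : ℝ) ≤ _ := mul_nonneg (inv_nonneg.2 (norm_nonneg (towards k σ t x))) this
    _ = _ := by simp only [towards]; ring

lemma capHtpy_zero (k : Fin (m + 1)) (σ : ℝ) (x : Sph m) : capHtpy k σ (0, x) = x := by
  rw [capHtpy, towards_zero, nrm_of_norm_one]

lemma capHtpy_one_pos (k : Fin (m + 1)) (x : Sph m) : capHtpy k 1 (1, x) = pole k := by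
  rw [capHtpy, ← nrm_of_norm_one x (pole k)]
  simp [towards, pole]

lemma capHtpy_one_neg (k : Fin (m + 1)) (x : Sph m) : capHtpy k (-1) (1, x) = -pole k := by
  rw [capHtpy, ← nrm_of_norm_one x (-pole k)]
  simp [towards, pole]

/-- Shrinking of the coordinate `k`. -/
def flat (k : Fin (m + 1)) (t : ℝ) (x : Sph m) : EuclideanSpace ℝ (Fin (m + 1)) :=
  x.1 - (t * x.1 k) • EuclideanSpace.single k 1

lemma flat_apply (k : Fin (m + 1)) (t : ℝ) (x : Sph m) (i : Fin (m + 1)) :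
    flat k t x i = if i = k then (1 - t) * x.1 k else x.1 i := by
  simp only [flat, PiLp.sub_apply, PiLp.smul_apply, smul_eq_mul, PiLp.single_apply]
  split_ifs with h
  · subst h; ring
  · ring

lemma continuous_flat (k : Fin (m + 1)) :
    Continuous fun p : ℝ × Sph m => flat k p.1 p.2 := by
  unfold flat; fun_prop

lemma norm_flat_sq (k : Fin (m + 1)) (t : ℝ) (x : Sph m) :
    ‖flat k t x‖ ^ 2 = 1 - x.1 k ^ 2 + ((1 - t) * x.1 k) ^ 2 := by
  have hx := norm_sq_eq x
  rw [← Finset.add_sum_erase _ _ (Finset.mem_univ k)] at hx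
  rw [EuclideanSpace.real_norm_sq_eq, ← Finset.add_sum_erase _ _ (Finset.mem_univ k),
    flat_apply, if_pos rfl,
    Finset.sum_congr rfl fun i hi => by
      rw [flat_apply, if_neg (Finset.ne_of_mem_erase hi)]]
  linear_combination hx

lemma band_sq_le {k : Fin (m + 1)} {x : Sph m} (hx : x ∈ band k) : x.1 k ^ 2 ≤ (1 / 2) ^ 2 := by
  have hb : |x.1 k| ≤ 1 / 2 := hx.2
  exact sq_le_sq' (by linarith [(abs_le.1 hb).1]) (abs_le.1 hb).2

lemma flat_ne_zero {k : Fin (m + 1)} {x : Sph m} (hx : x ∈ band k) (t : ℝ) : flat k t x ≠ 0 := by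
  have h1 := norm_flat_sq k t x
  have h2 := band_sq_le hx
  intro h
  rw [h, norm_zero] at h1
  nlinarith [sq_nonneg ((1 - t) * x.1 k)]

/-- The retraction of a band onto its equator. -/
def bandHtpy (k : Fin (m + 1)) (p : ℝ × Sph m) : Sph m := nrm p.2 (flat k p.1 p.2)

lemma ucOn_bandHtpy (k : Fin (m + 1)) :
    UniformContinuousOn (bandHtpy k) (Icc 0 1 ×ˢ band k) :=
  ucOn_nrm (isCompact_Icc.prod (isCompact_band k)) _ (continuous_flat k).continuousOn
    fun _ hp => flat_ne_zero hp.2 _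

lemma bandHtpy_mem {k : Fin (m + 1)} {t : ℝ} (ht : t ∈ Icc (0 : ℝ) 1)
    {x : Sph m} (hx : x ∈ band k) : bandHtpy k (t, x) ∈ band k := by
  have h0 := flat_ne_zero hx t
  refine ⟨nrm_mem_sub h0 fun i hi => ?_, ?_⟩
  · rw [flat_apply, if_neg hi.ne', hx.1 i hi]
  · have h1 := norm_flat_sq k t x
    have h2 := band_sq_le hx
    have h3 : 0 < ‖flat k t x‖ := norm_pos_iff.2 h0
    simp only [mem_ofPred_eq]
    rw [bandHtpy, nrm_coe _ h0, PiLp.smul_apply, flat_apply, if_pos rfl, smul_eq_mul, abs_mul,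
      abs_of_pos (inv_pos.2 h3), inv_mul_le_iff₀ h3]
    apply abs_le_of_sq_le_sq _ (by positivity)
    have h4 : (1 - t) ^ 2 ≤ 1 := by nlinarith [ht.1, ht.2]
    have h5 : ((1 - t) * x.1 k) ^ 2 ≤ x.1 k ^ 2 := by
      rw [mul_pow]; nlinarith [sq_nonneg (x.1 k)]
    nlinarith

lemma bandHtpy_zero (k : Fin (m + 1)) (x : Sph m) : bandHtpy k (0, x) = x := by
  rw [bandHtpy, show flat k 0 x = x.1 by simp [flat], nrm_of_norm_one]

/-- The retraction of a band onto its equator. -/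
def retr (k : Fin (m + 1)) (x : Sph m) : Sph m := bandHtpy k (1, x)

lemma retr_mem {j k : Fin (m + 1)} (hjk : (k : ℕ) = j + 1) {x : Sph m} (hx : x ∈ band k) :
    retr k x ∈ sub j := by
  refine nrm_mem_sub (flat_ne_zero hx 1) fun i hi => ?_
  rw [flat_apply]
  split_ifs with h
  · ring
  · exact hx.1 i (by rw [Fin.lt_def] at hi ⊢; rw [Fin.ext_iff] at h; omega)

lemma retr_of_mem {j k : Fin (m + 1)} (hjk : j < k) {x : Sph m} (hx : x ∈ sub j) :
    retr k x = x := by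
  rw [retr, bandHtpy, show flat k 1 x = x.1 by simp [flat, hx k hjk], nrm_of_norm_one]

lemma sub_subset_band {j k : Fin (m + 1)} (hjk : j < k) : sub j ⊆ band k :=
  fun x hx => ⟨sub_mono hjk.le hx, by simp [hx k hjk]⟩

lemma ucOn_retr (k : Fin (m + 1)) : UniformContinuousOn (retr k) (band k) := by
  have := (ucOn_bandHtpy k).comp (g := bandHtpy k) (f := fun x => ((1 : ℝ), x)) (s := band k)
    (t := Icc 0 1 ×ˢ band k)
  refine this ?_ fun x hx => ⟨by simp, hx⟩
  exact (uniformContinuous_const.prodMk uniformContinuous_id).uniformContinuousOn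

/-- The cut along the equator. -/
def cut (Λ : Type*) [CommRing Λ] (k : Fin (m + 1)) (x : Sph m) : Λ := if 0 < x.1 k then 1 else 0

end Sphere

section Product
variable {m : ℕ} {Λ : Type*} [CommRing Λ] {S S' X Z : Type*} [PseudoMetricSpace X]
  [PseudoMetricSpace S] [PseudoMetricSpace S'] [PseudoMetricSpace Z]

/-- Self-maps acting on the second factor of a product. -/
def onSnd (S : Type*) (F : Set (Z → Z)) : Set (S × Z → S × Z) := (Prod.map id) '' F

lemma ucOn_prodMap {h : ℝ × S → S'} {Y : Set S} (hu : UniformContinuousOn h (Icc 0 1 ×ˢ Y)) :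
    UniformContinuousOn (fun p : ℝ × (S × Z) => (h (p.1, p.2.1), p.2.2))
      (Icc 0 1 ×ˢ (Prod.fst ⁻¹' Y)) := by
  rw [Metric.uniformContinuousOn_iff] at hu ⊢
  intro ε hε
  obtain ⟨δ, hδ, h⟩ := hu ε hε
  refine ⟨min δ ε, lt_min hδ hε, fun p hp q hq hpq => ?_⟩
  rw [Prod.dist_eq, Prod.dist_eq, max_lt_iff, max_lt_iff] at hpq
  rw [Prod.dist_eq, max_lt_iff]
  have hp' : (p.1, p.2.1) ∈ Icc (0 : ℝ) 1 ×ˢ Y := ⟨hp.1, hp.2⟩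
  have hq' : (q.1, q.2.1) ∈ Icc (0 : ℝ) 1 ×ˢ Y := ⟨hq.1, hq.2⟩
  refine ⟨h _ hp' _ hq' ?_, hpq.2.2.trans_le (min_le_right _ _)⟩
  rw [Prod.dist_eq, max_lt_iff]
  exact ⟨hpq.1.trans_le (min_le_left _ _), hpq.2.1.trans_le (min_le_left _ _)⟩

lemma homotopy_prod {F : Set (Z → Z)} {Y : Set S} {Y' : Set S'} {h : ℝ × S → S'}
    (hu : UniformContinuousOn h (Icc 0 1 ×ˢ Y)) (hY : ∀ t ∈ Icc (0 : ℝ) 1, ∀ x ∈ Y, h (t, x) ∈ Y')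
    {α : List (S' × Z) → Λ} (hα : cobd α ∈ LZ (Λ := Λ) (Prod.fst ⁻¹' Y'))
    (hinv : α ∈ inv (Λ := Λ) (onSnd S' F)) :
    pb (Prod.map (fun x => h (1, x)) id) α - pb (Prod.map (fun x => h (0, x)) id) α ∈
      Bd (Λ := Λ) (onSnd S F) (Prod.fst ⁻¹' Y) := by
  refine homotopy_mem_Bd (F := onSnd S F) (F' := onSnd S' F)
    (fun p : ℝ × (S × Z) => (h (p.1, p.2.1), p.2.2)) (ucOn_prodMap hu)
    (fun t ht x hx => hY t ht x.1 hx) ?_ hα hinv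
  rintro _ ⟨f, hf, rfl⟩
  exact ⟨_, ⟨f, hf, rfl⟩, fun t x => rfl⟩

omit [PseudoMetricSpace S] [PseudoMetricSpace Z] in
lemma pb_snd_mem_inv {F : Set (Z → Z)} {θ : List Z → Λ} (h : θ ∈ inv (Λ := Λ) F) :
    pb Prod.snd θ ∈ inv (Λ := Λ) (onSnd S F) := by
  refine pb_mem_inv (u := (Prod.snd : S × Z → Z)) ?_ h
  rintro _ ⟨f, hf, rfl⟩
  exact ⟨f, hf, rfl⟩

omit [PseudoMetricSpace S] in
lemma pb_mk_mem_inv {F : Set (Z → Z)} {α : List (S × Z) → Λ} (x : S)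
    (h : α ∈ inv (Λ := Λ) (onSnd S F)) : pb (fun z => (x, z)) α ∈ inv (Λ := Λ) F :=
  pb_mem_inv (u := fun z : Z => (x, z))
    (fun f hf => ⟨Prod.map id f, mem_image_of_mem _ hf, rfl⟩) h

lemma uc_mk (x : S) (Y : Set Z) : UniformContinuousOn (fun z : Z => (x, z)) Y :=
  (uniformContinuous_const.prodMk uniformContinuous_id).uniformContinuousOn

lemma pb_snd_mem_LZ {θ : List Z → Λ} (h : θ ∈ LZ (Λ := Λ) univ) (Y : Set (S × Z)) :
    pb Prod.snd θ ∈ LZ (Λ := Λ) Y :=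
  pb_mem_LZ (f := (Prod.snd : S × Z → Z)) uniformContinuous_snd.uniformContinuousOn
    (fun _ _ => mem_univ _) h

lemma pb_snd_mem_Bd {F : Set (Z → Z)} {θ : List Z → Λ} (h : θ ∈ Bd (Λ := Λ) F univ)
    (Y : Set (S × Z)) : pb Prod.snd θ ∈ Bd (Λ := Λ) (onSnd S F) Y := by
  refine pb_mem_Bd (u := (Prod.snd : S × Z → Z)) uniformContinuous_snd.uniformContinuousOn
    (fun _ _ => mem_univ _) ?_ h
  rintro _ ⟨f, hf, rfl⟩
  exact ⟨f, hf, rfl⟩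

lemma pb_mk_mem_LZ {Y : Set S} {α : List (S × Z) → Λ} {x : S} (hx : x ∈ Y)
    (h : α ∈ LZ (Λ := Λ) (Prod.fst ⁻¹' Y)) : pb (fun z => (x, z)) α ∈ LZ (Λ := Λ) univ :=
  pb_mem_LZ (f := fun z : Z => (x, z)) (uc_mk x _) (fun _ _ => hx) h

lemma pb_mk_mem_Bd {F : Set (Z → Z)} {Y : Set S} {α : List (S × Z) → Λ} {x : S} (hx : x ∈ Y)
    (h : α ∈ Bd (Λ := Λ) (onSnd S F) (Prod.fst ⁻¹' Y)) :
    pb (fun z => (x, z)) α ∈ Bd (Λ := Λ) F univ :=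
  pb_mem_Bd (u := fun z : Z => (x, z)) (uc_mk x _) (fun _ _ => hx)
    (fun f hf => ⟨Prod.map id f, mem_image_of_mem _ hf, rfl⟩) h

lemma cap_cover (Λ : Type*) [CommRing Λ] (k : Fin (m + 1)) (u : X → Sph m)
    (hu : ∀ x y, dist (u x) (u y) ≤ dist x y) :
    ∃ ε > 0, ∀ l, Small ε (u ⁻¹' sub k) l →
      (∀ x ∈ l, x ∈ u ⁻¹' cap k 1 ∧ (cut Λ k ∘ u) x = 1) ∨
      (∀ x ∈ l, x ∈ u ⁻¹' cap k (-1) ∧ (cut Λ k ∘ u) x = 0) ∨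
      (∀ x ∈ l, x ∈ u ⁻¹' cap k 1 ∧ x ∈ u ⁻¹' cap k (-1) ∧ x ∈ u ⁻¹' band k) := by
  refine ⟨1 / 2, by norm_num, fun l hl => ?_⟩
  have hd : ∀ x ∈ l, ∀ y ∈ l, |(u x).1 k - (u y).1 k| < 1 / 2 := fun x hx y hy =>
    (abs_coord_sub_le _ _ k).trans_lt ((hu x y).trans_lt (hl.2 x hx y hy))
  by_cases h1 : ∃ y ∈ l, 1 / 2 < (u y).1 k
  · obtain ⟨y, hy, hy'⟩ := h1
    refine Or.inl fun x hx => ?_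
    have := (abs_lt.1 (hd x hx y hy)).1
    have h0 : 0 < (u x).1 k := by linarith
    exact ⟨⟨hl.1 x hx, show -(1 / 2) ≤ 1 * (u x).1 k by linarith⟩, by simp [cut, h0]⟩
  by_cases h2 : ∃ y ∈ l, (u y).1 k < -(1 / 2)
  · obtain ⟨y, hy, hy'⟩ := h2
    refine Or.inr (Or.inl fun x hx => ?_)
    have := (abs_lt.1 (hd x hx y hy)).2
    have h0 : ¬ 0 < (u x).1 k := by linarith
    exact ⟨⟨hl.1 x hx, show -(1 / 2) ≤ -1 * (u x).1 k by linarith⟩, by simp [cut, h0]⟩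
  push Not at h1 h2
  refine Or.inr (Or.inr fun x hx => ⟨⟨hl.1 x hx, ?_⟩, ⟨hl.1 x hx, ?_⟩, hl.1 x hx, ?_⟩)
  · show -(1 / 2) ≤ 1 * (u x).1 k
    linarith [h2 x hx]
  · show -(1 / 2) ≤ -1 * (u x).1 k
    linarith [h1 x hx]
  · exact abs_le.2 ⟨h2 x hx, h1 x hx⟩

lemma dcup_cut_mem_LZ (k : Fin (m + 1)) (u : X → Sph m)
    (hu : ∀ x y, dist (u x) (u y) ≤ dist x y) {ω : List X → Λ}
    (h : ω ∈ LZ (Λ := Λ) (u ⁻¹' band k)) :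
    dcup (cut Λ k ∘ u) ω ∈ LZ (Λ := Λ) (u ⁻¹' sub k) := by
  have := glue (cap_cover Λ k u hu) (α := (0 : List X → Λ)) (ψ₁ := 0) (ψ₂ := 0) (ω := ω)
    (by simp) (by simp) (by simpa using h) rfl rfl
  simpa using this

lemma pole_zero_mem_cap {k : Fin (m + 1)} (hk : k ≠ 0) (σ : ℝ) : pole 0 ∈ cap k σ := by
  refine ⟨pole_mem_sub (Fin.zero_le k), ?_⟩
  show -(1 / 2) ≤ σ * (pole 0).1 k
  simp [pole, hk]

lemma capHtpy_one_const {k : Fin (m + 1)} {σ : ℝ} (hσ : σ = 1 ∨ σ = -1) :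
    ∃ P, ∀ x, capHtpy k σ (1, x) = P := by
  rcases hσ with rfl | rfl
  · exact ⟨_, capHtpy_one_pos k⟩
  · exact ⟨_, capHtpy_one_neg k⟩

/-- On a cap, a cocycle is cohomologous to one pulled back from the second factor. -/
lemma sub_pb_snd_mem_Bd_cap {k : Fin (m + 1)} (hk : k ≠ 0) {σ : ℝ} (hσ : σ = 1 ∨ σ = -1)
    {F : Set (Z → Z)} {α : List (Sph m × Z) → Λ}
    (hα : cobd α ∈ LZ (Λ := Λ) (Prod.fst ⁻¹' sub k)) (hinv : α ∈ inv (Λ := Λ) (onSnd (Sph m) F)) :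
    α - pb Prod.snd (pb (fun z => (pole 0, z)) α) ∈
      Bd (Λ := Λ) (onSnd (Sph m) F) (Prod.fst ⁻¹' cap k σ) := by
  have hσ2 : σ ^ 2 = 1 := by rcases hσ with rfl | rfl <;> norm_num
  obtain ⟨P, hP⟩ := capHtpy_one_const (m := m) (k := k) hσ
  have h1 := homotopy_prod (F := F) (ucOn_capHtpy k hσ2)
    (fun t ht x hx => capHtpy_mem_sub hσ2 ht hx) hα hinv
  simp only [hP, capHtpy_zero] at h1
  have e0 : Prod.map (fun x : Sph m => x) (id : Z → Z) = id := rfl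
  have e1 : (Prod.map (fun _ : Sph m => P) (id : Z → Z)) = (fun z => (P, z)) ∘ Prod.snd := rfl
  rw [e0, pb_id, e1, ← pb_pb] at h1
  have h2 := pb_snd_mem_Bd (S := Sph m) (pb_mk_mem_Bd (pole_zero_mem_cap hk σ) h1)
    (Prod.fst ⁻¹' cap k σ)
  rw [map_sub, map_sub, pb_pb (fun z => (pole 0, z)) Prod.snd] at h2
  have e2 : (Prod.snd ∘ fun z : Z => (pole (m := m) 0, z)) = id := rfl
  rw [e2, pb_id] at h2
  have := sub_mem h2 h1
  convert this using 1
  abel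

end Product

section Fundamental
variable {m : ℕ} {Λ : Type*} [CommRing Λ] {Z : Type*} [PseudoMetricSpace Z]

lemma dist_fst_le (x y : Sph m × Z) : dist x.1 y.1 ≤ dist x y := by
  rw [Prod.dist_eq]; exact le_max_left _ _

/-- The induced map of a band retraction on a product pulls invariant cocycles back to
cohomologous ones. -/
lemma pb_retr_sub_mem_Bd {F : Set (Z → Z)} {k : Fin (m + 1)} {ω : List (Sph m × Z) → Λ}
    (hω : cobd ω ∈ LZ (Λ := Λ) (Prod.fst ⁻¹' band k))
    (hinv : ω ∈ inv (Λ := Λ) (onSnd (Sph m) F)) :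
    pb (Prod.map (retr k) id) ω - ω ∈ Bd (Λ := Λ) (onSnd (Sph m) F) (Prod.fst ⁻¹' band k) := by
  have h1 := homotopy_prod (F := F) (ucOn_bandHtpy k) (fun t ht x hx => bandHtpy_mem ht hx) hω hinv
  simp only [bandHtpy_zero] at h1
  have e0 : Prod.map (fun x : Sph m => x) (id : Z → Z) = id := rfl
  rwa [e0, pb_id] at h1

lemma ucOn_map_retr (k : Fin (m + 1)) :
    UniformContinuousOn (Prod.map (retr k) (id : Z → Z)) (Prod.fst ⁻¹' band k) := by
  have h1 := (ucOn_prodMap (Z := Z) (ucOn_bandHtpy k)).comp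
    (f := fun x : Sph m × Z => ((1 : ℝ), x)) (s := Prod.fst ⁻¹' band k)
    (uniformContinuous_const.prodMk uniformContinuous_id).uniformContinuousOn
    (fun x hx => ⟨by simp, hx⟩)
  exact h1

/-- Transfer of a relation on the equator to a relation on the band. -/
lemma pb_retr_mem_Bd {F : Set (Z → Z)} {j k : Fin (m + 1)} (hjk : (k : ℕ) = j + 1)
    {χ : List (Sph m × Z) → Λ}
    (h : χ ∈ Bd (Λ := Λ) (onSnd (Sph m) F) (Prod.fst ⁻¹' sub j)) :
    pb (Prod.map (retr k) id) χ ∈ Bd (Λ := Λ) (onSnd (Sph m) F) (Prod.fst ⁻¹' band k) := by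
  refine pb_mem_Bd (Y' := Prod.fst ⁻¹' sub j) (u := Prod.map (retr k) id)
    (ucOn_map_retr k) (fun x hx => retr_mem hjk hx) ?_ h
  rintro _ ⟨f, hf, rfl⟩
  exact ⟨_, ⟨f, hf, rfl⟩, rfl⟩

omit [PseudoMetricSpace Z] in
lemma pb_map_pb_snd (u : Sph m → Sph m) (θ : List Z → Λ) :
    pb (Prod.map u id) (pb Prod.snd θ) = pb Prod.snd θ := by
  rw [pb_pb]; rfl

lemma nil_of_cobd_mem_LZ_pole {k : Fin (m + 1)} [Nonempty Z] {α : List (Sph m × Z) → Λ}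
    (hα : cobd α ∈ LZ (Λ := Λ) (Prod.fst ⁻¹' sub k)) : α [] = 0 := by
  obtain ⟨z⟩ := ‹Nonempty Z›
  exact nil_of_cobd_mem_LZ hα ⟨(pole 0, z), pole_mem_sub (Fin.zero_le k)⟩

lemma mem_sub_zero {x : Sph m} (hx : x ∈ sub 0) : x = pole 0 ∨ x = -pole 0 := by
  have h1 := norm_sq_eq x
  have h2 : ∀ i ≠ 0, x.1 i = 0 := fun i hi => hx i (Fin.pos_iff_ne_zero.2 hi)
  rw [Finset.sum_eq_single 0 (fun i _ hi => by rw [h2 i hi]; ring) (by simp)] at h1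
  rcases sq_eq_one_iff.1 h1 with h | h
  · left
    ext i
    by_cases hi : i = 0
    · subst hi; simp [pole, h]
    · simp [pole, h2 i hi, hi]
  · right
    ext i
    by_cases hi : i = 0
    · subst hi; simp [pole, h]
    · simp [pole, h2 i hi, hi]

lemma cover_sub_zero (u : Z → Sph m) (hu : ∀ x y, dist (u x) (u y) ≤ dist x y) :
    ∃ ε > 0, ∀ l, Small ε (u ⁻¹' sub 0) l →
      (∀ x ∈ l, u x = pole 0) ∨ (∀ x ∈ l, u x = -pole 0) := by
  refine ⟨1, one_pos, fun l hl => ?_⟩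
  by_cases h : ∀ x ∈ l, u x = pole 0
  · exact Or.inl h
  push Not at h
  obtain ⟨y, hy, hy'⟩ := h
  have hy2 := (mem_sub_zero (hl.1 y hy)).resolve_left hy'
  refine Or.inr fun x hx => (mem_sub_zero (hl.1 x hx)).resolve_left fun hx' => ?_
  have h1 := (abs_coord_sub_le (u x) (u y) 0).trans ((hu x y).trans (hl.2 x hx y hy).le)
  rw [hx', hy2] at h1
  simp [pole] at h1
  norm_num at h1

/-- Cocycles over `ZMod 2` invariant under the antipode are pulled back from the second factor. -/
theorem antipode_invariant_cocycle [Nonempty Z] {F : Set (Z → Z)} (s : ℕ) (k : Fin (m + 1))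
    (hk : (k : ℕ) = s) (α : List (Sph m × Z) → ZMod 2)
    (hα : cobd α ∈ LZ (Λ := ZMod 2) (Prod.fst ⁻¹' sub k))
    (hinv : α ∈ inv (Λ := ZMod 2) (onSnd (Sph m) F)) (hneg : pb (Prod.map Neg.neg id) α = α) :
    ∃ θ ∈ inv (Λ := ZMod 2) F, cobd θ ∈ LZ (Λ := ZMod 2) univ ∧
      α - pb Prod.snd θ ∈ Bd (Λ := ZMod 2) (onSnd (Sph m) F) (Prod.fst ⁻¹' sub k) := by
  have hp : pole 0 ∈ sub k := pole_mem_sub (Fin.zero_le k)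
  refine ⟨pb (fun z => (pole 0, z)) α, pb_mk_mem_inv _ hinv, ?_, ?_⟩
  · rw [cobd_pb]; exact pb_mk_mem_LZ hp hα
  induction s generalizing k α with
  | zero =>
    obtain rfl : k = 0 := Fin.ext hk
    apply LZ_le_Bd
    obtain ⟨ε, hε, h⟩ := cover_sub_zero (m := m) (Prod.fst : Sph m × Z → Sph m) dist_fst_le
    refine ⟨ε, hε, fun l hl => ?_⟩
    have hmap : ∀ l : List (Sph m × Z), (∀ x ∈ l, x.1 = pole 0) →
        α ((l.map Prod.snd).map fun z => (pole 0, z)) = α l := by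
      intro l hl
      congr 1
      rw [List.map_map]
      conv_rhs => rw [← List.map_id l]
      refine List.map_congr_left fun x hx => ?_
      exact Prod.ext (hl x hx).symm rfl
    simp only [Pi.sub_apply, pb_apply]
    rcases h l hl with h | h
    · rw [hmap l h, sub_self]
    · have h1 := hmap (l.map (Prod.map Neg.neg id)) (by
        intro x hx
        obtain ⟨y, hy, rfl⟩ := List.mem_map.1 hx
        simp [h y hy])
      have h2 : α (l.map (Prod.map Neg.neg id)) = α l := congrFun hneg l
      have h3 : (l.map (Prod.map Neg.neg id)).map Prod.snd = l.map Prod.snd := by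
        rw [List.map_map]; rfl
      rw [h3, h2] at h1
      rw [h1, sub_self]
  | succ s ih =>
    have hk0 : k ≠ 0 := by rintro rfl; simp at hk
    set θ := pb (fun z => (pole (m := m) 0, z)) α with hθ
    set β := α - pb Prod.snd θ with hβ
    have hj : s < m + 1 := by omega
    set j : Fin (m + 1) := ⟨s, hj⟩
    have hjk : (k : ℕ) = j + 1 := hk
    have hjk' : j < k := by rw [Fin.lt_def]; omega
    set a : Sph m × Z → Sph m × Z := Prod.map Neg.neg id with ha
    have haa : a ∘ a = id := by funext x; exact Prod.ext (neg_neg x.1) rfl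
    have hβneg : pb a β = β := by
      rw [hβ, map_sub, hneg, ha, pb_map_pb_snd]
    obtain ⟨ψ, hψi, hψ0, hψ⟩ := sub_pb_snd_mem_Bd_cap hk0 (Or.inl rfl) hα hinv
    have hacap : UniformContinuousOn a (Prod.fst ⁻¹' cap k (-1)) :=
      (uniformContinuous_neg_sph.prodMap uniformContinuous_id).uniformContinuousOn
    have hψ' : β - cobd (pb a ψ) ∈ LZ (Λ := ZMod 2) (Prod.fst ⁻¹' cap k (-1)) := by
      rw [← hβneg, cobd_pb, ← map_sub]
      refine pb_mem_LZ hacap ?_ hψ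
      intro x hx
      refine ⟨neg_mem_sub hx.1, ?_⟩
      have : -(1 / 2) ≤ -1 * x.1.1 k := hx.2
      show -(1 / 2) ≤ 1 * (-x.1).1 k
      simpa using this
    have hψ'i : pb a ψ ∈ inv (Λ := ZMod 2) (onSnd (Sph m) F) := by
      refine pb_mem_inv ?_ hψi
      rintro _ ⟨f, hf, rfl⟩
      exact ⟨_, ⟨f, hf, rfl⟩, rfl⟩
    set ω := ψ - pb a ψ with hω
    have hωi : ω ∈ inv (Λ := ZMod 2) (onSnd (Sph m) F) := sub_mem hψi hψ'i
    have hωneg : pb a ω = ω := by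
      rw [hω, map_sub, pb_pb, haa, pb_id]
      funext l
      simp only [Pi.sub_apply, CharTwo.sub_eq_add, add_comm]
    have hωc : cobd ω ∈ LZ (Λ := ZMod 2) (Prod.fst ⁻¹' band k) := by
      have h1 := LZ_anti (preimage_mono (band_subset_cap (Or.inl rfl))) hψ
      have h2 := LZ_anti (preimage_mono (band_subset_cap (Or.inr rfl))) hψ'
      have := sub_mem h2 h1
      rwa [sub_sub_sub_cancel_left, ← map_sub] at this
    have hωj : cobd ω ∈ LZ (Λ := ZMod 2) (Prod.fst ⁻¹' sub j) :=
      LZ_anti (preimage_mono (sub_subset_band hjk')) hωc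
    have h1 := ih j rfl ω hωj hωi hωneg (pole_mem_sub (Fin.zero_le j))
    set θ' := pb (fun z => (pole (m := m) 0, z)) ω with hθ'
    have h2 := pb_retr_mem_Bd hjk h1
    rw [map_sub, pb_map_pb_snd] at h2
    have h3 := sub_mem h2 (pb_retr_sub_mem_Bd hωc hωi)
    rw [sub_sub_sub_cancel_left] at h3
    obtain ⟨η, hηi, hη0, hη⟩ := h3
    have hθ'c : cobd (pb Prod.snd θ') ∈ LZ (Λ := ZMod 2) (Prod.fst ⁻¹' cap k 1) := by
      rw [cobd_pb]
      refine pb_snd_mem_LZ ?_ _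
      rw [hθ', cobd_pb]
      exact pb_mk_mem_LZ (pole_mem_sub (Fin.zero_le j)) hωj
    have hθ'0 : θ' [] = 0 := by simp [hθ', hω, hψ0]
    have hθ'i : pb Prod.snd θ' ∈ inv (Λ := ZMod 2) (onSnd (Sph m) F) :=
      pb_snd_mem_inv (pb_mk_mem_inv _ hωi)
    have hg := glue (cap_cover (ZMod 2) k (Prod.fst : Sph m × Z → Sph m) dist_fst_le)
      (α := β) (ψ₁ := ψ - pb Prod.snd θ') (ψ₂ := pb a ψ) (ω := cobd η)
      (by rw [map_sub, sub_sub_eq_add_sub, add_sub_right_comm]; exact add_mem hψ hθ'c) hψ'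
      (by
        have : ψ - pb Prod.snd θ' - pb a ψ - cobd η = ω - pb Prod.snd θ' - cobd η := by
          rw [hω]; abel
        rw [this]; exact hη)
      (by simp [hψ0, hθ'0]) (by simpa using hψ0)
    have hc : ∀ f ∈ onSnd (Sph m) F, (cut (ZMod 2) k ∘ Prod.fst) ∘ f = cut (ZMod 2) k ∘ Prod.fst := by
      rintro _ ⟨f, hf, rfl⟩; rfl
    refine ⟨(pb a ψ + mulv (cut (ZMod 2) k ∘ Prod.fst) (ψ - pb Prod.snd θ' - pb a ψ)) +
      dcup (cut (ZMod 2) k ∘ Prod.fst) η, add_mem (add_mem hψ'i (mulv_mem_inv hc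
        (sub_mem (sub_mem hψi hθ'i) hψ'i))) (dcup_mem_inv hc hηi), by simp [hψ0], ?_⟩
    rw [map_add, cobd_dcup _ _ hη0, ← sub_sub, sub_neg_eq_add]
    exact hg

end Fundamental

section Ubar
variable {m : ℕ} {Λ : Type*} [CommRing Λ] {Z : Type*} [PseudoMetricSpace Z]

/-- The fundamental cochain of the subsphere of dimension `s`. -/
def ubar (m : ℕ) (Λ : Type*) [CommRing Λ] : ℕ → List (Sph m) → Λ
  | 0 => mulv (fun x => 1 - cut Λ 0 x) one
  | s + 1 => dcup (cut Λ (Fin.ofNat (m + 1) (s + 1)))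
      (pb (retr (Fin.ofNat (m + 1) (s + 1))) (ubar m Λ s))

lemma ubar_zero : ubar m Λ 0 = mulv (fun x => 1 - cut Λ 0 x) one := rfl

lemma ubar_succ {s : ℕ} {k : Fin (m + 1)} (hk : (k : ℕ) = s + 1) :
    ubar m Λ (s + 1) = dcup (cut Λ k) (pb (retr k) (ubar m Λ s)) := by
  have : Fin.ofNat (m + 1) (s + 1) = k := by
    ext; rw [Fin.val_ofNat, ← hk, Nat.mod_eq_of_lt k.2]
  rw [ubar, this]

lemma ubar_mem_supp (s : ℕ) : ubar m Λ s ∈ supp (Λ := Λ) (s + 1) := by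
  induction s with
  | zero => exact mulv_mem_supp _ one_mem_supp
  | succ s ih => exact dcup_mem_supp _ (pb_mem_supp _ ih)

lemma ubar_nil (s : ℕ) : ubar m Λ s [] = 0 := by cases s <;> rfl

lemma ubar_succ_singleton (s : ℕ) (x : Sph m) : ubar m Λ (s + 1) [x] = 0 := rfl

lemma cobd_ubar_mem_LZ (s : ℕ) (k : Fin (m + 1)) (hk : (k : ℕ) = s) :
    cobd (ubar m Λ s) ∈ LZ (Λ := Λ) (sub k) := by
  induction s generalizing k with
  | zero =>
    obtain rfl : k = 0 := Fin.ext hk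
    rw [ubar_zero, cobd_mulv _ _ one_nil, cobd_one, map_zero, add_zero]
    obtain ⟨ε, hε, h⟩ := cover_sub_zero (m := m) id (fun x y => le_rfl)
    refine dcup_mem_LZ_of_const _ ⟨ε, hε, fun x hx y hy hxy => ?_⟩ _
    have := h [x, y] ⟨by simpa using ⟨hx, hy⟩, by simpa [hε, dist_comm y x] using hxy⟩
    rcases this with h | h
    · rw [show x = pole 0 from h x (by simp), show y = pole 0 from h y (by simp)]
    · rw [show x = -pole 0 from h x (by simp), show y = -pole 0 from h y (by simp)]
  | succ s ih =>
    have hjk : s < m + 1 := by omega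
    rw [ubar_succ hk, cobd_dcup _ _ (by simp [ubar_nil]), cobd_pb]
    refine neg_mem (dcup_cut_mem_LZ k id (fun x y => le_rfl) ?_)
    exact pb_mem_LZ (ucOn_retr k) (fun x hx => retr_mem (j := ⟨s, hjk⟩) hk hx) (ih ⟨s, hjk⟩ rfl)

lemma mem_sub_last (x : Sph m) : x ∈ sub (Fin.last m) :=
  fun i hi => absurd (Fin.le_last i) (not_le.2 hi)

lemma sub_last : sub (Fin.last m) = univ := eq_univ_of_forall mem_sub_last

lemma cobd_ubar_last : cobd (ubar m Λ m) ∈ LZ (Λ := Λ) univ := by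
  rw [← sub_last]; exact cobd_ubar_mem_LZ m _ rfl

/-- Cocycles of low degree over a subsphere times `Z`. -/
theorem cocycle_decomposition [Nonempty Z]
    (hZ : ∀ θ : List Z → Λ, θ ∈ supp (Λ := Λ) 1 → cobd θ ∈ LZ (Λ := Λ) univ → θ [] = 0 →
      ∃ c : Λ, θ - c • one ∈ LZ (Λ := Λ) univ)
    (s : ℕ) (k : Fin (m + 1)) (hk : (k : ℕ) = s) (α : List (Sph m × Z) → Λ)
    (hα : cobd α ∈ LZ (Λ := Λ) (Prod.fst ⁻¹' sub k)) (hsupp : α ∈ supp (Λ := Λ) (s + 1)) :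
    ∃ c : Λ, α - pb Prod.snd (pb (fun z => (pole 0, z)) α) - c • pb Prod.fst (ubar m Λ s) ∈
      Bd (Λ := Λ) (onSnd (Sph m) ∅) (Prod.fst ⁻¹' sub k) := by
  have hp : ∀ k : Fin (m + 1), pole 0 ∈ sub k := fun k => pole_mem_sub (Fin.zero_le k)
  induction s generalizing k α with
  | zero =>
    obtain rfl : k = 0 := Fin.ext hk
    have hα0 : α [] = 0 := nil_of_cobd_mem_LZ_pole hα
    have hex : ∀ x ∈ sub (0 : Fin (m + 1)), ∃ c : Λ, pb (fun z => (x, z)) α - c • one ∈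
        LZ (Λ := Λ) univ := by
      intro x hx
      refine hZ _ (pb_mem_supp _ hsupp) ?_ (by simp [hα0])
      rw [cobd_pb]; exact pb_mk_mem_LZ hx hα
    obtain ⟨c₁, hc₁⟩ := hex _ (hp 0)
    obtain ⟨c₂, hc₂⟩ := hex _ (neg_mem_sub (hp 0))
    refine ⟨c₂ - c₁, LZ_le_Bd ?_⟩
    obtain ⟨ε, hε, h⟩ := cover_sub_zero (m := m) (Prod.fst : Sph m × Z → Sph m) dist_fst_le
    obtain ⟨ε', hε', h'⟩ := sub_mem (pb_snd_mem_LZ (S := Sph m) hc₂ univ)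
      (pb_snd_mem_LZ (S := Sph m) hc₁ univ)
    refine ⟨min ε ε', lt_min hε hε', fun l hl => ?_⟩
    have hl' := h' l (hl.mono (min_le_right _ _) (subset_univ _) fun _ h => h)
    have hmap : ∀ x : Sph m, (∀ y ∈ l, y.1 = x) →
        (l.map Prod.snd).map (fun z => (x, z)) = l := by
      intro x hl
      rw [List.map_map]
      conv_rhs => rw [← List.map_id l]
      refine List.map_congr_left fun y hy => ?_
      exact Prod.ext (hl y hy).symm rfl
    simp only [map_sub, map_smul, pb_one, Pi.sub_apply, Pi.smul_apply, pb_apply, ubar_zero,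
      smul_eq_mul] at hl' ⊢
    have hu : ∀ x : Sph m, (∀ y ∈ l, y.1 = x) →
        mulv (fun x => 1 - cut Λ 0 x) one (l.map Prod.fst) = (1 - cut Λ 0 x) * one l := by
      intro x hx
      rcases l with _ | ⟨y, l⟩
      · simp
      · simp [hx y (by simp), one]
    rcases h l (hl.mono (min_le_left _ _) subset_rfl fun _ h => h) with h | h
    · rw [hmap _ h, hu _ h, show cut Λ 0 (pole (m := m) 0) = 1 by simp [cut, pole]]
      ring
    · rw [hmap _ h] at hl'
      rw [hu _ h, show cut Λ 0 (-pole (m := m) 0) = 0 by simp [cut, pole]]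
      linear_combination hl'
  | succ s ih =>
    have hk0 : k ≠ 0 := by rintro rfl; simp at hk
    have hinv : ∀ φ : List (Sph m × Z) → Λ, φ ∈ inv (Λ := Λ) (onSnd (Sph m) (∅ : Set (Z → Z))) := by
      rintro φ _ ⟨f, hf, rfl⟩; exact hf.elim
    set β := α - pb Prod.snd (pb (fun z => (pole (m := m) 0, z)) α) with hβ
    have hβs : β ∈ supp (Λ := Λ) (s + 1 + 1) :=
      sub_mem hsupp (pb_mem_supp _ (pb_mem_supp _ hsupp))
    have hj : s < m + 1 := by omega
    set j : Fin (m + 1) := ⟨s, hj⟩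
    have hjk : (k : ℕ) = j + 1 := hk
    have hjk' : j < k := by rw [Fin.lt_def]; omega
    obtain ⟨ψ₁, -, h10, h1s, h1⟩ := exists_supp_of_mem_Bd
      (sub_pb_snd_mem_Bd_cap hk0 (Or.inl rfl) hα (hinv α)) hβs
    obtain ⟨ψ₂, -, h20, h2s, h2⟩ := exists_supp_of_mem_Bd
      (sub_pb_snd_mem_Bd_cap hk0 (Or.inr rfl) hα (hinv α)) hβs
    set ω := ψ₁ - ψ₂ with hω
    have hωc : cobd ω ∈ LZ (Λ := Λ) (Prod.fst ⁻¹' band k) := by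
      have := sub_mem (LZ_anti (preimage_mono (band_subset_cap (Or.inr rfl))) h2)
        (LZ_anti (preimage_mono (band_subset_cap (Or.inl rfl))) h1)
      rwa [sub_sub_sub_cancel_left, ← map_sub] at this
    have hωj : cobd ω ∈ LZ (Λ := Λ) (Prod.fst ⁻¹' sub j) :=
      LZ_anti (preimage_mono (sub_subset_band hjk')) hωc
    obtain ⟨c, hc⟩ := ih j rfl ω hωj (sub_mem h1s h2s)
    set θ' := pb (fun z => (pole (m := m) 0, z)) ω with hθ'
    have h3 := pb_retr_mem_Bd hjk hc
    set W := pb (Prod.fst : Sph m × Z → Sph m) (pb (retr k) (ubar m Λ s)) with hW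
    have eW : pb (Prod.map (retr k) (id : Z → Z)) (pb Prod.fst (ubar m Λ s)) = W := by
      rw [hW, pb_pb, pb_pb]; rfl
    rw [map_sub, map_sub, map_smul, pb_map_pb_snd, eW] at h3
    have h4 := sub_mem h3 (pb_retr_sub_mem_Bd hωc (hinv ω))
    obtain ⟨η, -, hη0, hη⟩ := h4
    have hθ'c : cobd (pb Prod.snd θ') ∈ LZ (Λ := Λ) (Prod.fst ⁻¹' cap k 1) := by
      rw [cobd_pb]
      refine pb_snd_mem_LZ ?_ _
      rw [hθ', cobd_pb]
      exact pb_mk_mem_LZ (hp j) hωj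
    have hθ'0 : θ' [] = 0 := by simp [hθ', hω, h10, h20]
    have hg := glue (cap_cover Λ k (Prod.fst : Sph m × Z → Sph m) dist_fst_le)
      (α := β) (ψ₁ := ψ₁ - pb Prod.snd θ') (ψ₂ := ψ₂) (ω := c • W + cobd η)
      (by rw [map_sub, sub_sub_eq_add_sub, add_sub_right_comm]; exact add_mem h1 hθ'c) h2
      (by
        convert hη using 1
        rw [hω]; abel)
      (by simp [h10, hθ'0]) h20
    refine ⟨-c, (ψ₂ + mulv (cut Λ k ∘ Prod.fst) (ψ₁ - pb Prod.snd θ' - ψ₂)) +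
      dcup (cut Λ k ∘ Prod.fst) η, hinv _, by simp [h20], ?_⟩
    have e2 : pb Prod.fst (ubar m Λ (s + 1)) = dcup (cut Λ k ∘ (Prod.fst : Sph m × Z → Sph m)) W := by
      rw [ubar_succ hk, dcup_pb]
    rw [map_add, cobd_dcup _ _ hη0, e2]
    convert hg using 1
    have e3 : dcup (cut Λ k ∘ (Prod.fst : Sph m × Z → Sph m)) (c • W + cobd η) =
        c • dcup (cut Λ k ∘ Prod.fst) W + dcup (cut Λ k ∘ Prod.fst) (cobd η) := by
      rw [map_add, map_smul]
    rw [e3]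
    module

lemma hemi_acyclic {k : Fin (m + 1)} (hk : k ≠ 0) {σ : ℝ} (hσ : σ = 1 ∨ σ = -1)
    {ψ : List (Sph m) → Λ} (h : cobd ψ ∈ LZ (Λ := Λ) (hemi k σ)) :
    ∃ η, ψ - cobd η ∈ LZ (Λ := Λ) (hemi k σ) := by
  have hσ2 : σ ^ 2 = 1 := by rcases hσ with rfl | rfl <;> norm_num
  obtain ⟨P, hP⟩ := capHtpy_one_const (m := m) (k := k) hσ
  have hP' : P ∈ hemi k σ := by
    rw [← hP (pole 0)]
    refine capHtpy_mem_hemi hσ2 (by simp) ⟨pole_mem_sub (Fin.zero_le k), ?_⟩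
    show 0 ≤ σ * (pole 0).1 k
    simp [pole, hk]
  obtain ⟨η, -, -, hη⟩ := homotopy_mem_Bd (F := ∅) (F' := ∅) (capHtpy k σ)
    ((ucOn_capHtpy k hσ2).mono (prod_mono subset_rfl (hemi_subset_cap k σ)))
    (fun t ht x hx => capHtpy_mem_hemi hσ2 ht hx) (by simp) h (fun _ hf => hf.elim)
  simp only [hP, capHtpy_zero] at hη
  have e0 : pb (fun x : Sph m => x) ψ = ψ := pb_id ψ
  rw [e0] at hη
  have e1 : ins P (cobd (pb (fun _ : Sph m => P) ψ)) = 0 := by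
    obtain ⟨ε, hε, h⟩ := h
    funext l
    rw [ins_apply, cobd_pb, pb_apply, Pi.zero_apply]
    have hl : ∀ x ∈ List.map (fun _ : Sph m => P) (P :: l), x = P := fun x hx => by
      obtain ⟨y, -, rfl⟩ := List.mem_map.1 hx; rfl
    refine h _ ⟨?_, ?_⟩
    · intro x hx
      rw [hl x hx]; exact hP'
    · intro x hx y hy
      rw [hl x hx, hl y hy, dist_self]; exact hε
  have e2 := cone_formula P (pb (fun _ : Sph m => P) ψ)
  rw [e1, zero_add] at e2
  refine ⟨ins P (pb (fun _ : Sph m => P) ψ) - η, ?_⟩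
  rw [map_sub, ← e2]
  convert neg_mem hη using 1
  abel

/-- Nontriviality of the fundamental cocycle. -/
theorem eq_zero_of_smul_ubar_mem (s : ℕ) (k : Fin (m + 1)) (hk : (k : ℕ) = s) (c : Λ)
    (ψ : List (Sph m) → Λ) (h : c • ubar m Λ s - cobd ψ ∈ LZ (Λ := Λ) (sub k)) : c = 0 := by
  induction s generalizing k ψ with
  | zero =>
    have hp : pole 0 ∈ sub k := pole_mem_sub (Fin.zero_le k)
    have h1 := singleton_of_mem_LZ h hp
    have h2 := singleton_of_mem_LZ h (neg_mem_sub hp)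
    have e1 : cut Λ 0 (pole (m := m) 0) = 1 := by simp [cut, pole]
    have e2 : cut Λ 0 (-pole (m := m) 0) = 0 := by simp [cut, pole]
    simp only [ubar_zero, Pi.sub_apply, Pi.smul_apply, mulv_cons, e1, e2, cobd_singleton,
      one_singleton, smul_eq_mul] at h1 h2
    linear_combination h2 - h1
  | succ s ih =>
    have hk0 : k ≠ 0 := by rintro rfl; simp at hk
    have hj : s < m + 1 := by omega
    set j : Fin (m + 1) := ⟨s, hj⟩
    have hjk : (k : ℕ) = j + 1 := hk
    have hjk' : j < k := by rw [Fin.lt_def]; omega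
    rw [ubar_succ hk] at h
    set ω := c • pb (retr k) (ubar m Λ s) with hω
    have h' : dcup (cut Λ k) ω - cobd ψ ∈ LZ (Λ := Λ) (sub k) := by rwa [hω, map_smul]
    have hωc : cobd ω ∈ LZ (Λ := Λ) (band k) := by
      rw [hω, map_smul, cobd_pb]
      exact Submodule.smul_mem _ _ (pb_mem_LZ (ucOn_retr k)
        (fun x hx => retr_mem hjk hx) (cobd_ubar_mem_LZ s j rfl))
    have hcut : ∀ x ∈ hemi k (-1), cut Λ k x = 0 := fun x hx => by
      have : 0 ≤ -1 * x.1 k := hx.2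
      simp [cut, show ¬ 0 < x.1 k by linarith]
    obtain ⟨η₂, hη₂⟩ : ∃ η, ψ - cobd η ∈ LZ (Λ := Λ) (hemi k (-1)) := by
      refine hemi_acyclic hk0 (Or.inr rfl) ?_
      have h1 : dcup (cut Λ k) ω ∈ LZ (Λ := Λ) (hemi k (-1)) :=
        dcup_mem_LZ_of_const _ ⟨1, one_pos, fun x hx y hy _ => by rw [hcut x hx, hcut y hy]⟩ _
      have := sub_mem h1 (LZ_anti (fun x hx => hx.1 : hemi k (-1) ⊆ sub k) h')
      rwa [sub_sub_cancel] at this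
    set ψ₁ := ψ - mulv (fun x => cut Λ k x - 1) ω with hψ₁
    obtain ⟨η₁, hη₁⟩ : ∃ η, ψ₁ - cobd η ∈ LZ (Λ := Λ) (hemi k 1) := by
      refine hemi_acyclic hk0 (Or.inl rfl) ?_
      have e1 : dcup (fun x => cut Λ k x - 1) ω = dcup (cut Λ k) ω := by
        funext l; rcases l with _ | ⟨x, _ | ⟨y, l⟩⟩ <;> simp
      rw [hψ₁, map_sub, cobd_mulv _ _ (by simp [hω, ubar_nil]), e1, ← sub_sub, sub_right_comm]
      have h1 : mulv (fun x => cut Λ k x - 1) (cobd ω) ∈ LZ (Λ := Λ) (hemi k 1) := by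
        obtain ⟨ε, hε, hωc⟩ := hωc
        refine ⟨min ε (1 / 2), by positivity, fun l hl => ?_⟩
        rcases l with _ | ⟨x, l⟩
        · rfl
        rw [mulv_cons]
        have hx : 0 ≤ 1 * x.1 k := (hl.1 x (by simp)).2
        rcases (show 0 ≤ x.1 k by linarith).lt_or_eq with hx | hx
        · simp [cut, hx]
        · rw [hωc, mul_zero]
          refine ⟨fun y hy => ⟨(hl.1 y hy).1, ?_⟩,
            (hl.mono (min_le_left _ _) subset_rfl fun _ h => h).2⟩
          have h1 := (abs_coord_sub_le y x k).trans ((hl.2 y hy x (by simp)).le.trans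
            (min_le_right _ _))
          rwa [← hx, sub_zero] at h1
      have h2 := LZ_anti (fun x hx => hx.1 : hemi k 1 ⊆ sub k) h'
      have := neg_mem (add_mem h2 h1)
      convert this using 1
      abel
    refine ih j rfl (η₁ - η₂) ?_
    have hjh : ∀ σ, sub j ⊆ hemi k σ := fun σ x hx => ⟨sub_mono hjk'.le hx, by
      show 0 ≤ σ * x.1 k
      rw [hx k hjk', mul_zero]⟩
    have h3 := sub_mem (LZ_anti (hjh 1) hη₁) (LZ_anti (hjh (-1)) hη₂)
    obtain ⟨ε, hε, h3⟩ := h3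
    refine ⟨ε, hε, fun l hl => ?_⟩
    have h4 := h3 l hl
    have h5 : mulv (fun x => cut Λ k x - 1) ω l = - ω l := by
      rcases l with _ | ⟨x, l⟩
      · simp [hω, ubar_nil]
      · rw [mulv_cons, hcut x (hjh _ (hl.1 x (by simp)))]; ring
    have h6 : ω l = c * ubar m Λ s l := by
      simp only [hω, Pi.smul_apply, pb_apply, smul_eq_mul]
      have e : l.map (retr k) = l := by
        conv_rhs => rw [← List.map_id l]
        exact List.map_congr_left fun x hx => retr_of_mem hjk' (hl.1 x hx)
      rw [e]
    simp only [hψ₁, Pi.sub_apply, h5, h6] at h4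
    simp only [map_sub, Pi.sub_apply, Pi.smul_apply, smul_eq_mul]
    linear_combination h4

end Ubar

section Products
variable {m n : ℕ} {Λ : Type*} [CommRing Λ]

instance : Nonempty (Sph m) := ⟨pole 0⟩

lemma trunc_dcup {X : Type*} (d : ℕ) (c : X → Λ) (φ : List X → Λ) :
    trunc (d + 1) (dcup c φ) = dcup c (trunc d φ) := by
  funext l
  rcases l with _ | ⟨x, _ | ⟨y, l⟩⟩ <;> simp [trunc_apply]

lemma trunc_ubar (s d : ℕ) (h : d ≤ s) : trunc d (ubar m Λ s) = 0 := by
  induction s generalizing d with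
  | zero =>
    obtain rfl : d = 0 := by omega
    funext l
    rcases l with _ | ⟨x, l⟩ <;> simp [trunc_apply, ubar_zero]
  | succ s ih =>
    rcases d with _ | d
    · funext l
      rcases l with _ | ⟨x, l⟩ <;> simp [trunc_apply, ubar]
    · rw [ubar, trunc_dcup, trunc_pb, ih d (by omega), map_zero, map_zero]

lemma pb_const_ubar {X : Type*} (hm : 1 ≤ m) (P : Sph m) :
    pb (fun _ : X => P) (ubar m Λ m) = 0 := by
  obtain ⟨s, rfl⟩ : ∃ s, m = s + 1 := ⟨m - 1, by omega⟩
  funext l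
  rcases l with _ | ⟨x, _ | ⟨y, l⟩⟩ <;> simp [ubar]

lemma trunc_zero_eq {X : Type*} (φ : List X → Λ) : trunc 0 φ = φ [] • aug := by
  funext l
  rcases l with _ | ⟨x, l⟩ <;> simp [trunc_apply]

lemma ucOn_of_continuous {X Y : Type*} [UniformSpace X] [CompactSpace X] [UniformSpace Y]
    {f : X → Y} (hf : Continuous f) : UniformContinuousOn f univ :=
  (CompactSpace.uniformContinuous_of_continuous hf).uniformContinuousOn

/-- The pulled back fundamental cocycle of the `j`-th factor. -/
def coord (Λ : Type*) [CommRing Λ] (j : Fin n) : List (Fin n → Sph m) → Λ :=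
  pb (fun x => x j) (ubar m Λ m)

theorem top_cocycle (hm : 1 ≤ m) (n : ℕ) (α : List (Fin n → Sph m) → Λ)
    (hα : cobd α ∈ LZ (Λ := Λ) univ) (hs : α ∈ supp (Λ := Λ) (m + 1)) :
    ∃ (p : Fin n → Λ) (ψ : List (Fin n → Sph m) → Λ),
      α - ∑ j, p j • coord Λ j - cobd ψ ∈ LZ (Λ := Λ) univ := by
  induction n with
  | zero =>
    refine ⟨0, ins default α, ?_⟩
    obtain ⟨ε, hε, h⟩ := hα
    refine ⟨ε, hε, fun l _ => ?_⟩
    have h1 := congrFun (cone_formula default α) l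
    have h2 := h (default :: l) ⟨fun _ _ => mem_univ _, fun x _ y _ => by
      rw [Subsingleton.elim x y, dist_self]; exact hε⟩
    simp only [Pi.add_apply, ins_apply, h2, zero_add] at h1
    simp [← h1]
  | succ n ih =>
    have hZ : ∀ θ : List (Fin n → Sph m) → Λ, θ ∈ supp (Λ := Λ) 1 →
        cobd θ ∈ LZ (Λ := Λ) univ → θ [] = 0 → ∃ c : Λ, θ - c • one ∈ LZ (Λ := Λ) univ := by
      intro θ h1 h2 _
      obtain ⟨p, ψ, hψ⟩ := ih θ h2 (supp_mono (by omega) h1)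
      refine ⟨ψ [], ?_⟩
      have := trunc_mem_LZ 1 hψ
      simpa only [map_sub, map_sum, map_smul, coord, trunc_pb, trunc_ubar m 1 hm, map_zero,
        smul_zero, Finset.sum_const_zero, sub_zero, trunc_of_mem h1, trunc_cobd, trunc_zero_eq,
        cobd_aug] using this
    let e : Sph m × (Fin n → Sph m) → (Fin (n + 1) → Sph m) := fun z => Fin.cons z.1 z.2
    let e' : (Fin (n + 1) → Sph m) → Sph m × (Fin n → Sph m) := fun x => (x 0, fun i => x i.succ)
    have he : Continuous e := by
      refine continuous_pi fun i => ?_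
      refine Fin.cases ?_ (fun i => ?_) i
      · exact continuous_fst
      · exact (continuous_apply i).comp continuous_snd
    have he' : Continuous e' := by fun_prop
    have hee : e ∘ e' = id := by
      funext x; exact Fin.cons_self_tail x
    have hα' : cobd (pb e α) ∈ LZ (Λ := Λ) univ := by
      rw [cobd_pb]; exact pb_mem_LZ (ucOn_of_continuous he) (mapsTo_univ _ _) hα
    obtain ⟨c, ψ, -, -, h⟩ := cocycle_decomposition hZ m (Fin.last m) rfl (pb e α)
      (by rwa [sub_last, preimage_univ]) (pb_mem_supp _ hs)
    rw [sub_last, preimage_univ] at h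
    obtain ⟨p, ψ', h'⟩ := ih (pb (fun z => (pole 0, z)) (pb e α))
      (by rw [cobd_pb]; exact pb_mem_LZ (ucOn_of_continuous (by fun_prop)) (mapsTo_univ _ _) hα')
      (pb_mem_supp _ (pb_mem_supp _ hs))
    refine ⟨Fin.cons c p, pb e' (ψ + pb Prod.snd ψ'), ?_⟩
    have h1 := pb_mem_LZ (ucOn_of_continuous he') (mapsTo_univ _ _)
      (add_mem h (pb_mem_LZ (ucOn_of_continuous continuous_snd) (mapsTo_univ _ _) h'))
    have e1 : pb e' (pb e α) = α := by rw [pb_pb, hee, pb_id]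
    have e2 : pb e' (pb Prod.fst (ubar m Λ m)) = coord Λ 0 := by
      simp only [coord, pb_pb]; rfl
    have e3 : ∀ j : Fin n, pb e' (pb Prod.snd (coord Λ j)) = coord Λ j.succ := fun j => by
      simp only [coord, pb_pb]; rfl
    simp only [map_sub, map_add, map_sum, map_smul, e1, e2, e3] at h1
    rw [Fin.sum_univ_succ]
    simp only [Fin.cons_zero, Fin.cons_succ, cobd_pb, map_add]
    convert h1 using 1
    abel

theorem acyclic (hm : 1 ≤ m) (n d : ℕ) (hd : d < m) (α : List (Fin n → Sph m) → Λ)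
    (hα : cobd α ∈ LZ (Λ := Λ) univ) (hs : α ∈ supp (Λ := Λ) (d + 1)) :
    ∃ ψ ∈ supp (Λ := Λ) d, α - cobd ψ ∈ LZ (Λ := Λ) univ := by
  obtain ⟨p, ψ, h⟩ := top_cocycle hm n α hα (supp_mono (by omega) hs)
  refine ⟨trunc d ψ, trunc_mem_supp _ _, ?_⟩
  have := trunc_mem_LZ (d + 1) h
  simpa only [map_sub, map_sum, map_smul, coord, trunc_pb, trunc_ubar m (d + 1) hd, map_zero,
    smul_zero, Finset.sum_const_zero, sub_zero, trunc_of_mem hs, trunc_cobd] using this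

theorem coord_independent (hm : 1 ≤ m) (p : Fin n → Λ) (ψ : List (Fin n → Sph m) → Λ)
    (h : ∑ j, p j • coord Λ j - cobd ψ ∈ LZ (Λ := Λ) univ) : p = 0 := by
  funext i
  let u : Sph m → Fin n → Sph m := fun x => Function.update (fun _ => pole 0) i x
  have hu : Continuous u := continuous_const.update i continuous_id
  have h1 := pb_mem_LZ (ucOn_of_continuous hu) (mapsTo_univ _ _) h
  rw [map_sub, map_sum, ← cobd_pb, Finset.sum_eq_single i, ← sub_last] at h1
  · refine eq_zero_of_smul_ubar_mem m (Fin.last m) rfl (p i) (pb u ψ) ?_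
    convert h1 using 2
    rw [map_smul, coord, pb_pb]
    have : (fun x : Fin n → Sph m => x i) ∘ u = id := by funext x; simp [u]
    rw [this, pb_id]
  · intro j _ hj
    have : (fun x : Fin n → Sph m => x j) ∘ u = fun _ => pole 0 := by
      funext x; simp [u, hj]
    rw [map_smul, coord, pb_pb, this, pb_const_ubar hm, smul_zero]
  · simp

end Products

section Gysin
variable {X : Type*} [PseudoMetricSpace X]

/-- `c` is invariant under `F` up to additive constants. -/
def Quasi {X Λ : Type*} [CommRing Λ] (F : Set (X → X)) (c : X → Λ) : Prop :=
  ∀ f ∈ F, ∀ x y, c (f x) - c (f y) = c x - c y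

lemma dcup_mem_inv_of_quasi {X Λ : Type*} [CommRing Λ] {F : Set (X → X)} {c : X → Λ}
    (hc : Quasi F c) {φ : List X → Λ} (h : φ ∈ inv F) : dcup c φ ∈ inv (Λ := Λ) F := by
  intro f hf
  rw [dcup_pb, h f hf]
  funext l
  rcases l with _ | ⟨x, _ | ⟨y, l⟩⟩ <;> simp [hc f hf]

lemma dcup_mem_Bd_of_quasi {Λ : Type*} [CommRing Λ] {F : Set (X → X)} {Y : Set X} {c : X → Λ}
    (hc : Quasi F c) {φ : List X → Λ} (h : φ ∈ Bd F Y) : dcup c φ ∈ Bd (Λ := Λ) F Y := by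
  obtain ⟨ψ, h1, h2, h3⟩ := h
  refine ⟨-dcup c ψ, neg_mem (dcup_mem_inv_of_quasi hc h1), by simp, ?_⟩
  rw [map_neg, cobd_dcup c ψ h2, neg_neg, ← map_sub]
  exact dcup_mem_LZ c h3

/-- Invariant cocycles. -/
def Zc (F : Set (X → X)) : Submodule (ZMod 2) (List X → ZMod 2) where
  carrier := {φ | φ ∈ inv (Λ := ZMod 2) F ∧ φ [] = 0 ∧ cobd φ ∈ LZ (Λ := ZMod 2) univ}
  add_mem' := by
    rintro a b ⟨h1, h2, h3⟩ ⟨k1, k2, k3⟩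
    exact ⟨add_mem h1 k1, by simp [h2, k2], by rw [map_add]; exact add_mem h3 k3⟩
  zero_mem' := ⟨zero_mem _, rfl, by rw [map_zero]; exact zero_mem _⟩
  smul_mem' := by
    rintro c a ⟨h1, h2, h3⟩
    exact ⟨Submodule.smul_mem _ _ h1, by simp [h2],
      by rw [map_smul]; exact Submodule.smul_mem _ _ h3⟩

lemma one_mem_Zc (F : Set (X → X)) : one ∈ Zc F :=
  ⟨one_mem_inv F, one_nil, by rw [cobd_one]; exact zero_mem _⟩

lemma dcup_mem_Zc {F : Set (X → X)} {c : X → ZMod 2} (hc : Quasi F c) {φ : List X → ZMod 2}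
    (h : φ ∈ Zc F) : dcup c φ ∈ Zc F :=
  ⟨dcup_mem_inv_of_quasi hc h.1, rfl, by
    rw [cobd_dcup _ _ h.2.1]; exact neg_mem (dcup_mem_LZ c h.2.2)⟩

lemma char_two_add_self {X : Type*} (φ : List X → ZMod 2) : φ + φ = 0 := by
  funext l; exact CharTwo.add_self_eq_zero _

lemma mulv_add_one {X : Type*} (χ : X → ZMod 2) {φ : List X → ZMod 2} (h0 : φ [] = 0) :
    mulv (fun x => χ x + 1) φ = mulv χ φ + φ := by
  funext l
  rcases l with _ | ⟨x, l⟩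
  · simp [h0]
  · simp; ring

/-- Two functions with the same translation behaviour define the same cup product operation. -/
lemma dcup_sub_dcup_mem_Bd {F : Set (X → X)} {c c' : X → ZMod 2}
    (h : ∀ f ∈ F, ∀ x, c (f x) - c' (f x) = c x - c' x) {φ : List X → ZMod 2} (hφ : φ ∈ Zc F) :
    dcup c φ - dcup c' φ ∈ Bd (Λ := ZMod 2) F univ := by
  refine ⟨mulv (fun x => c x - c' x) φ, mulv_mem_inv (c := fun x => c x - c' x) (fun f hf => funext (h f hf)) hφ.1, rfl, ?_⟩
  rw [cobd_mulv _ _ hφ.2.1]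
  have e : dcup c φ - dcup c' φ = dcup (fun x => c x - c' x) φ := by
    funext l
    rcases l with _ | ⟨x, _ | ⟨y, l⟩⟩ <;> simp
    ring
  rw [e, sub_add_cancel_left]
  exact neg_mem (mulv_mem_LZ _ hφ.2.2)

variable {F : Set (X → X)} {τ : X → X} {χ : X → ZMod 2}

omit [PseudoMetricSpace X] in
lemma quasi_insert (hχF : ∀ f ∈ F, ∀ x, χ (f x) = χ x) (hχ : ∀ x, χ (τ x) = χ x + 1) :
    Quasi (insert τ F) χ := by
  rintro f (rfl | hf) x y
  · rw [hχ, hχ]; ring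
  · rw [hχF f hf, hχF f hf]

omit [PseudoMetricSpace X] in
lemma transfer_mem_inv (hτ : τ ∘ τ = id) (hc : ∀ f ∈ F, f ∘ τ = τ ∘ f) {κ : List X → ZMod 2}
    (h : κ ∈ inv (Λ := ZMod 2) F) : κ + pb τ κ ∈ inv (Λ := ZMod 2) (insert τ F) := by
  rintro f (rfl | hf)
  · rw [map_add, pb_pb, hτ, pb_id, add_comm]
  · rw [map_add, h f hf, pb_pb, ← hc f hf, ← pb_pb, h f hf]

/-- Exactness of the Gysin sequence at the restriction map. -/
lemma exists_dcup_of_mem_Bd (hτ : τ ∘ τ = id) (hc : ∀ f ∈ F, f ∘ τ = τ ∘ f)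
    (hu : UniformContinuousOn τ univ) (hχF : ∀ f ∈ F, ∀ x, χ (f x) = χ x)
    (hχ : ∀ x, χ (τ x) = χ x + 1) {φ : List X → ZMod 2} (hφ : φ ∈ inv (Λ := ZMod 2) (insert τ F))
    (h : φ ∈ Bd (Λ := ZMod 2) F univ) :
    ∃ η ∈ Zc (insert τ F), φ - dcup χ η ∈ Bd (Λ := ZMod 2) (insert τ F) univ := by
  obtain ⟨ψ, hψ, h0, h⟩ := h
  have hη0 : (ψ + pb τ ψ) [] = 0 := by simp [h0]
  have hηc : cobd (ψ + pb τ ψ) ∈ LZ (Λ := ZMod 2) univ := by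
    have h1 := pb_mem_LZ hu (mapsTo_univ _ _) h
    rw [map_sub, hφ τ (mem_insert _ _), ← cobd_pb] at h1
    have := neg_mem (add_mem h h1)
    rw [sub_add_sub_comm, char_two_add_self, zero_sub, neg_neg] at this
    rwa [map_add]
  refine ⟨ψ + pb τ ψ, ⟨transfer_mem_inv hτ hc hψ, hη0, hηc⟩,
    ψ - mulv χ (ψ + pb τ ψ), ?_, by simp [h0], ?_⟩
  · rintro f (rfl | hf)
    · have e : χ ∘ f = fun x => χ x + 1 := funext hχ
      have e2 := transfer_mem_inv hτ hc hψ f (mem_insert _ _)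
      rw [map_sub, mulv_pb, e, e2, mulv_add_one χ hη0]
      linear_combination -char_two_add_self ψ
    · have e := (inv_anti (Λ := ZMod 2) (subset_insert τ F)) (transfer_mem_inv hτ hc hψ) f hf
      rw [map_sub, mulv_pb, e, hψ f hf, show χ ∘ f = χ from funext (hχF f hf)]
  · rw [map_sub, cobd_mulv _ _ hη0]
    have := add_mem h (mulv_mem_LZ χ hηc)
    convert this using 1
    abel

/-- Exactness of the Gysin sequence at the cup product, when the restriction is onto. -/
lemma mem_Bd_of_dcup_mem_Bd (hτ : τ ∘ τ = id) (hc : ∀ f ∈ F, f ∘ τ = τ ∘ f)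
    (hu : UniformContinuousOn τ univ) (hχF : ∀ f ∈ F, ∀ x, χ (f x) = χ x)
    (hχ : ∀ x, χ (τ x) = χ x + 1)
    (hres : ∀ κ ∈ Zc F, ∃ κ' ∈ inv (Λ := ZMod 2) (insert τ F), κ - κ' ∈ Bd (Λ := ZMod 2) F univ)
    {φ : List X → ZMod 2} (hφ : φ ∈ Zc (insert τ F))
    (h : dcup χ φ ∈ Bd (Λ := ZMod 2) (insert τ F) univ) :
    φ ∈ Bd (Λ := ZMod 2) (insert τ F) univ := by
  obtain ⟨ψ, hψ, h0, h⟩ := h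
  have hF := subset_insert τ F
  obtain ⟨κ', hκ', ξ, hξ, hξ0, h'⟩ := hres (mulv χ φ - ψ)
    ⟨sub_mem (mulv_mem_inv (fun f hf => funext (hχF f hf)) (inv_anti hF hφ.1))
      (inv_anti hF hψ), by simp [h0], by
      rw [map_sub, cobd_mulv _ _ hφ.2.1, add_sub_right_comm]
      exact add_mem h (mulv_mem_LZ _ hφ.2.2)⟩
  refine ⟨ξ + pb τ ξ, transfer_mem_inv hτ hc hξ, by simp [hξ0], ?_⟩
  have h1 := add_mem h' (pb_mem_LZ hu (mapsTo_univ _ _) h')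
  have e : χ ∘ τ = fun x => χ x + 1 := funext hχ
  rw [map_sub, map_sub, map_sub, mulv_pb, hφ.1 τ (mem_insert _ _), hψ τ (mem_insert _ _),
    hκ' τ (mem_insert _ _), e, mulv_add_one χ hφ.2.1, ← cobd_pb] at h1
  rw [map_add]
  have e2 : φ - (cobd ξ + cobd (pb τ ξ)) = mulv χ φ - ψ - κ' - cobd ξ +
      (mulv χ φ + φ - ψ - κ' - cobd (pb τ ξ)) - ((mulv χ φ - ψ - κ') + (mulv χ φ - ψ - κ')) := by
    abel
  rw [e2, char_two_add_self, sub_zero]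
  exact h1

lemma iterate_dcup_mem_Zc {F : Set (X → X)} {c : X → ZMod 2} (hc : Quasi F c)
    {φ : List X → ZMod 2} (h : φ ∈ Zc F) (N : ℕ) : (dcup c)^[N] φ ∈ Zc F := by
  induction N with
  | zero => exact h
  | succ N ih => rw [Function.iterate_succ_apply']; exact dcup_mem_Zc hc ih

/-- The Euler class of a free involution detected by finitely many odd functions is nilpotent. -/
lemma iterate_dcup_mem_Bd [CompactSpace X] (hχF : ∀ f ∈ F, ∀ x, χ (f x) = χ x)
    (hχ : ∀ x, χ (τ x) = χ x + 1) {ι : Type*} [Finite ι] (f : ι → X → ℝ)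
    (hf : ∀ i, Continuous (f i)) (hfF : ∀ i, ∀ g ∈ F, ∀ x, f i (g x) = f i x)
    (hfτ : ∀ i x, f i (τ x) = - f i x) (hcov : ∀ x, ∃ i, f i x ≠ 0) :
    ∃ N : ℕ, ∀ φ ∈ Zc (insert τ F), (dcup χ)^[N] φ ∈ Bd (Λ := ZMod 2) (insert τ F) univ := by
  classical
  obtain ⟨ε, hε, hL⟩ : ∃ ε > 0, ∀ x : X, ∃ i, ∀ y, dist y x < ε → 0 < f i y * f i x := by
    have hopen : ∀ p : ι × Bool, IsOpen {x : X | 0 < (if p.2 then f p.1 x else - f p.1 x)} := by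
      rintro ⟨i, b⟩
      cases b
      · exact isOpen_lt continuous_const (hf i).neg
      · exact isOpen_lt continuous_const (hf i)
    obtain ⟨ε, hε, h⟩ := lebesgue_number_lemma_of_metric (isCompact_univ (X := X)) hopen (by
      intro x _
      obtain ⟨i, hi⟩ := hcov x
      rw [mem_iUnion]
      rcases lt_or_gt_of_ne hi with hi | hi
      · exact ⟨(i, false), show 0 < - f i x by linarith⟩
      · exact ⟨(i, true), hi⟩)
    refine ⟨ε, hε, fun x => ?_⟩
    obtain ⟨⟨i, b⟩, hb⟩ := h x (mem_univ x)
    refine ⟨i, fun y hy => ?_⟩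
    have h1 := hb hy
    have h2 := hb (Metric.mem_ball_self hε)
    cases b
    · have h1 : 0 < - f i y := h1
      have h2 : 0 < - f i x := h2
      nlinarith
    · exact mul_pos h1 h2
  let c : ι → X → ZMod 2 := fun i x => if f i x = 0 then χ x else if 0 < f i x then 1 else 0
  have hd : ∀ i, ∀ g ∈ insert τ F, ∀ x, χ (g x) - c i (g x) = χ x - c i x := by
    rintro i g (rfl | hg) x
    · simp only [c, hfτ, hχ, neg_eq_zero]
      rcases lt_trichotomy (f i x) 0 with h | h | h
      · rw [if_neg h.ne, if_neg h.ne, if_pos (by linarith), if_neg (by linarith)]; ring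
      · rw [if_pos h, if_pos h]; ring
      · rw [if_neg h.ne', if_neg h.ne', if_neg (by linarith), if_pos h]
        rw [CharTwo.sub_eq_add, CharTwo.sub_eq_add]; ring
    · simp only [c, hfF i g hg, hχF g hg]
  have hq := quasi_insert hχF hχ
  have hqc : ∀ i, Quasi (insert τ F) (c i) := fun i g hg x y => by
    have := hq g hg x y
    linear_combination this - hd i g hg x + hd i g hg y
  have key : ∀ L : List ι, ∀ φ ∈ Zc (insert τ F),
      (L.foldr (fun i ψ => dcup (c i) ψ) φ ∈ Zc (insert τ F)) ∧
      (dcup χ)^[L.length] φ - L.foldr (fun i ψ => dcup (c i) ψ) φ ∈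
        Bd (Λ := ZMod 2) (insert τ F) univ := by
    intro L φ hφ
    induction L with
    | nil => exact ⟨hφ, by simp⟩
    | cons i L ih =>
      refine ⟨dcup_mem_Zc (hqc i) ih.1, ?_⟩
      rw [List.length_cons, Function.iterate_succ_apply', List.foldr_cons]
      have h1 := dcup_mem_Bd_of_quasi hq ih.2
      have h2 := dcup_sub_dcup_mem_Bd (hd i) ih.1
      rw [map_sub] at h1
      have := add_mem h1 h2
      rwa [sub_add_sub_cancel] at this
  have : Fintype ι := Fintype.ofFinite ι
  refine ⟨(Finset.univ : Finset ι).toList.length, fun φ hφ => ?_⟩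
  have hk := (key (Finset.univ : Finset ι).toList φ hφ).2
  have hz : (Finset.univ : Finset ι).toList.foldr (fun i ψ => dcup (c i) ψ) φ ∈
      LZ (Λ := ZMod 2) univ := by
    refine ⟨ε, hε, fun l hl => ?_⟩
    rcases l with _ | ⟨x, l⟩
    · exact (key _ φ hφ).1.2.1
    obtain ⟨i, hi⟩ := hL x
    have hcx : ∀ y ∈ x :: l, ∀ z ∈ x :: l, c i y = c i z := by
      have : ∀ y ∈ x :: l, c i y = c i x := fun y hy => by
        have h := hi y (hl.2 y hy x (by simp))
        have hx : f i x ≠ 0 := by rintro h0; simp [h0] at h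
        have hy0 : f i y ≠ 0 := by rintro h0; simp [h0] at h
        simp only [c, if_neg hx, if_neg hy0]
        congr 1
        rw [eq_iff_iff, ← pos_iff_pos_of_mul_pos h]
      intro y hy z hz; rw [this y hy, this z hz]
    have : ∀ L : List ι, i ∈ L → ∀ l' : List X, (∀ y ∈ l', y ∈ x :: l) →
        L.foldr (fun i ψ => dcup (c i) ψ) φ l' = 0 := by
      intro L hL
      induction L with
      | nil => simp at hL
      | cons j L ih =>
        intro l' hl'
        rw [List.foldr_cons]
        rcases l' with _ | ⟨y, _ | ⟨z, l'⟩⟩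
        · rfl
        · rfl
        rw [dcup_cons_cons]
        rcases List.mem_cons.1 hL with rfl | hL
        · rw [hcx z (hl' z (by simp)) y (hl' y (by simp)), sub_self, zero_mul]
        · rw [ih hL (z :: l') fun w hw => hl' w (List.mem_cons_of_mem _ hw), mul_zero]
    exact this _ (Finset.mem_toList.2 (Finset.mem_univ i)) _ fun _ h => h
  have := add_mem hk (LZ_le_Bd hz)
  rwa [sub_add_cancel] at this

end Gysin

section Generation
variable {m n : ℕ}

/-- The antipode of the `j`-th coordinate. -/
def sgl (j : Fin n) (x : Fin n → Sph m) : Fin n → Sph m := Function.update x j (-x j)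

lemma continuous_sgl (j : Fin n) : Continuous (sgl (m := m) j) :=
  continuous_id.update j (continuous_apply j).neg

lemma sgl_sgl (j : Fin n) (x : Fin n → Sph m) : sgl j (sgl j x) = x := by
  simp [sgl]

lemma sgl_comm (i j : Fin n) (x : Fin n → Sph m) : sgl i (sgl j x) = sgl j (sgl i x) := by
  funext k
  by_cases hij : i = j
  · rw [hij]
  · by_cases h1 : k = i
    · subst h1; simp [sgl, hij]
    · by_cases h2 : k = j
      · subst h2; simp [sgl, h1]
      · simp [sgl, h1, h2]

lemma sgl_cons_zero (a : Sph m) (z : Fin n → Sph m) :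
    sgl 0 (Fin.cons a z : Fin (n + 1) → Sph m) = Fin.cons (-a) z := by
  rw [sgl, Fin.update_cons_zero, Fin.cons_zero]

lemma sgl_cons_succ (j : Fin n) (a : Sph m) (z : Fin n → Sph m) :
    sgl j.succ (Fin.cons a z : Fin (n + 1) → Sph m) = Fin.cons a (sgl j z) := by
  rw [sgl, Fin.cons_succ, ← Fin.cons_update, sgl]

lemma range_sgl_succ : range (sgl (m := m) (n := n + 1)) =
    insert (sgl 0) (range fun j : Fin n => sgl j.succ) := by
  rw [← Fin.range_cons]
  congr 1
  funext j
  refine Fin.cases ?_ (fun j => ?_) j <;> simp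

lemma exists_coord_ne_zero (x : Sph m) : ∃ i, x.1 i ≠ 0 := by
  by_contra! h
  have := norm_sq_eq x
  simp [h] at this

/-- The cohomology of the quotient by the coordinate antipodes is generated by the Euler classes. -/
theorem Zc_le_of_closed (n : ℕ) (χ : Fin n → (Fin n → Sph m) → ZMod 2)
    (hχ : ∀ j i x, χ j (sgl i x) = χ j x + if i = j then 1 else 0)
    (N : Submodule (ZMod 2) (List (Fin n → Sph m) → ZMod 2)) (h1 : one ∈ N)
    (hB : Bd (Λ := ZMod 2) (range sgl) univ ≤ N)
    (hN : ∀ j, ∀ φ ∈ Zc (range sgl), φ ∈ N → dcup (χ j) φ ∈ N) : Zc (range sgl) ≤ N := by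
  induction n with
  | zero =>
    rintro φ ⟨-, h0, h2⟩
    have hone : φ = φ [default] • one + (φ - φ [default] • one) := by abel
    rw [hone]
    refine add_mem (N.smul_mem _ h1) (hB ?_)
    obtain ⟨ε, hε, h⟩ := h2
    refine ⟨ins default φ - φ [default] • aug, ?_, by simp, ε, hε, fun l _ => ?_⟩
    · rintro _ ⟨j, -⟩; exact j.elim0
    · have h1 := congrFun (cone_formula default φ) l
      have h2 := h (default :: l) ⟨fun _ _ => mem_univ _, fun x _ y _ => by
        rw [Subsingleton.elim x y, dist_self]; exact hε⟩
      simp only [Pi.add_apply, ins_apply, h2, zero_add] at h1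
      rw [map_sub, map_smul, cobd_aug, sub_sub_sub_cancel_right, Pi.sub_apply, ← h1, sub_self]
  | succ n ih =>
    have hq : ∀ j, Quasi (range sgl) (χ j) := by
      rintro j _ ⟨i, rfl⟩ x y
      rw [hχ, hχ]; ring
    let e : Sph m × (Fin n → Sph m) → (Fin (n + 1) → Sph m) := fun z => Fin.cons z.1 z.2
    let e' : (Fin (n + 1) → Sph m) → Sph m × (Fin n → Sph m) := fun x => (x 0, fun i => x i.succ)
    have he : Continuous e := by
      refine continuous_pi fun i => ?_
      refine Fin.cases ?_ (fun i => ?_) i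
      · exact continuous_fst
      · exact (continuous_apply i).comp continuous_snd
    have he' : Continuous e' := by fun_prop
    have hee : e ∘ e' = id := by
      funext x; exact Fin.cons_self_tail x
    have hee' : e' ∘ e = id := by
      funext x; rfl
    have hs0 : sgl 0 ∘ e = e ∘ Prod.map Neg.neg id := funext fun z => sgl_cons_zero _ _
    have hss : ∀ j : Fin n, sgl j.succ ∘ e = e ∘ Prod.map id (sgl j) :=
      fun j => funext fun z => sgl_cons_succ _ _ _
    have hss' : ∀ j : Fin n, e' ∘ sgl j.succ = Prod.map id (sgl j) ∘ e' := fun j => by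
      rw [← Function.comp_id (e' ∘ _), ← hee, Function.comp_assoc, ← Function.comp_assoc _ e,
        hss, ← Function.comp_assoc, ← Function.comp_assoc, hee', Function.id_comp]
    have hs0' : e' ∘ sgl 0 = Prod.map Neg.neg id ∘ e' := by
      rw [← Function.comp_id (e' ∘ _), ← hee, Function.comp_assoc, ← Function.comp_assoc _ e,
        hs0, ← Function.comp_assoc, ← Function.comp_assoc, hee', Function.id_comp]
    let t : (Fin (n + 1) → Sph m) → (Fin n → Sph m) := Prod.snd ∘ e'
    have ht : Continuous t := continuous_snd.comp he'
    have hts : ∀ f ∈ range (sgl (m := m) (n := n + 1)),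
        t ∘ f = t ∨ ∃ f' ∈ range (sgl (m := m) (n := n)), t ∘ f = f' ∘ t := by
      rw [range_sgl_succ]
      rintro _ (rfl | ⟨j, rfl⟩)
      · left; rw [Function.comp_assoc, hs0']; rfl
      · right; exact ⟨_, ⟨j, rfl⟩, by rw [Function.comp_assoc, hss']; rfl⟩
    have htinv : ∀ θ ∈ inv (Λ := ZMod 2) (range (sgl (m := m) (n := n))),
        pb t θ ∈ inv (Λ := ZMod 2) (range (sgl (m := m) (n := n + 1))) := by
      intro θ hθ f hf
      rcases hts f hf with h | ⟨f', hf', h⟩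
      · rw [pb_pb, h]
      · rw [pb_pb, h, ← pb_pb, hθ f' hf']
    have htZ : ∀ θ ∈ Zc (range (sgl (m := m) (n := n))),
        pb t θ ∈ Zc (range (sgl (m := m) (n := n + 1))) := fun θ hθ =>
      ⟨htinv θ hθ.1, hθ.2.1, by
        rw [cobd_pb]; exact pb_mem_LZ (ucOn_of_continuous ht) (mapsTo_univ _ _) hθ.2.2⟩
    have hbase : ∀ θ ∈ Zc (range (sgl (m := m) (n := n))), pb t θ ∈ N := by
      let c : Fin n → (Fin n → Sph m) → ZMod 2 := fun j z => χ j.succ (Fin.cons (pole 0) z)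
      refine ih c ?_ (N.comap (pb t)) (by simpa using h1) ?_ ?_
      · intro j i x
        simp only [c]
        rw [← sgl_cons_succ, hχ]; simp
      · rintro θ ⟨ψ, hψ, h0, h⟩
        refine hB ⟨pb t ψ, htinv ψ hψ, h0, ?_⟩
        rw [cobd_pb, ← map_sub]
        exact pb_mem_LZ (ucOn_of_continuous ht) (mapsTo_univ _ _) h
      · intro j θ hθ hθN
        have h2 := dcup_sub_dcup_mem_Bd (F := range (sgl (m := m) (n := n + 1)))
          (c := χ j.succ) (c' := c j ∘ t) ?_ (htZ θ hθ)
        · have := sub_mem (hN j.succ _ (htZ θ hθ) hθN) (hB h2)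
          rw [sub_sub_cancel, ← dcup_pb] at this
          exact this
        · rw [range_sgl_succ]
          rintro _ (rfl | ⟨i, rfl⟩) x
          · rw [hχ, if_neg (Fin.succ_ne_zero j).symm, add_zero, Function.comp_apply]
            rw [show t (sgl 0 x) = t x from congrFun (show (t ∘ sgl 0) = t by
              rw [Function.comp_assoc, hs0']; rfl) x]
            rfl
          · have : t (sgl i.succ x) = sgl i (t x) := congrFun (show t ∘ sgl i.succ = sgl i ∘ t by
              rw [Function.comp_assoc, hss']; rfl) x
            simp only [Function.comp_apply, this, c, ← sgl_cons_succ, hχ]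
            ring_nf
    obtain ⟨M, hM⟩ := iterate_dcup_mem_Bd (X := Fin (n + 1) → Sph m)
      (F := range fun j : Fin n => sgl j.succ) (τ := sgl 0) (χ := χ 0)
      (by rintro _ ⟨j, rfl⟩ x; rw [hχ]; simp) (by intro x; rw [hχ]; simp)
      (fun i x => (x 0).1 i) (fun i => (continuous_coord i).comp (continuous_apply 0))
      (by rintro i _ ⟨j, rfl⟩ x; simp [sgl, (Fin.succ_ne_zero j).symm])
      (by intro i x; simp [sgl]) (fun x => exists_coord_ne_zero (x 0))
    rw [← range_sgl_succ] at hM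
    have step : ∀ φ ∈ Zc (range (sgl (m := m) (n := n + 1))), ∃ η ∈ Zc (range sgl), ∃ θ ∈ Zc (range sgl),
        θ ∈ N ∧ φ - θ - dcup (χ 0) η ∈ Bd (Λ := ZMod 2) (range sgl) univ := by
      intro φ hφ
      have hφ1 := hφ.1
      obtain ⟨θ, hθ, hθc, hd⟩ := antipode_invariant_cocycle (Z := Fin n → Sph m)
        (F := range sgl) m (Fin.last m) rfl (pb e φ)
        (by rw [cobd_pb]; exact pb_mem_LZ (Y' := univ)
              ((ucOn_of_continuous he).mono (subset_univ _)) (mapsTo_univ _ _) hφ.2.2)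
        (by
          rintro _ ⟨_, ⟨j, rfl⟩, rfl⟩
          rw [pb_pb, ← hss, ← pb_pb, hφ1 _ ⟨_, rfl⟩])
        (by rw [pb_pb, ← hs0, ← pb_pb, hφ1 _ ⟨_, rfl⟩])
      have hθZ : θ ∈ Zc (range sgl) :=
        ⟨hθ, nil_of_cobd_mem_LZ hθc univ_nonempty, hθc⟩
      rw [sub_last, preimage_univ] at hd
      have hd' := pb_mem_Bd (F := range fun j : Fin n => sgl (m := m) j.succ)
        (ucOn_of_continuous he') (mapsTo_univ _ _)
        (by rintro _ ⟨j, rfl⟩; exact ⟨_, ⟨_, ⟨j, rfl⟩, rfl⟩, hss' j⟩) hd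
      rw [map_sub, pb_pb, hee, pb_id, pb_pb] at hd'
      have hZ := htZ θ hθZ
      obtain ⟨η, hη, hη'⟩ := exists_dcup_of_mem_Bd (τ := sgl (m := m) (n := n + 1) 0) (χ := χ 0)
        (funext (sgl_sgl 0)) (by rintro _ ⟨j, rfl⟩; funext x; exact sgl_comm _ _ _)
        (ucOn_of_continuous (continuous_sgl 0))
        (by rintro _ ⟨j, rfl⟩ x; rw [hχ]; simp) (by intro x; rw [hχ]; simp)
        (by rw [← range_sgl_succ]; exact sub_mem hφ.1 hZ.1) hd'
      rw [← range_sgl_succ] at hη hη'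
      exact ⟨η, hη, _, hZ, hbase θ hθZ, hη'⟩
    have hB' : ∀ a, ∀ φ ∈ Bd (Λ := ZMod 2) (range (sgl (m := m) (n := n + 1))) univ,
        (dcup (χ 0))^[a] φ ∈ Bd (Λ := ZMod 2) (range sgl) univ := by
      intro a φ hφ
      induction a with
      | zero => exact hφ
      | succ a ih => rw [Function.iterate_succ_apply']; exact dcup_mem_Bd_of_quasi (hq 0) ih
    have hN' : ∀ a, ∀ φ ∈ Zc (range (sgl (m := m) (n := n + 1))), φ ∈ N →
        (dcup (χ 0))^[a] φ ∈ N := by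
      intro a φ hφ hφN
      induction a with
      | zero => exact hφN
      | succ a ih =>
        rw [Function.iterate_succ_apply']; exact hN 0 _ (iterate_dcup_mem_Zc (hq 0) hφ a) ih
    have hdesc : ∀ k ≤ M, ∀ φ ∈ Zc (range (sgl (m := m) (n := n + 1))),
        (dcup (χ 0))^[M - k] φ ∈ N := by
      intro k
      induction k with
      | zero => exact fun _ φ hφ => hB (hM φ hφ)
      | succ k ihk =>
        intro hk φ hφ
        obtain ⟨η, hη, θ, hθ, hθN, h⟩ := step φ hφ
        have h1 := hB (hB' (M - (k + 1)) _ h)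
        have h2 := hN' (M - (k + 1)) θ hθ hθN
        have h3 := ihk (by omega) η hη
        rw [show M - k = M - (k + 1) + 1 by omega, Function.iterate_succ_apply] at h3
        have := add_mem (add_mem h1 h3) h2
        rw [← iterate_map_add, ← iterate_map_add, sub_add_cancel, sub_add_cancel] at this
        exact this
    intro φ hφ
    simpa using hdesc M le_rfl φ hφ

end Generation

section FreeInvolution
variable {m n : ℕ}

/-- The sign action of `ZMod 2` on a sphere. -/
def sg (b : ZMod 2) (x : Sph m) : Sph m := if b = 0 then x else -x

@[simp] lemma sg_zero (x : Sph m) : sg 0 x = x := rfl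
@[simp] lemma sg_one (x : Sph m) : sg 1 x = -x := rfl

lemma zmod_two_cases (a : ZMod 2) : a = 0 ∨ a = 1 := by
  fin_cases a
  exacts [Or.inl rfl, Or.inr rfl]

lemma sg_sg (a b : ZMod 2) (x : Sph m) : sg a (sg b x) = sg (a + b) x := by
  rcases zmod_two_cases a with rfl | rfl <;> rcases zmod_two_cases b with rfl | rfl <;>
    simp [CharTwo.add_self_eq_zero]

lemma neg_ne_self_sph (x : Sph m) : -x ≠ x := fun h => by
  obtain ⟨i, hi⟩ := exists_coord_ne_zero x
  have : (-x).1 i = x.1 i := by rw [h]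
  simp at this
  exact hi (by linarith)

lemma sg_injective (x : Sph m) {a b : ZMod 2} (h : sg a x = sg b x) : a = b := by
  rcases zmod_two_cases a with rfl | rfl <;> rcases zmod_two_cases b with rfl | rfl <;>
    simp_all [neg_ne_self_sph, (neg_ne_self_sph x).symm]

lemma continuous_sg (b : ZMod 2) : Continuous (sg (m := m) b) := by
  rcases zmod_two_cases b with rfl | rfl
  · exact continuous_id
  · exact continuous_neg

/-- The coordinatewise sign action on a product of spheres. -/
def act (b : Fin n → ZMod 2) (x : Fin n → Sph m) : Fin n → Sph m := fun j => sg (b j) (x j)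

lemma act_zero (x : Fin n → Sph m) : act 0 x = x := rfl

lemma act_act (a b : Fin n → ZMod 2) (x : Fin n → Sph m) : act a (act b x) = act (a + b) x :=
  funext fun _ => sg_sg _ _ _

lemma act_injective (x : Fin n → Sph m) {a b : Fin n → ZMod 2} (h : act a x = act b x) : a = b :=
  funext fun j => sg_injective (x j) (congrFun h j)

lemma continuous_act (b : Fin n → ZMod 2) : Continuous (act (m := m) b) :=
  continuous_pi fun j => (continuous_sg _).comp (continuous_apply j)

lemma sgl_eq_act (j : Fin n) (x : Fin n → Sph m) : sgl j x = act (Pi.single j 1) x := by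
  funext k
  by_cases h : k = j
  · subst h; simp [sgl, act]
  · simp [sgl, act, h]

lemma act_congr_sq {b : Fin n → ZMod 2} (x : Fin n → Sph m) (j : Fin n) (k l : Fin (m + 1)) :
    (act b x j).1 k * (act b x j).1 l = (x j).1 k * (x j).1 l := by
  rcases zmod_two_cases (b j) with h | h <;> simp [act, h]

lemma eq_sg_of_mul_eq {u v : Sph m} (h : ∀ k l, u.1 k * u.1 l = v.1 k * v.1 l) :
    ∃ a, u = sg a v := by
  set c := ∑ l, u.1 l * v.1 l with hc
  have h1 : ∀ k, u.1 k = c * v.1 k := fun k => by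
    have : ∑ l, u.1 k * u.1 l * u.1 l = ∑ l, v.1 k * v.1 l * u.1 l :=
      Finset.sum_congr rfl fun l _ => by rw [h]
    calc u.1 k = u.1 k * ∑ l, u.1 l ^ 2 := by rw [norm_sq_eq, mul_one]
      _ = ∑ l, u.1 k * u.1 l * u.1 l := by
        rw [Finset.mul_sum]; exact Finset.sum_congr rfl fun l _ => by ring
      _ = ∑ l, v.1 k * v.1 l * u.1 l := this
      _ = c * v.1 k := by
        rw [hc, Finset.sum_mul]; exact Finset.sum_congr rfl fun l _ => by ring
  have h2 : c ^ 2 = 1 := by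
    have := norm_sq_eq u
    simp only [h1, mul_pow] at this
    rwa [← Finset.mul_sum, norm_sq_eq, mul_one] at this
  rcases sq_eq_one_iff.1 h2 with h3 | h3
  · refine ⟨0, Subtype.ext ?_⟩
    ext k; rw [h1, h3, one_mul]; rfl
  · refine ⟨1, Subtype.ext ?_⟩
    ext k; rw [h1, h3, neg_one_mul]; rfl

/-- Free actions have set-theoretic equivariant maps to the group. -/
lemma exists_equivariant {G X : Type*} [AddCommGroup G] (ρ : G → X → X) (h0 : ∀ x, ρ 0 x = x)
    (hadd : ∀ g h x, ρ (g + h) x = ρ g (ρ h x)) (hfree : ∀ g x, ρ g x = x → g = 0) :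
    ∃ κ : X → G, ∀ g x, κ (ρ g x) = g + κ x := by
  let s : Setoid X :=
    { r := fun x y => ∃ g, ρ g x = y
      iseqv :=
        { refl := fun x => ⟨0, h0 x⟩
          symm := fun {x y} ⟨g, h⟩ => ⟨-g, by rw [← h, ← hadd, neg_add_cancel, h0]⟩
          trans := fun {x y z} ⟨g, h⟩ ⟨g', h'⟩ => ⟨g' + g, by rw [hadd, h, h']⟩ } }
  have hrep : ∀ x : X, ∃ g, ρ g (Quotient.out (Quotient.mk s x)) = x := fun x =>
    Quotient.exact (Quotient.out_eq (Quotient.mk s x))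
  choose κ hκ using hrep
  refine ⟨κ, fun g x => ?_⟩
  have e : Quotient.mk s (ρ g x) = Quotient.mk s x := 
    (Quotient.sound (s := s) (show ∃ h, ρ h x = ρ g x from ⟨g, rfl⟩)).symm
  have h1 := hκ (ρ g x)
  have h2 := hκ x
  rw [e] at h1
  set y := Quotient.out (Quotient.mk s x)
  have h3 : ρ (-(g + κ x) + κ (ρ g x)) y = y := by
    rw [hadd, h1]
    nth_rw 2 [← h2]
    rw [← hadd, ← hadd, add_assoc, neg_add_cancel, h0]
  have := hfree _ _ h3
  rw [neg_add_eq_zero] at this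
  exact this.symm

/-- There is no involution of a product of spheres that commutes with the sign action and acts
freely modulo it. -/
theorem no_free_involution (T : (Fin n → Sph m) → (Fin n → Sph m)) (hT : Continuous T)
    (hTT : ∀ x, T (T x) = x) (hTa : ∀ b x, T (act b x) = act b (T x))
    (hfree : ∀ b x, T x ≠ act b x) : False := by
  let ρ : (Fin n → ZMod 2) × ZMod 2 → (Fin n → Sph m) → (Fin n → Sph m) := fun g x =>
    if g.2 = 0 then act g.1 x else act g.1 (T x)
  obtain ⟨κ, hκ⟩ := exists_equivariant ρ (fun x => act_zero x)
    (by
      rintro ⟨a, s⟩ ⟨b, t⟩ x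
      rcases zmod_two_cases s with rfl | rfl <;> rcases zmod_two_cases t with rfl | rfl <;>
        simp [ρ, act_act, hTa, hTT, CharTwo.add_self_eq_zero])
    (by
      rintro ⟨a, s⟩ x h
      rcases zmod_two_cases s with rfl | rfl
      · have h : act a x = act 0 x := h
        rw [act_injective x h]; rfl
      · have h : act a (T x) = x := h
        refine absurd ?_ (hfree a x)
        nth_rw 2 [← h]
        rw [act_act, show a + a = 0 from funext fun _ => CharTwo.add_self_eq_zero _, act_zero])
  have hκs : ∀ j x, κ (sgl j x) = (Pi.single j 1, 0) + κ x := fun j x => by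
    rw [← hκ, sgl_eq_act]; rfl
  have hκT : ∀ x, κ (T x) = (0, 1) + κ x := fun x => by
    rw [← hκ]; rfl
  have hTs : ∀ f ∈ range (sgl (m := m) (n := n)), f ∘ T = T ∘ f := by
    rintro _ ⟨j, rfl⟩
    funext x
    simp only [Function.comp_apply, sgl_eq_act, hTa]
  let χ : (Fin n → Sph m) → ZMod 2 := fun x => (κ x).2
  have hχF : ∀ f ∈ range (sgl (m := m) (n := n)), ∀ x, χ (f x) = χ x := by
    rintro _ ⟨j, rfl⟩ x
    simp [χ, hκs]
  have hχ : ∀ x, χ (T x) = χ x + 1 := fun x => by simp [χ, hκT, add_comm]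
  let c : Fin n → (Fin n → Sph m) → ZMod 2 := fun j x => (κ x).1 j
  have hc : ∀ j i x, c j (sgl i x) = c j x + if i = j then 1 else 0 := by
    intro j i x
    simp [c, hκs, Pi.single_apply, add_comm, eq_comm]
  have hcT : ∀ j x, c j (T x) = c j x := fun j x => by simp [c, hκT]
  have hq : ∀ j, Quasi (insert T (range sgl)) (c j) := by
    rintro j _ (rfl | ⟨i, rfl⟩) x y
    · rw [hcT, hcT]
    · rw [hc, hc]; ring
  have hsub := subset_insert T (range (sgl (m := m) (n := n)))
  have hq' : ∀ j, Quasi (range sgl) (c j) := fun j f hf => hq j f (hsub hf)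
  let N : Submodule (ZMod 2) (List (Fin n → Sph m) → ZMod 2) :=
    inv (Λ := ZMod 2) (insert T (range sgl)) ⊔ Bd (Λ := ZMod 2) (range sgl) univ
  have hN : Zc (range sgl) ≤ N := by
    refine Zc_le_of_closed n c hc N (Submodule.mem_sup_left (one_mem_inv _)) le_sup_right ?_
    intro j φ _ hφ
    obtain ⟨a, ha, b, hb, rfl⟩ := Submodule.mem_sup.1 hφ
    rw [map_add]
    exact Submodule.add_mem_sup (dcup_mem_inv_of_quasi (hq j) ha) (dcup_mem_Bd_of_quasi (hq' j) hb)
  have hres : ∀ κ ∈ Zc (range (sgl (m := m) (n := n))),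
      ∃ κ' ∈ inv (Λ := ZMod 2) (insert T (range sgl)),
        κ - κ' ∈ Bd (Λ := ZMod 2) (range sgl) univ := by
    intro φ hφ
    obtain ⟨a, ha, b, hb, rfl⟩ := Submodule.mem_sup.1 (hN hφ)
    exact ⟨a, ha, by rwa [add_sub_cancel_left]⟩
  obtain ⟨M, hM⟩ := iterate_dcup_mem_Bd (τ := T) hχF hχ
    (ι := Fin n × Fin (m + 1) × Fin (m + 1))
    (fun i x => (x i.1).1 i.2.1 * (x i.1).1 i.2.2 - (T x i.1).1 i.2.1 * (T x i.1).1 i.2.2)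
    (fun i => by
      have h1 : Continuous fun x : Fin n → Sph m => x i.1 := continuous_apply i.1
      have h2 : Continuous fun x : Fin n → Sph m => T x i.1 := (continuous_apply i.1).comp hT
      exact (((continuous_coord _).comp h1).mul ((continuous_coord _).comp h1)).sub
        (((continuous_coord _).comp h2).mul ((continuous_coord _).comp h2)))
    (by
      rintro i _ ⟨j, rfl⟩ x
      simp only [sgl_eq_act, hTa, act_congr_sq])
    (by intro i x; simp only [hTT]; ring)
    (by
      intro x
      by_contra! h
      have : ∀ j, ∃ a, T x j = sg a (x j) := fun j => eq_sg_of_mul_eq fun k l =>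
        (sub_eq_zero.1 (h (j, k, l))).symm
      choose b hb using this
      exact hfree b x (funext hb))
  have hq1 := quasi_insert hχF hχ
  have hdesc : ∀ k ≤ M, (dcup χ)^[M - k] one ∈
      Bd (Λ := ZMod 2) (insert T (range (sgl (m := m) (n := n)))) univ := by
    intro k
    induction k with
    | zero => exact fun _ => hM _ (one_mem_Zc _)
    | succ k ih =>
      intro hk
      have h1 := ih (by omega)
      rw [show M - k = M - (k + 1) + 1 by omega, Function.iterate_succ_apply'] at h1
      exact mem_Bd_of_dcup_mem_Bd (funext hTT) hTs (ucOn_of_continuous hT) hχF hχ hres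
        (iterate_dcup_mem_Zc hq1 (one_mem_Zc _) _) h1
  obtain ⟨ψ, -, h0, h⟩ := hdesc M le_rfl
  have := singleton_of_mem_LZ h (mem_univ fun _ => pole 0)
  simp [h0] at this

end FreeInvolution

section Resolution
variable {Λ C C' : Type*} [CommRing Λ] [AddCommGroup C] [Module Λ C] [AddCommGroup C']
  {m : ℕ} {δ : C →ₗ[Λ] C} {E : ℕ → Submodule Λ C}

/-- Acyclicity of a filtered endomorphism `δ` below level `m + 2`. -/
structure IsRes (m : ℕ) (δ : C →ₗ[Λ] C) (E : ℕ → Submodule Λ C) : Prop where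
  dd : ∀ x, δ (δ x) = 0
  bot : ∀ x ∈ E 0, x = 0
  exact : ∀ k ≤ m + 1, ∀ x ∈ E k, δ x = 0 → ∃ y ∈ E (k - 1), δ y = x

/-- The endomorphism `T` commutes with `δ` and preserves `E`. -/
structure Compat (δ : C →ₗ[Λ] C) (E : ℕ → Submodule Λ C) (T : Module.End Λ C) : Prop where
  comm : ∀ x, δ (T x) = T (δ x)
  mem : ∀ d, ∀ x ∈ E d, T x ∈ E d

namespace Compat
variable {S T : Module.End Λ C}

lemma one : Compat δ E 1 := ⟨fun _ => rfl, fun _ _ h => h⟩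
lemma zero : Compat δ E 0 := ⟨fun _ => map_zero _, fun _ _ _ => zero_mem _⟩
lemma add (hS : Compat δ E S) (hT : Compat δ E T) : Compat δ E (S + T) :=
  ⟨fun x => by simp [hS.comm, hT.comm], fun d x h => add_mem (hS.mem d x h) (hT.mem d x h)⟩
lemma sub (hS : Compat δ E S) (hT : Compat δ E T) : Compat δ E (S - T) :=
  ⟨fun x => by simp [hS.comm, hT.comm], fun d x h => sub_mem (hS.mem d x h) (hT.mem d x h)⟩
lemma neg (hS : Compat δ E S) : Compat δ E (-S) :=
  ⟨fun x => by simp [hS.comm], fun d x h => neg_mem (hS.mem d x h)⟩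
lemma mul (hS : Compat δ E S) (hT : Compat δ E T) : Compat δ E (S * T) :=
  ⟨fun x => by simp [hS.comm, hT.comm], fun d x h => hS.mem d _ (hT.mem d x h)⟩
lemma pow (hS : Compat δ E S) (k : ℕ) : Compat δ E (S ^ k) := by
  induction k with
  | zero => exact one
  | succ k ih => rw [pow_succ]; exact ih.mul hS

end Compat

/-- A sequence of cochains connected by the operators `T`. -/
structure IsRow (m : ℕ) (δ : C →ₗ[Λ] C) (E : ℕ → Submodule Λ C) (T : ℕ → Module.End Λ C)
    (V : ℕ → C) : Prop where
  mem : ∀ k, V k ∈ E (m + 2 - k)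
  rel : ∀ k, δ (V (k + 1)) = T k (V k)

lemma exists_row (h : IsRes m δ E) {T : ℕ → Module.End Λ C} (hT : ∀ k, Compat δ E (T k))
    (hTT : ∀ k x, T (k + 1) (T k x) = 0) {u : C} (hu : u ∈ E (m + 2))
    (h1 : ∃ a ∈ E (m + 1), δ a = T 0 u) : ∃ V, V 0 = u ∧ IsRow m δ E T V := by
  classical
  let step : ℕ → C → C := fun k x =>
    if h : ∃ y ∈ E (m + 1 - k), δ y = T k x then h.choose else 0
  let V : ℕ → C := fun k => Nat.rec u step k
  have hV : ∀ k, (∃ y ∈ E (m + 1 - k), δ y = T k (V k)) →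
      V (k + 1) ∈ E (m + 1 - k) ∧ δ (V (k + 1)) = T k (V k) := fun k hk => by
    have : V (k + 1) = hk.choose := dif_pos hk
    rw [this]
    exact hk.choose_spec
  have key : ∀ k, V (k + 1) ∈ E (m + 1 - k) ∧ δ (V (k + 1)) = T k (V k) := by
    intro k
    induction k with
    | zero => exact hV 0 h1
    | succ k ih =>
      apply hV
      have := h.exact (m + 1 - k) (by omega) (T (k + 1) (V (k + 1)))
        ((hT _).mem _ _ ih.1) (by rw [(hT _).comm, ih.2, hTT])
      rwa [Nat.sub_sub] at this
  refine ⟨V, rfl, ⟨fun k => ?_, fun k => (key k).2⟩⟩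
  cases k with
  | zero => exact hu
  | succ k =>
    rw [show m + 2 - (k + 1) = m + 1 - k by omega]
    exact (key k).1

lemma row_unique (h : IsRes m δ E) {T : ℕ → Module.End Λ C} (hT : ∀ k, Compat δ E (T k))
    (hTT : ∀ k x, T (k + 1) (T k x) = 0) {V V' : ℕ → C} (hV : IsRow m δ E T V)
    (hV' : IsRow m δ E T V') (h0 : ∃ w ∈ E (m + 1), δ w = V 0 - V' 0) :
    ∃ w ∈ E 1, V (m + 1) - V' (m + 1) = T m w := by
  have key : ∀ k, k ≤ m → ∃ w ∈ E (m + 1 - k), ∃ z, δ w + z = V k - V' k ∧ T k z = 0 := by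
    intro k
    induction k with
    | zero =>
      intro _
      obtain ⟨w, hw, e⟩ := h0
      exact ⟨w, hw, 0, by rw [e, add_zero], map_zero _⟩
    | succ k ih =>
      intro hk
      obtain ⟨w, hw, z, e, hz⟩ := ih (by omega)
      obtain ⟨y, hy, hy'⟩ := h.exact (m + 1 - k) (by omega) (V (k + 1) - V' (k + 1) - T k w)
        (sub_mem (sub_mem (by simpa [show m + 2 - (k + 1) = m + 1 - k by omega] using hV.mem (k + 1))
          (by simpa [show m + 2 - (k + 1) = m + 1 - k by omega] using hV'.mem (k + 1)))
          ((hT _).mem _ _ hw))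
        (by rw [map_sub, map_sub, hV.rel, hV'.rel, (hT _).comm, ← map_sub, ← map_sub, ← e,
            add_sub_cancel_left, hz])
      exact ⟨y, by rwa [Nat.sub_sub] at hy, T k w, by rw [hy']; abel, hTT _ _⟩
  obtain ⟨w, hw, z, e, hz⟩ := key m le_rfl
  rw [Nat.add_sub_cancel_left] at hw
  have h1 := hV.mem (m + 1)
  have h2 := hV'.mem (m + 1)
  rw [show m + 2 - (m + 1) = 1 by omega] at h1 h2
  refine ⟨w, hw, ?_⟩
  obtain ⟨y, hy, hy'⟩ := h.exact 1 (by omega) (V (m + 1) - V' (m + 1) - T m w)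
    (sub_mem (sub_mem h1 h2) ((hT _).mem _ _ hw))
    (by rw [map_sub, map_sub, hV.rel, hV'.rel, (hT _).comm, ← map_sub, ← map_sub, ← e,
            add_sub_cancel_left, hz])
  rw [h.bot y hy, map_zero] at hy'
  exact sub_eq_zero.1 hy'.symm

lemma IsRow.top (h : IsRes m δ E) {T : ℕ → Module.End Λ C} {V : ℕ → C}
    (hV : IsRow m δ E T V) : T (m + 1) (V (m + 1)) = 0 := by
  have := hV.mem (m + 1 + 1)
  rw [Nat.sub_self] at this
  rw [← hV.rel, h.bot _ this, map_zero]

/-- Alternating sequence of operators. -/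
def alt (a b : Module.End Λ C) (k : ℕ) : Module.End Λ C := if Even k then a else b

lemma alt_even (a b : Module.End Λ C) (k : ℕ) : alt a b (2 * k) = a := if_pos (even_two_mul k)
lemma alt_odd (a b : Module.End Λ C) (k : ℕ) : alt a b (2 * k + 1) = b :=
  if_neg (by simp)

lemma alt_compat {a b : Module.End Λ C} (ha : Compat δ E a) (hb : Compat δ E b) (k : ℕ) :
    Compat δ E (alt a b k) := by
  unfold alt; split_ifs <;> assumption

lemma alt_alt {a b : Module.End Λ C} (hab : ∀ x, a (b x) = 0) (hba : ∀ x, b (a x) = 0) (k : ℕ)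
    (x : C) : alt a b (k + 1) (alt a b k x) = 0 := by
  rcases Nat.even_or_odd' k with ⟨l, rfl | rfl⟩
  · rw [alt_odd, alt_even, hba]
  · rw [alt_odd, show 2 * l + 1 + 1 = 2 * (l + 1) by ring, alt_even, hab]

/-- Shifted sequence with vanishing initial term. -/
def shft (A : ℕ → Module.End Λ C) : ℕ → Module.End Λ C
  | 0 => 0
  | k + 1 => A k

lemma shft_zero (A : ℕ → Module.End Λ C) : shft A 0 = 0 := rfl
lemma shft_succ (A : ℕ → Module.End Λ C) (k : ℕ) : shft A (k + 1) = A k := rfl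

/-- Doubly indexed analogue of `IsRow`, for two sequences of operators. -/
structure IsFam (m : ℕ) (δ : C →ₗ[Λ] C) (E : ℕ → Submodule Λ C) (A B : ℕ → Module.End Λ C)
    (U : ℕ → ℕ → C) : Prop where
  mem : ∀ p q, U p q ∈ E (m + 2 - (p + q))
  rel : ∀ p q, p + q ≠ 0 →
    δ (U p q) = shft A p (U (p - 1) q) + (-1 : ℤ) ^ p • shft B q (U p (q - 1))

/-- The total operators of a pair of sequences of operators. -/
def tot (A B : ℕ → Module.End Λ C) (k : ℕ) : Module.End Λ (ℕ → C) where
  toFun f p := shft A p (f (p - 1)) + (-1 : ℤ) ^ p • shft B (k + 1 - p) (f p)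
  map_add' f g := by
    funext p; simp only [Pi.add_apply, map_add, smul_add]; abel
  map_smul' r f := by
    funext p; simp only [Pi.smul_apply, map_smul, RingHom.id_apply, smul_add, smul_comm r]

lemma tot_apply (A B : ℕ → Module.End Λ C) (k : ℕ) (f : ℕ → C) (p : ℕ) :
    tot A B k f p = shft A p (f (p - 1)) + (-1 : ℤ) ^ p • shft B (k + 1 - p) (f p) := rfl

lemma tot_tot {A B : ℕ → Module.End Λ C} (hA : ∀ k x, A (k + 1) (A k x) = 0)
    (hB : ∀ k x, B (k + 1) (B k x) = 0) (hAB : ∀ j k x, A j (B k x) = B k (A j x)) (k : ℕ)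
    (f : ℕ → C) : tot A B (k + 1) (tot A B k f) = 0 := by
  funext p
  have hB' : ∀ q x, shft B (q + 1) (shft B q x) = 0 := by
    intro q x
    cases q with
    | zero => simp [shft]
    | succ q => exact hB q x
  have hAB' : ∀ i q x, A i (shft B q x) = shft B q (A i x) := by
    intro i q x
    cases q with
    | zero => simp [shft]
    | succ q => exact hAB _ _ _
  have hpp : ∀ p x, ((-1 : ℤ) ^ p) • ((-1 : ℤ) ^ p • (x : C)) = x := fun p x => by
    rw [smul_smul, ← mul_pow]; simp
  have hBB : ∀ x, shft B (k + 1 + 1 - p) (shft B (k + 1 - p) x) = 0 := by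
    intro x
    by_cases hp : p ≤ k + 1
    · rw [show k + 1 + 1 - p = k + 1 - p + 1 by omega, hB']
    · rw [show k + 1 + 1 - p = 0 by omega]; rfl
  simp only [tot_apply, Pi.zero_apply, map_add, map_zsmul, smul_add, hBB, smul_zero]
  cases p with
  | zero => simp [shft]
  | succ p =>
    cases p with
    | zero => simp [shft, hAB]
    | succ p =>
      simp only [shft_succ, Nat.add_sub_cancel, hA, hAB']
      rw [show k + 1 + 1 - (p + 1 + 1) = k + 1 - (p + 1) by omega, pow_succ _ (p + 1), mul_smul]
      simp [-Nat.reduceSubDiff]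

/-- Pointwise differential on sequences of cochains. -/
def piδ (δ : C →ₗ[Λ] C) : (ℕ → C) →ₗ[Λ] (ℕ → C) := δ.compLeft ℕ

lemma piδ_apply (f : ℕ → C) (p : ℕ) : piδ δ f p = δ (f p) := rfl

/-- Pointwise filtration on sequences of cochains. -/
def piE (E : ℕ → Submodule Λ C) (d : ℕ) : Submodule Λ (ℕ → C) := Submodule.pi univ fun _ => E d

lemma mem_piE {d : ℕ} {f : ℕ → C} : f ∈ piE E d ↔ ∀ p, f p ∈ E d := by simp [piE]

lemma IsRes.pi (h : IsRes m δ E) : IsRes m (piδ δ) (piE E) where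
  dd x := funext fun p => h.dd _
  bot x hx := funext fun p => h.bot _ (mem_piE.1 hx p)
  exact k hk x hx hδ := by
    choose y hy hy' using fun p => h.exact k hk (x p) (mem_piE.1 hx p) (congrFun hδ p)
    exact ⟨y, mem_piE.2 hy, funext hy'⟩

lemma shft_compat {A : ℕ → Module.End Λ C} (hA : ∀ k, Compat δ E (A k)) (k : ℕ) :
    Compat δ E (shft A k) := by
  cases k with
  | zero => exact Compat.zero
  | succ k => exact hA k

lemma tot_compat {A B : ℕ → Module.End Λ C} (hA : ∀ k, Compat δ E (A k))
    (hB : ∀ k, Compat δ E (B k)) (k : ℕ) : Compat (piδ δ) (piE E) (tot A B k) := by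
  refine ⟨fun x => funext fun p => ?_, fun d x hx => mem_piE.2 fun p => ?_⟩
  · simp only [piδ_apply, tot_apply, map_add, map_zsmul, (shft_compat hA _).comm,
      (shft_compat hB _).comm]
  · exact add_mem ((shft_compat hA _).mem _ _ (mem_piE.1 hx _))
      (zsmul_mem ((shft_compat hB _).mem _ _ (mem_piE.1 hx _)) _)

section
variable {A B : ℕ → Module.End Λ C} (hA : ∀ k, Compat δ E (A k)) (hB : ∀ k, Compat δ E (B k))
  (hAA : ∀ k x, A (k + 1) (A k x) = 0) (hBB : ∀ k x, B (k + 1) (B k x) = 0)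
  (hAB : ∀ j k x, A j (B k x) = B k (A j x))
include hA hB hAA hBB hAB

lemma exists_fam (h : IsRes m δ E) {u : C} (hu : u ∈ E (m + 2))
    (h1 : ∃ a ∈ E (m + 1), δ a = A 0 u) (h2 : ∃ b ∈ E (m + 1), δ b = B 0 u) :
    ∃ U, U 0 0 = u ∧ IsFam m δ E A B U := by
  obtain ⟨a, ha, ha'⟩ := h1
  obtain ⟨b, hb, hb'⟩ := h2
  obtain ⟨V, hV0, hV⟩ := exists_row h.pi (tot_compat hA hB) (tot_tot hAA hBB hAB)
    (u := fun p => if p = 0 then u else 0)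
    (mem_piE.2 fun p => by split_ifs; exacts [hu, zero_mem _])
    ⟨fun p => if p = 0 then b else if p = 1 then a else 0,
      mem_piE.2 fun p => by split_ifs; exacts [hb, ha, zero_mem _],
      funext fun p => by
        rw [piδ_apply, tot_apply]
        rcases p with _ | _ | p
        · simp [shft, hb']
        · simp [shft, ha']
        · simp [shft]⟩
  refine ⟨fun p q => V (p + q) p, by simp [hV0], fun p q => mem_piE.1 (hV.mem _) p, ?_⟩
  intro p q hpq
  obtain ⟨k, hk⟩ := Nat.exists_eq_succ_of_ne_zero hpq
  have := congrFun (hV.rel k) p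
  rw [piδ_apply, tot_apply] at this
  rw [hk, Nat.succ_eq_add_one, this]
  congr 1
  · cases p with
    | zero => simp [shft]
    | succ p => rw [Nat.add_sub_cancel, show p + q = k by omega]
  · cases q with
    | zero => simp [shft, show k + 1 - p = 0 by omega]
    | succ q => rw [Nat.add_sub_cancel, show k + 1 - p = q + 1 by omega, show p + q = k by omega]

lemma fam_unique (h : IsRes m δ E) {U U' : ℕ → ℕ → C} (hU : IsFam m δ E A B U)
    (hU' : IsFam m δ E A B U') (h0 : ∃ w ∈ E (m + 1), δ w = U 0 0 - U' 0 0) {p q : ℕ}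
    (hpq : p + q = m + 1) :
    ∃ w ∈ E 1, ∃ w' ∈ E 1, U p q - U' p q = shft A p w + (-1 : ℤ) ^ p • shft B q w' := by
  have hrow : ∀ {U : ℕ → ℕ → C}, IsFam m δ E A B U →
      IsRow m (piδ δ) (piE E) (tot A B) fun k p => if p ≤ k then U p (k - p) else 0 := by
    intro U hU
    refine ⟨fun k => mem_piE.2 fun p => ?_, fun k => funext fun p => ?_⟩
    · split_ifs with hp
      · have := hU.mem p (k - p)
        rwa [Nat.add_sub_cancel' hp] at this
      · exact zero_mem _
    · rw [piδ_apply, tot_apply]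
      by_cases hp : p ≤ k + 1
      · rw [if_pos hp, hU.rel _ _ (by omega)]
        congr 1
        · cases p with
          | zero => simp [shft]
          | succ p =>
            rw [Nat.add_sub_cancel, if_pos (by omega), show k + 1 - (p + 1) = k - p by omega]
        · by_cases hp' : p ≤ k
          · rw [if_pos hp', show k + 1 - p - 1 = k - p by omega]
          · rw [show k + 1 - p = 0 by omega]; simp [shft]
      · rw [if_neg hp, if_neg (by omega), if_neg (by omega)]; simp
  obtain ⟨w, hw, hw'⟩ := h0
  obtain ⟨z, hz, e⟩ := row_unique h.pi (tot_compat hA hB) (tot_tot hAA hBB hAB) (hrow hU)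
    (hrow hU') ⟨fun p => if p = 0 then w else 0,
      mem_piE.2 fun p => by split_ifs; exacts [hw, zero_mem _],
      funext fun p => by
        rw [piδ_apply]
        cases p with
        | zero => simp [hw']
        | succ p => simp⟩
  refine ⟨z (p - 1), mem_piE.1 hz _, z p, mem_piE.1 hz _, ?_⟩
  have := congrFun e p
  rw [tot_apply, show m + 1 - p = q by omega] at this
  rw [← this]
  simp [show p ≤ m + 1 by omega, show m + 1 - p = q by omega]

end

end Resolution

section Concrete
variable {X X' X'' Λ : Type*} [CommRing Λ]

/-- Cochains supported on lists of length exactly `d`. -/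
def homog (d : ℕ) : Submodule Λ (List X → Λ) where
  carrier := {φ | ∀ l, l.length ≠ d → φ l = 0}
  add_mem' ha hb l hl := by simp [ha l hl, hb l hl]
  zero_mem' _ _ := rfl
  smul_mem' c φ h l hl := by simp [h l hl]

lemma homog_le_supp (d : ℕ) : homog (X := X) (Λ := Λ) d ≤ supp d := fun _ h l hl => h l hl.ne'

/-- Projection to cochains supported on lists of length exactly `d`. -/
def homogProj (d : ℕ) : (List X → Λ) →ₗ[Λ] (List X → Λ) where
  toFun φ l := if l.length = d then φ l else 0
  map_add' φ ψ := by funext l; by_cases h : l.length = d <;> simp [h]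
  map_smul' c φ := by funext l; by_cases h : l.length = d <;> simp [h]

lemma homogProj_apply (d : ℕ) (φ : List X → Λ) (l : List X) :
    homogProj d φ l = if l.length = d then φ l else 0 := rfl

lemma homogProj_mem (d : ℕ) (φ : List X → Λ) : homogProj d φ ∈ homog (Λ := Λ) d :=
  fun _ h => if_neg h

lemma homogProj_of_mem {d : ℕ} {φ : List X → Λ} (h : φ ∈ homog d) : homogProj d φ = φ := by
  funext l
  rw [homogProj_apply]
  split_ifs with hl
  · rfl
  · exact (h l hl).symm

lemma homogProj_cobd (d : ℕ) (φ : List X → Λ) :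
    homogProj (d + 1) (cobd φ) = cobd (homogProj d φ) := by
  have h : ∀ (d : ℕ) (φ : List X → Λ),
      homogProj (d + 1) φ = trunc (d + 1) φ - trunc d φ := fun d φ => by
    funext l
    rw [homogProj_apply, Pi.sub_apply, trunc_apply, trunc_apply]
    split_ifs <;> first | omega | simp
  rw [h, trunc_cobd]
  cases d with
  | zero =>
    have h1 : trunc 0 (cobd φ) = 0 := by
      funext l
      rcases l with _ | ⟨x, l⟩ <;> simp [trunc_apply]
    rw [h1, sub_zero]
    congr 1
    funext l
    simp [trunc_apply, homogProj_apply]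
  | succ d => rw [trunc_cobd, h, map_sub]

lemma pb_mem_homog (f : X → X') {d : ℕ} {φ : List X' → Λ} (h : φ ∈ homog d) :
    pb f φ ∈ homog (Λ := Λ) d := fun l hl => h _ (by rwa [List.length_map])

lemma homogProj_mem_LZ [PseudoMetricSpace X] {Y : Set X} (d : ℕ) {φ : List X → Λ}
    (h : φ ∈ LZ Y) : homogProj d φ ∈ LZ (Λ := Λ) Y := by
  obtain ⟨ε, hε, h⟩ := h
  refine ⟨ε, hε, fun l hl => ?_⟩
  rw [homogProj_apply, h l hl, ite_self]

section Quotient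
variable [PseudoMetricSpace X] [PseudoMetricSpace X'] [PseudoMetricSpace X'']
  [CompactSpace X] [CompactSpace X'] [CompactSpace X'']

/-- Cochains modulo the locally zero ones. -/
def Cx (X Λ : Type*) [CommRing Λ] [PseudoMetricSpace X] : Type _ :=
  (List X → Λ) ⧸ (LZ univ : Submodule Λ (List X → Λ))

instance (X Λ : Type*) [CommRing Λ] [PseudoMetricSpace X] : AddCommGroup (Cx X Λ) :=
  inferInstanceAs (AddCommGroup ((List X → Λ) ⧸ (LZ univ : Submodule Λ (List X → Λ))))

instance (X Λ : Type*) [CommRing Λ] [PseudoMetricSpace X] : Module Λ (Cx X Λ) :=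
  inferInstanceAs (Module Λ ((List X → Λ) ⧸ (LZ univ : Submodule Λ (List X → Λ))))

/-- The class of a cochain. -/
def mkC : (List X → Λ) →ₗ[Λ] Cx X Λ := Submodule.mkQ _

omit [CompactSpace X] in
lemma mkC_eq_zero {φ : List X → Λ} : mkC φ = 0 ↔ φ ∈ LZ (Λ := Λ) univ :=
  Submodule.Quotient.mk_eq_zero _

omit [CompactSpace X] in
lemma mkC_eq {φ ψ : List X → Λ} : mkC φ = mkC ψ ↔ φ - ψ ∈ LZ (Λ := Λ) univ := by
  rw [← sub_eq_zero, ← map_sub, mkC_eq_zero]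

omit [CompactSpace X] in
lemma mkC_surjective : Function.Surjective (mkC : (List X → Λ) →ₗ[Λ] Cx X Λ) :=
  Submodule.mkQ_surjective _

/-- The coboundary on classes of cochains. -/
def dC : Cx X Λ →ₗ[Λ] Cx X Λ := Submodule.mapQ _ _ cobd fun _ h => cobd_mem_LZ h

omit [CompactSpace X] in
@[simp] lemma dC_mk (φ : List X → Λ) : dC (mkC φ) = mkC (cobd φ) := rfl

/-- Pullback on classes of cochains. -/
def pbC (f : C(X, X')) : Cx X' Λ →ₗ[Λ] Cx X Λ :=
  Submodule.mapQ _ _ (pb f) fun _ h => pb_mem_LZ (ucOn_of_continuous f.continuous) (mapsTo_univ _ _) h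

omit [CompactSpace X'] in
@[simp] lemma pbC_mk (f : C(X, X')) (φ : List X' → Λ) : pbC f (mkC φ) = mkC (pb f φ) := rfl

/-- Evaluation of a cochain on the empty list. -/
def evC : Cx X Λ →ₗ[Λ] Λ := Submodule.liftQ _ (LinearMap.proj []) fun _ h => nil_of_mem_LZ h

omit [CompactSpace X] in
@[simp] lemma evC_mk (φ : List X → Λ) : evC (mkC φ) = φ [] := rfl

/-- The grading of the classes of cochains, shifted by two. -/
def filt (X Λ : Type*) [CommRing Λ] [PseudoMetricSpace X] : ℕ → Submodule Λ (Cx X Λ)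
  | 0 => ⊥
  | d + 1 => (homog d).map mkC

omit [CompactSpace X] in
lemma dC_dC (x : Cx X Λ) : dC (dC x) = 0 := by
  obtain ⟨φ, rfl⟩ := mkC_surjective x
  simp [cobd_cobd]

omit [CompactSpace X'] in
lemma dC_pbC (f : C(X, X')) (x : Cx X' Λ) : dC (pbC f x) = pbC f (dC x) := by
  obtain ⟨φ, rfl⟩ := mkC_surjective x
  simp [cobd_pb]

omit [CompactSpace X'] in
lemma pbC_mem (f : C(X, X')) (d : ℕ) (x : Cx X' Λ) (h : x ∈ filt X' Λ d) :
    pbC f x ∈ filt X Λ d := by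
  cases d with
  | zero =>
    rw [(Submodule.mem_bot Λ).1 h, map_zero]
    exact zero_mem _
  | succ d =>
    obtain ⟨φ, hφ, rfl⟩ := h
    exact ⟨_, pb_mem_homog f hφ, rfl⟩

omit [CompactSpace X''] in
lemma pbC_pbC (f : C(X, X')) (g : C(X', X'')) (x : Cx X'' Λ) :
    pbC f (pbC g x) = pbC (g.comp f) x := by
  obtain ⟨φ, rfl⟩ := mkC_surjective x
  simp [pb_pb]

lemma pbC_id (x : Cx X Λ) : pbC (ContinuousMap.id X) x = x := by
  obtain ⟨φ, rfl⟩ := mkC_surjective x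
  exact congrArg mkC (pb_id φ)

omit [CompactSpace X'] in
@[simp] lemma evC_pbC (f : C(X, X')) (x : Cx X' Λ) : evC (pbC f x) = evC x := by
  obtain ⟨φ, rfl⟩ := mkC_surjective x
  simp

lemma pbC_compat (f : C(X, X)) : Compat dC (filt X Λ) (pbC f) := ⟨dC_pbC f, pbC_mem f⟩

omit [CompactSpace X] in
lemma evC_dC (x : Cx X Λ) : evC (dC x) = 0 := by
  obtain ⟨φ, rfl⟩ := mkC_surjective x
  simp

omit [CompactSpace X] in
lemma mkC_cast_eq {φ ψ : List X → ℤ} (h : mkC φ = mkC ψ) :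
    mkC (fun l => (φ l : ZMod 2)) = mkC fun l => (ψ l : ZMod 2) := by
  obtain ⟨ε, hε, h⟩ := mkC_eq.1 h
  refine mkC_eq.2 ⟨ε, hε, fun l hl => ?_⟩
  rw [Pi.sub_apply, sub_eq_zero.1 (h l hl), sub_self]

/-- Reduction modulo two. -/
def red : Cx X ℤ →+ Cx X (ZMod 2) :=
  AddMonoidHom.mk' (fun x => mkC fun l => ((Function.surjInv (mkC_surjective (Λ := ℤ)) x l : ℤ) : ZMod 2)) (by
    intro x y
    rw [← map_add]
    refine (mkC_cast_eq (φ := Function.surjInv (mkC_surjective (Λ := ℤ)) (x + y))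
      (ψ := Function.surjInv (mkC_surjective (Λ := ℤ)) x + Function.surjInv (mkC_surjective (Λ := ℤ)) y) ?_).trans ?_
    · rw [map_add]
      simp only [Function.surjInv_eq]
    · congr 1
      funext l
      simp)

omit [CompactSpace X] in
lemma red_mk (φ : List X → ℤ) : red (mkC φ) = mkC fun l => (φ l : ZMod 2) :=
  mkC_cast_eq (Function.surjInv_eq mkC_surjective _)

omit [PseudoMetricSpace X] [CompactSpace X] in
lemma cast_cobd (φ : List X → ℤ) :
    (fun l => ((cobd φ l : ℤ) : ZMod 2)) = cobd fun l => (φ l : ZMod 2) := by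
  funext l
  induction l generalizing φ with
  | nil => simp
  | cons x l ih => rw [cobd_cons, cobd_cons, Int.cast_sub, ih]

omit [CompactSpace X] in
lemma red_dC (x : Cx X ℤ) : red (dC x) = dC (red x) := by
  obtain ⟨φ, rfl⟩ := mkC_surjective x
  rw [dC_mk, red_mk, red_mk, dC_mk, cast_cobd]

omit [CompactSpace X'] in
lemma red_pbC (f : C(X, X')) (x : Cx X' ℤ) : red (pbC f x) = pbC f (red x) := by
  obtain ⟨φ, rfl⟩ := mkC_surjective x
  rw [pbC_mk, red_mk, red_mk, pbC_mk]
  rfl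

omit [CompactSpace X] in
lemma red_mem (d : ℕ) (x : Cx X ℤ) (h : x ∈ filt X ℤ d) : red x ∈ filt X (ZMod 2) d := by
  cases d with
  | zero =>
    rw [(Submodule.mem_bot ℤ).1 h, map_zero]
    exact zero_mem _
  | succ d =>
    obtain ⟨φ, hφ, rfl⟩ := h
    refine ⟨_, fun l hl => ?_, (red_mk φ).symm⟩
    rw [hφ l hl, Int.cast_zero]

omit [CompactSpace X] in
lemma evC_red (x : Cx X ℤ) : evC (red x) = ((evC x : ℤ) : ZMod 2) := by
  obtain ⟨φ, rfl⟩ := mkC_surjective x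
  rw [red_mk, evC_mk, evC_mk]

omit [CompactSpace X] in
lemma evC_of_mem {d : ℕ} {x : Cx X Λ} (h : x ∈ filt X Λ (d + 2)) : evC x = 0 := by
  obtain ⟨φ, hφ, rfl⟩ := h
  exact hφ [] (by simp)

omit [CompactSpace X] in
lemma eq_of_mem_filt_one {x y : Cx X Λ} (hx : x ∈ filt X Λ 1) (hy : y ∈ filt X Λ 1)
    (h : evC x = evC y) : x = y := by
  obtain ⟨φ, hφ, rfl⟩ := hx
  obtain ⟨ψ, hψ, rfl⟩ := hy
  congr 1
  funext l
  cases l with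
  | nil => exact h
  | cons a l => rw [hφ _ (by simp), hψ _ (by simp)]

end Quotient

end Concrete

section Classes
variable {m n : ℕ} {Λ : Type*} [CommRing Λ]

lemma exists_rotation (hm : Odd m) : ∃ h : ℝ × Sph m → Sph m,
    UniformContinuousOn h (Icc 0 1 ×ˢ univ) ∧ (∀ x, h (0, x) = x) ∧ ∀ x, h (1, x) = -x := by
  let σ : Fin (m + 1) → Fin (m + 1) := fun i =>
    if h : Even (i : ℕ) then ⟨i + 1, by have := i.2; grind⟩ else ⟨i - 1, by omega⟩
  let ε : Fin (m + 1) → ℝ := fun i => if Even (i : ℕ) then 1 else -1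
  have hσ : ∀ i, σ (σ i) = i := fun i => by
    apply Fin.ext
    by_cases h : Even (i : ℕ)
    · have h2 : ¬ Even ((i : ℕ) + 1) := by grind
      simp [σ, h, h2]
    · have h2 : Even ((i : ℕ) - 1) := by grind
      have : 0 < (i : ℕ) := by grind
      simp [σ, h, h2]; omega
  have hε : ∀ i, ε (σ i) = -ε i := fun i => by
    by_cases h : Even (i : ℕ)
    · have h2 : ¬ Even ((i : ℕ) + 1) := by grind
      simp [σ, ε, h, h2]
    · have h2 : Even ((i : ℕ) - 1) := by grind
      simp [σ, ε, h, h2]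
  have hε2 : ∀ i, ε i * ε i = 1 := fun i => by simp only [ε]; split_ifs <;> norm_num
  let v : ℝ × Sph m → EuclideanSpace ℝ (Fin (m + 1)) := fun p => WithLp.toLp 2 fun i =>
    Real.cos (Real.pi * p.1) * p.2.1 i + Real.sin (Real.pi * p.1) * (ε i * p.2.1 (σ i))
  have hv : Continuous v := by
    refine (PiLp.continuous_toLp 2 _).comp (continuous_pi fun i => ?_)
    have := fun i => (continuous_coord (m := m) i).comp (continuous_snd (X := ℝ))
    simp only [Function.comp_def] at this
    have h1 := this i
    have h2 := this (σ i)
    fun_prop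
  have hv0 : ∀ p, v p ≠ 0 := by
    intro p h
    obtain ⟨i, hi⟩ := exists_coord_ne_zero p.2
    apply hi
    have e : ∀ j, Real.cos (Real.pi * p.1) * p.2.1 j +
        Real.sin (Real.pi * p.1) * (ε j * p.2.1 (σ j)) = 0 := fun j => by
      have := congrArg (fun w : EuclideanSpace ℝ (Fin (m + 1)) => w j) h
      simpa [v] using this
    have e1 := e i
    have e2 := e (σ i)
    rw [hσ, hε] at e2
    have e3 := Real.sin_sq_add_cos_sq (Real.pi * p.1)
    linear_combination (-(p.2.1 i)) * e3 + Real.cos (Real.pi * p.1) * e1 -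
      Real.sin (Real.pi * p.1) * ε i * e2 - (Real.sin (Real.pi * p.1)) ^ 2 * p.2.1 i * hε2 i
  refine ⟨fun p => nrm p.2 (v p), ucOn_nrm (isCompact_Icc.prod isCompact_univ) _ hv.continuousOn
    fun p _ => hv0 p, fun x => ?_, fun x => ?_⟩
  · have : v (0, x) = x.1 := by ext i; simp [v]
    show nrm x (v (0, x)) = x
    rw [this, nrm_of_norm_one]
  · have : v (1, x) = (-x).1 := by ext i; simp [v]
    show nrm x (v (1, x)) = -x
    rw [this, nrm_of_norm_one]

/-- Cohomologous cochain classes of degree `m`. -/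
def Cohom {X : Type*} [PseudoMetricSpace X] (m : ℕ) (x y : Cx X Λ) : Prop :=
  ∃ w ∈ filt X Λ (m + 1), dC w = x - y

namespace Cohom
variable {X X' : Type*} [PseudoMetricSpace X] [PseudoMetricSpace X'] {x y z x' y' : Cx X Λ}

lemma refl (x : Cx X Λ) : Cohom m x x := ⟨0, zero_mem _, by simp⟩
lemma of_eq (h : x = y) : Cohom m x y := h ▸ refl x
lemma symm (h : Cohom m x y) : Cohom m y x := by
  obtain ⟨w, hw, e⟩ := h
  exact ⟨-w, neg_mem hw, by rw [map_neg, e, neg_sub]⟩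
lemma trans (h : Cohom m x y) (h' : Cohom m y z) : Cohom m x z := by
  obtain ⟨w, hw, e⟩ := h
  obtain ⟨w', hw', e'⟩ := h'
  exact ⟨w + w', add_mem hw hw', by rw [map_add, e, e']; abel⟩
lemma smul (c : Λ) (h : Cohom m x y) : Cohom m (c • x) (c • y) := by
  obtain ⟨w, hw, e⟩ := h
  exact ⟨c • w, Submodule.smul_mem _ _ hw, by rw [map_smul, e, smul_sub]⟩
lemma sum {ι : Type*} (s : Finset ι) {f g : ι → Cx X Λ} (h : ∀ i, Cohom m (f i) (g i)) :
    Cohom m (∑ i ∈ s, f i) (∑ i ∈ s, g i) := by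
  choose w hw e using h
  exact ⟨∑ i ∈ s, w i, sum_mem fun i _ => hw i, by simp [e]⟩
lemma pbC [CompactSpace X'] (f : C(X', X)) (h : Cohom m x y) :
    Cohom m (pbC f x) (ASp.pbC f y) := by
  obtain ⟨w, hw, e⟩ := h
  exact ⟨_, pbC_mem f _ _ hw, by rw [dC_pbC, e, map_sub]⟩
lemma red {x y : Cx X ℤ} (h : Cohom m x y) : Cohom m (red x) (ASp.red y) := by
  obtain ⟨w, hw, e⟩ := h
  exact ⟨_, red_mem _ _ hw, by rw [← red_dC, e, map_sub]⟩

end Cohom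

/-- The fundamental class of the sphere. -/
def ub (m : ℕ) (Λ : Type*) [CommRing Λ] : Cx (Sph m) Λ := mkC (ubar m Λ m)

lemma homog_of_supp_of_trunc {X : Type*} {d : ℕ} {φ : List X → Λ} (h : φ ∈ supp (Λ := Λ) (d + 1))
    (h' : trunc d φ = 0) : φ ∈ homog (Λ := Λ) (d + 1) := by
  intro l hl
  by_cases hd : l.length ≤ d
  · have := congrFun h' l
    rwa [trunc_apply, if_pos hd] at this
  · exact h l (by omega)

lemma ub_mem : ub m Λ ∈ filt (Sph m) Λ (m + 2) :=
  ⟨_, homog_of_supp_of_trunc (ubar_mem_supp m) (trunc_ubar m m le_rfl), rfl⟩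

lemma dC_ub : dC (ub m Λ) = 0 := mkC_eq_zero.2 cobd_ubar_last

lemma cohom_of_mk {X : Type*} [PseudoMetricSpace X] {φ χ ψ : List X → Λ}
    (hφ : φ ∈ homog (Λ := Λ) (m + 1)) (hχ : χ ∈ homog (Λ := Λ) (m + 1))
    (h : φ - χ - cobd ψ ∈ LZ (Λ := Λ) univ) : Cohom m (mkC φ) (mkC χ) := by
  refine ⟨mkC (homogProj m ψ), ⟨_, homogProj_mem m ψ, rfl⟩, ?_⟩
  have := homogProj_mem_LZ (m + 1) h
  rw [map_sub, homogProj_of_mem (sub_mem hφ hχ), homogProj_cobd] at this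
  rw [← map_sub, dC_mk]
  exact (mkC_eq.2 this).symm

lemma ubar_mem_homog : ubar m Λ m ∈ homog (Λ := Λ) (m + 1) :=
  homog_of_supp_of_trunc (ubar_mem_supp m) (trunc_ubar m m le_rfl)

/-- The antipode as a bundled continuous map. -/
def negS (m : ℕ) : C(Sph m, Sph m) := ⟨fun x => -x, continuous_neg⟩

lemma cohom_neg_ub (hm : Odd m) : Cohom m (pbC (negS m) (ub m Λ)) (ub m Λ) := by
  obtain ⟨h, huc, h0, h1⟩ := exists_rotation hm
  obtain ⟨N, hN⟩ := homotopy_prism h huc (fun _ _ _ _ => mem_univ _)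
    (cobd_ubar_last (m := m) (Λ := Λ))
  simp only [h0, h1] at hN
  rw [ub, pbC_mk]
  rw [show pb (fun x : Sph m => x) (ubar m Λ m) = ubar m Λ m from pb_id _] at hN
  exact cohom_of_mk (pb_mem_homog _ ubar_mem_homog) ubar_mem_homog hN

/-- The bundled sign action. -/
def sgC (b : ZMod 2) : C(Sph m, Sph m) := ⟨sg b, continuous_sg b⟩

lemma cohom_sg_ub (hm : Odd m) (b : ZMod 2) : Cohom m (pbC (sgC b) (ub m Λ)) (ub m Λ) := by
  rcases zmod_two_cases b with rfl | rfl
  · exact Cohom.of_eq (pbC_id _)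
  · exact cohom_neg_ub hm

/-- The bundled sign action on a product. -/
def actC (b : Fin n → ZMod 2) : C(Fin n → Sph m, Fin n → Sph m) := ⟨act b, continuous_act b⟩

/-- The bundled projections. -/
def prC (j : Fin n) : C(Fin n → Sph m, Sph m) := ⟨fun x => x j, continuous_apply j⟩

/-- Linear combinations of the fundamental classes of the factors. -/
def comb (p : Fin n → Λ) : Cx (Fin n → Sph m) Λ := ∑ j, p j • pbC (prC j) (ub m Λ)

lemma comb_mem (p : Fin n → Λ) : comb p ∈ filt (Fin n → Sph m) Λ (m + 2) :=
  sum_mem fun _ _ => Submodule.smul_mem _ _ (pbC_mem _ _ _ ub_mem)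

lemma comb_single (j : Fin n) : comb (Pi.single j 1) = pbC (prC j) (ub m Λ) := by
  rw [comb, Finset.sum_eq_single j] <;> simp +contextual

lemma comb_add (p q : Fin n → Λ) : comb (m := m) (p + q) = comb p + comb q := by
  simp [comb, add_smul, Finset.sum_add_distrib]

lemma comb_neg (p : Fin n → Λ) : comb (m := m) (-p) = -comb p := by
  simp [comb]

lemma isRes (hm : 1 ≤ m) (n : ℕ) : IsRes m dC (filt (Fin n → Sph m) Λ) where
  dd := dC_dC
  bot _ h := (Submodule.mem_bot Λ).1 h
  exact k hk x hx hδ := by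
    rcases k with _ | _ | d
    · exact ⟨0, zero_mem _, by rw [map_zero, (Submodule.mem_bot Λ).1 hx]⟩
    · obtain ⟨φ, hφ, rfl⟩ := hx
      refine ⟨0, zero_mem _, ?_⟩
      rw [dC_mk, mkC_eq_zero] at hδ
      have := singleton_of_mem_LZ hδ (mem_univ fun _ => pole 0)
      rw [cobd_singleton] at this
      rw [map_zero]
      refine eq_of_mem_filt_one (zero_mem _) ⟨φ, hφ, rfl⟩ ?_
      rw [map_zero, evC_mk, this]
    · obtain ⟨φ, hφ, rfl⟩ := hx
      rw [dC_mk, mkC_eq_zero] at hδ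
      obtain ⟨ψ, -, h⟩ := acyclic hm n d (by omega) φ hδ (homog_le_supp _ hφ)
      refine ⟨mkC (homogProj d ψ), ⟨_, homogProj_mem d ψ, rfl⟩, ?_⟩
      have := homogProj_mem_LZ (d + 1) h
      rw [map_sub, homogProj_of_mem hφ, homogProj_cobd] at this
      exact (mkC_eq.2 this).symm

lemma comb_eq_mk (p : Fin n → Λ) :
    comb (m := m) p = mkC (∑ j, p j • coord Λ j) := by
  rw [map_sum]
  exact Finset.sum_congr rfl fun j _ => by rw [map_smul]; rfl

lemma exists_cohom_comb (hm : 1 ≤ m) {x : Cx (Fin n → Sph m) Λ}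
    (hx : x ∈ filt (Fin n → Sph m) Λ (m + 2)) (hδ : dC x = 0) : ∃ p, Cohom m x (comb p) := by
  obtain ⟨φ, hφ, rfl⟩ := hx
  rw [dC_mk, mkC_eq_zero] at hδ
  obtain ⟨p, ψ, h⟩ := top_cocycle hm n φ hδ (homog_le_supp _ hφ)
  refine ⟨p, ?_⟩
  rw [comb_eq_mk]
  exact cohom_of_mk hφ (sum_mem fun j _ => Submodule.smul_mem _ _
    (pb_mem_homog _ ubar_mem_homog)) h

lemma comb_injective (hm : 1 ≤ m) {p q : Fin n → Λ} (h : Cohom m (comb (m := m) p) (comb q)) :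
    p = q := by
  obtain ⟨w, -, e⟩ := h
  obtain ⟨ψ, rfl⟩ := mkC_surjective w
  rw [← sub_eq_zero]
  rw [sub_eq_add_neg, ← comb_neg, ← comb_add, ← sub_eq_add_neg, comb_eq_mk, dC_mk] at e
  exact coord_independent hm _ ψ (mkC_eq.1 e.symm)

lemma pbC_comb {X : Type*} [PseudoMetricSpace X] [CompactSpace X] (f : C(X, Fin n → Sph m))
    (p : Fin n → Λ) : pbC f (comb p) = ∑ j, p j • pbC ((prC j).comp f) (ub m Λ) := by
  simp [comb, pbC_pbC]

lemma prC_comp_actC (j : Fin n) (b : Fin n → ZMod 2) :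
    (prC j).comp (actC (m := m) b) = (sgC (b j)).comp (prC j) := rfl

lemma cohom_actC_comb (hm : Odd m) (b : Fin n → ZMod 2) (p : Fin n → Λ) :
    Cohom m (pbC (actC b) (comb (m := m) p)) (comb p) := by
  rw [pbC_comb]
  refine Cohom.sum _ fun j => Cohom.smul _ ?_
  rw [prC_comp_actC, ← pbC_pbC]
  exact (cohom_sg_ub hm _).pbC _

lemma cast_ubar (s : ℕ) (l : List (Sph m)) :
    ((ubar m ℤ s l : ℤ) : ZMod 2) = ubar m (ZMod 2) s l := by
  have hc : ∀ (k : Fin (m + 1)) x, ((cut ℤ k x : ℤ) : ZMod 2) = cut (ZMod 2) k x := fun k x => by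
    simp only [cut]; split_ifs <;> simp
  induction s generalizing l with
  | zero =>
    rcases l with _ | ⟨x, l⟩
    · simp [ubar_nil]
    · simp only [ubar, mulv_cons, one]
      push_cast
      rw [hc]
  | succ s ih =>
    rcases l with _ | ⟨x, _ | ⟨y, l⟩⟩
    · simp [ubar_nil]
    · simp [ubar_succ_singleton]
    · show (((cut ℤ _ y - cut ℤ _ x) * ubar m ℤ s ((y :: l).map (retr _)) : ℤ) : ZMod 2) =
        (cut (ZMod 2) _ y - cut (ZMod 2) _ x) * ubar m (ZMod 2) s ((y :: l).map (retr _))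
      rw [Int.cast_mul, Int.cast_sub, hc, hc, ih]

lemma red_ub : red (ub m ℤ) = ub m (ZMod 2) := by
  rw [ub, red_mk, ub]
  exact congrArg mkC (funext (cast_ubar m))

lemma red_comb (p : Fin n → ℤ) :
    red (comb (m := m) p) = comb fun j => ((p j : ℤ) : ZMod 2) := by
  rw [comb, map_sum, comb]
  refine Finset.sum_congr rfl fun j _ => ?_
  refine (congrArg red (int_smul_eq_zsmul _ (p j) _)).trans ?_
  rw [map_zsmul, red_pbC, red_ub, Int.cast_smul_eq_zsmul]

end Classes

section Shift
variable {C : Type*} [AddCommGroup C]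

/-- Shift of a sequence by one place, with initial term `0`. -/
def pre (f : ℕ → C) : ℕ → C
  | 0 => 0
  | k + 1 => f k

open Finset.HasAntidiagonal in
lemma sum_pre_left (F : ℕ → ℕ → C) (l : ℕ) :
    ∑ x ∈ antidiagonal l, pre (fun a => F a x.2) x.1 =
      pre (fun l => ∑ x ∈ antidiagonal l, F x.1 x.2) l := by
  cases l with
  | zero => simp [pre]
  | succ l => rw [Finset.Nat.sum_antidiagonal_succ]; simp [pre]

open Finset.HasAntidiagonal in
lemma sum_pre_right (F : ℕ → ℕ → C) (l : ℕ) :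
    ∑ x ∈ antidiagonal l, pre (F x.1) x.2 =
      pre (fun l => ∑ x ∈ antidiagonal l, F x.1 x.2) l := by
  cases l with
  | zero => simp [pre]
  | succ l => rw [Finset.Nat.sum_antidiagonal_succ']; simp [pre]

end Shift

section Cyclic
variable {R C : Type*} [CommRing R] [AddCommGroup C] [Module R C]

open Finset.HasAntidiagonal in
/-- Even terms of the row of `g * β` built from a family for `g` and `β`. -/
def cycEven (g : R) (U : ℕ → ℕ → C) (l : ℕ) : C :=
  ∑ x ∈ antidiagonal l, ((1 + g * g) * g) ^ x.2 • U (2 * x.1) (2 * x.2) -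
    pre (fun l => ∑ x ∈ antidiagonal l,
      ((1 + g * g) * ((1 + g * g) * g) ^ x.2) • U (2 * x.1 + 1) (2 * x.2 + 1)) l

open Finset.HasAntidiagonal in
/-- Odd terms of the row of `g * β` built from a family for `g` and `β`. -/
def cycOdd (g β : R) (U : ℕ → ℕ → C) (l : ℕ) : C :=
  ∑ x ∈ antidiagonal l, ((1 + g * g) * g) ^ x.2 •
    (β • U (2 * x.1 + 1) (2 * x.2) + U (2 * x.1) (2 * x.2 + 1))

variable {δ : C →+ C} (hδ : ∀ (r : R) x, δ (r • x) = r • δ x) {g β : R} (hβ : β * β = 1)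
  {U : ℕ → ℕ → C}
  (h00 : ∀ a j, a + j ≠ 0 → δ (U (2 * a) (2 * j)) =
    ((1 + g * g) * (1 + g)) • pre (fun a => U (2 * a + 1) (2 * j)) a +
    (1 + β) • pre (fun j => U (2 * a) (2 * j + 1)) j)
  (h10 : ∀ a j, δ (U (2 * a + 1) (2 * j)) = (g - 1) • U (2 * a) (2 * j) -
    (1 + β) • pre (fun j => U (2 * a + 1) (2 * j + 1)) j)
  (h01 : ∀ a j, δ (U (2 * a) (2 * j + 1)) =
    ((1 + g * g) * (1 + g)) • pre (fun a => U (2 * a + 1) (2 * j + 1)) a +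
    (β - 1) • U (2 * a) (2 * j))
  (h11 : ∀ a j, δ (U (2 * a + 1) (2 * j + 1)) =
    (g - 1) • U (2 * a) (2 * j + 1) - (β - 1) • U (2 * a + 1) (2 * j))

lemma smul_pre (c : ℕ → R) (f : ℕ → C) (k : ℕ) :
    c k • pre f k = pre (fun k => c (k + 1) • f k) k := by
  cases k <;> simp [pre]

lemma smul_pre_const (c : R) (f : ℕ → C) (k : ℕ) : c • pre f k = pre (fun k => c • f k) k := by
  cases k <;> simp [pre]

include hδ hβ h10 h01 in
lemma delta_cycOdd (l : ℕ) : δ (cycOdd g β U l) = (g * β - 1) • cycEven g U l := by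
  have e : δ (cycOdd g β U l) = ∑ x ∈ Finset.HasAntidiagonal.antidiagonal l,
      ((g * β - 1) • ((1 + g * g) * g) ^ x.2 • U (2 * x.1) (2 * x.2) +
        pre (fun a => (((1 + g * g) * g) ^ x.2 * ((1 + g * g) * (1 + g))) •
          U (2 * a + 1) (2 * x.2 + 1)) x.1 -
        pre (fun j => (((1 + g * g) * g) ^ (j + 1) * (1 + β)) •
          U (2 * x.1 + 1) (2 * j + 1)) x.2) := by
    rw [cycOdd, map_sum]
    refine Finset.sum_congr rfl fun x _ => ?_
    rw [hδ, map_add, hδ, h10, h01, ← smul_pre (fun k => ((1 + g * g) * g) ^ k * (1 + β)),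
      ← smul_pre_const]
    match_scalars
    · ring
    · linear_combination (-(((1 + g * g) * g) ^ x.2)) * hβ
    · ring
  rw [e, Finset.sum_sub_distrib, Finset.sum_add_distrib, sum_pre_left (fun a j =>
      (((1 + g * g) * g) ^ j * ((1 + g * g) * (1 + g))) • U (2 * a + 1) (2 * j + 1)),
    sum_pre_right (fun a j => (((1 + g * g) * g) ^ (j + 1) * (1 + β)) •
          U (2 * a + 1) (2 * j + 1)), cycEven, smul_sub, Finset.smul_sum]
  cases l with
  | zero => simp [pre]
  | succ l =>
    simp only [pre]
    rw [add_sub_assoc, sub_eq_add_neg _ ((g * β - 1) • _), Finset.smul_sum,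
      ← Finset.sum_sub_distrib, ← Finset.sum_neg_distrib]
    congr 1
    refine Finset.sum_congr rfl fun x _ => ?_
    match_scalars
    ring

include hδ hβ h00 h11 in
lemma delta_cycEven (l : ℕ) :
    δ (cycEven g U (l + 1)) = ((1 + g * g) * (1 + g * β)) • cycOdd g β U l := by
  have e : δ (∑ x ∈ Finset.HasAntidiagonal.antidiagonal (l + 1),
      ((1 + g * g) * g) ^ x.2 • U (2 * x.1) (2 * x.2)) = ∑ x ∈ Finset.HasAntidiagonal.antidiagonal (l + 1),
      (pre (fun a => (((1 + g * g) * g) ^ x.2 * ((1 + g * g) * (1 + g))) •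
          U (2 * a + 1) (2 * x.2)) x.1 +
        pre (fun j => (((1 + g * g) * g) ^ (j + 1) * (1 + β)) •
          U (2 * x.1) (2 * j + 1)) x.2) := by
    rw [map_sum]
    refine Finset.sum_congr rfl fun x hx => ?_
    rw [hδ, h00 _ _ (by rw [Finset.HasAntidiagonal.mem_antidiagonal.1 hx]; omega),
      ← smul_pre (fun k => ((1 + g * g) * g) ^ k * (1 + β)), ← smul_pre_const]
    module
  rw [cycEven, map_sub, e, Finset.sum_add_distrib, sum_pre_left (fun a j =>
      (((1 + g * g) * g) ^ j * ((1 + g * g) * (1 + g))) • U (2 * a + 1) (2 * j)),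
    sum_pre_right (fun a j => (((1 + g * g) * g) ^ (j + 1) * (1 + β)) • U (2 * a) (2 * j + 1))]
  simp only [pre]
  rw [map_sum, ← Finset.sum_add_distrib, ← Finset.sum_sub_distrib, cycOdd, Finset.smul_sum]
  refine Finset.sum_congr rfl fun x _ => ?_
  rw [hδ, h11]
  match_scalars
  · linear_combination (-((1 + g * g) * ((1 + g * g) * g) ^ x.2 * g)) * hβ
  · ring

end Cyclic

section Periodic
variable {Λ C : Type*} [CommRing Λ] [AddCommGroup C] [Module Λ C]
  {m : ℕ} {δ : C →ₗ[Λ] C} {E : ℕ → Submodule Λ C}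

/-- Operators of the periodic resolution of the group of order two. -/
def per2 (b : Module.End Λ C) : ℕ → Module.End Λ C := alt (b - 1) (1 + b)

/-- Operators of the periodic resolution of the cyclic group of order four. -/
def per4 (g : Module.End Λ C) : ℕ → Module.End Λ C := alt (g - 1) ((1 + g * g) * (1 + g))

lemma per2_compat {b : Module.End Λ C} (hb : Compat δ E b) (k : ℕ) : Compat δ E (per2 b k) :=
  alt_compat (hb.sub .one) (Compat.one.add hb) k

lemma per4_compat {g : Module.End Λ C} (hg : Compat δ E g) (k : ℕ) : Compat δ E (per4 g k) :=
  alt_compat (hg.sub .one) ((Compat.one.add (hg.mul hg)).mul (Compat.one.add hg)) k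

lemma per2_per2 {b : Module.End Λ C} (hb : b * b = 1) (k : ℕ) (x : C) :
    per2 b (k + 1) (per2 b k x) = 0 := by
  refine alt_alt (fun x => ?_) (fun x => ?_) k x
  · rw [← Module.End.mul_apply, show (b - 1) * (1 + b) = b * b - 1 by noncomm_ring, hb, sub_self,
      LinearMap.zero_apply]
  · rw [← Module.End.mul_apply, show (1 + b) * (b - 1) = b * b - 1 by noncomm_ring, hb, sub_self,
      LinearMap.zero_apply]

lemma per4_per4 {g : Module.End Λ C} (hg : g * g * (g * g) = 1) (k : ℕ) (x : C) :
    per4 g (k + 1) (per4 g k x) = 0 := by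
  refine alt_alt (fun x => ?_) (fun x => ?_) k x
  · rw [← Module.End.mul_apply,
      show (g - 1) * ((1 + g * g) * (1 + g)) = g * g * (g * g) - 1 by noncomm_ring, hg, sub_self,
      LinearMap.zero_apply]
  · rw [← Module.End.mul_apply,
      show (1 + g * g) * (1 + g) * (g - 1) = g * g * (g * g) - 1 by noncomm_ring, hg, sub_self,
      LinearMap.zero_apply]

lemma alt_comm {a b c d : Module.End Λ C} (hac : Commute a c) (had : Commute a d)
    (hbc : Commute b c) (hbd : Commute b d) (j k : ℕ) (x : C) :
    alt a b j (alt c d k x) = alt c d k (alt a b j x) := by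
  rw [← Module.End.mul_apply, ← Module.End.mul_apply]
  unfold alt
  split_ifs
  exacts [congrArg (· x) hac.eq, congrArg (· x) had.eq, congrArg (· x) hbc.eq,
    congrArg (· x) hbd.eq]

lemma per2_comm_per2 {a b : Module.End Λ C} (h : Commute a b) (j k : ℕ) (x : C) :
    per2 a j (per2 b k x) = per2 b k (per2 a j x) := by
  have h1 := Commute.one_left b
  have h2 := Commute.one_right a
  have h3 := Commute.one_right (1 : Module.End Λ C)
  refine alt_comm ?_ ?_ ?_ ?_ j k x
  · exact (h.sub_left h1).sub_right (h2.sub_left h3)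
  · exact (h2.sub_left h3).add_right (h.sub_left h1)
  · exact (h1.add_left h).sub_right (h3.add_left h2)
  · exact (h3.add_left h2).add_right (h1.add_left h)

lemma per4_comm_per2 {g b : Module.End Λ C} (h : Commute g b) (j k : ℕ) (x : C) :
    per4 g j (per2 b k x) = per2 b k (per4 g j x) := by
  have h1 : Commute (g - 1) b := h.sub_left (Commute.one_left b)
  have h2 : Commute ((1 + g * g) * (1 + g)) b :=
    ((Commute.one_left b).add_left (h.mul_left h)).mul_left ((Commute.one_left b).add_left h)
  have h3 := Commute.one_right (g - 1)
  have h4 := Commute.one_right ((1 + g * g) * (1 + g))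
  exact alt_comm (h1.sub_right h3) (h3.add_right h1) (h2.sub_right h4) (h4.add_right h2) j k x

variable {A B : ℕ → Module.End Λ C} {U : ℕ → ℕ → C}

lemma IsFam.row (hU : IsFam m δ E A B U) : IsRow m δ E A fun k => U k 0 where
  mem k := hU.mem k 0
  rel k := by
    rw [hU.rel _ _ (by omega)]
    simp [shft]

/-- A family for `g` yields one for `g * g`. -/
lemma IsFam.square {g b : Module.End Λ C} (hg : Compat δ E g) (hgb : Commute g b)
    (hU : IsFam m δ E (per4 g) (per2 b) U) :
    IsFam m δ E (per2 (g * g)) (per2 b) fun p q => alt 1 (1 + g) p (U p q) where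
  mem p q := (alt_compat Compat.one (Compat.one.add hg) p).mem _ _ (hU.mem p q)
  rel p q hpq := by
    rw [(alt_compat Compat.one (Compat.one.add hg) p).comm, hU.rel p q hpq, map_add, map_zsmul]
    congr 1
    · cases p with
      | zero => simp [shft]
      | succ p =>
        rw [shft_succ, shft_succ, Nat.add_sub_cancel, per4, per2]
        simp only [← Module.End.mul_apply]
        rcases Nat.even_or_odd' p with ⟨l, rfl | rfl⟩
        · simp only [alt_even, alt_odd]
          congr 1
          noncomm_ring
        · simp only [show 2 * l + 1 + 1 = 2 * (l + 1) by ring, alt_even, alt_odd]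
          rfl
    · congr 1
      cases q with
      | zero => simp [shft]
      | succ q =>
        rw [shft_succ, per2]
        have h1 : Commute (1 + g) b := (Commute.one_left b).add_left hgb
        exact alt_comm ((Commute.one_left b).sub_right (Commute.one_right 1))
          ((Commute.one_right _).add_right (Commute.one_left b))
          (h1.sub_right (Commute.one_right _)) ((Commute.one_right _).add_right h1) _ _ _

section
variable {R : Type*} [CommRing R] [Module R C]

lemma exists_cyc_row_smul (hδ : ∀ (r : R) x, δ (r • x) = r • δ x)
    (hE : ∀ (r : R) d, ∀ x ∈ E d, r • x ∈ E d) {ev : C →ₗ[Λ] Λ} {g b : R}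
    (hbb : b * b = 1) (evg : ∀ x, ev (g • x) = ev x)
    {G H : Module.End Λ C} (hG : ∀ x, G x = g • x) (hH : ∀ x, H x = b • x)
    (hU : IsFam m δ E (per4 G) (per2 H) U) {l : ℕ} (hl : m = 2 * l + 3) :
    ∃ V, V 0 = U 0 0 ∧ IsRow m δ E (per4 (G * H)) V ∧
      ∃ c, ev (V (m + 1)) =
        ev (U (m + 1) 0) + 2 * ev (U (m - 1) 2) - 2 * ev (U m 1) + 4 * c := by
  have hN : ∀ x, ((1 + G * G) * (1 + G)) x = ((1 + g * g) * (1 + g)) • x := fun x => by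
    simp only [Module.End.mul_apply, LinearMap.add_apply, Module.End.one_apply, hG]
    module
  have hG1 : ∀ x, (G - 1) x = (g - 1) • x := fun x => by
    simp only [LinearMap.sub_apply, Module.End.one_apply, hG]; module
  have hH1 : ∀ x, (H - 1) x = (b - 1) • x := fun x => by
    simp only [LinearMap.sub_apply, Module.End.one_apply, hH]; module
  have hH2 : ∀ x, (1 + H) x = (1 + b) • x := fun x => by
    simp only [LinearMap.add_apply, Module.End.one_apply, hH]; module
  have hA : ∀ a q, shft (per4 G) (2 * a) (U (2 * a - 1) q) =
      ((1 + g * g) * (1 + g)) • pre (fun a => U (2 * a + 1) q) a := by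
    intro a q
    cases a with
    | zero => simp [shft, pre]
    | succ a =>
      rw [show 2 * (a + 1) = 2 * a + 1 + 1 by ring, shft_succ, per4, alt_odd, hN]
      rfl
  have hB : ∀ p j, shft (per2 H) (2 * j) (U p (2 * j - 1)) =
      (1 + b) • pre (fun j => U p (2 * j + 1)) j := by
    intro p j
    cases j with
    | zero => simp [shft, pre]
    | succ j =>
      rw [show 2 * (j + 1) = 2 * j + 1 + 1 by ring, shft_succ, per2, alt_odd, hH2]
      rfl
  have hodd : ∀ (a : ℕ) (x : C), (-1 : ℤ) ^ (2 * a + 1) • x = -x := fun a x => by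
    rw [pow_succ, pow_mul]; simp
  have heven : ∀ (a : ℕ) (x : C), (-1 : ℤ) ^ (2 * a) • x = x := fun a x => by
    rw [pow_mul]; simp
  have h00 : ∀ a j, a + j ≠ 0 → δ (U (2 * a) (2 * j)) =
    ((1 + g * g) * (1 + g)) • pre (fun a => U (2 * a + 1) (2 * j)) a +
    (1 + b) • pre (fun j => U (2 * a) (2 * j + 1)) j := fun a j h => by
    rw [hU.rel _ _ (by omega), heven, hA, hB]
  have h10 : ∀ a j, δ (U (2 * a + 1) (2 * j)) = (g - 1) • U (2 * a) (2 * j) -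
    (1 + b) • pre (fun j => U (2 * a + 1) (2 * j + 1)) j := fun a j => by
    rw [hU.rel _ _ (by omega), hodd, shft_succ, per4, alt_even, hB, hG1,
      Nat.add_sub_cancel]
    exact (sub_eq_add_neg _ _).symm
  have h01 : ∀ a j, δ (U (2 * a) (2 * j + 1)) =
    ((1 + g * g) * (1 + g)) • pre (fun a => U (2 * a + 1) (2 * j + 1)) a +
    (b - 1) • U (2 * a) (2 * j) := fun a j => by
    rw [hU.rel _ _ (by omega), heven, hA, shft_succ, per2, alt_even, hH1, Nat.add_sub_cancel]
  have h11 : ∀ a j, δ (U (2 * a + 1) (2 * j + 1)) =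
    (g - 1) • U (2 * a) (2 * j + 1) - (b - 1) • U (2 * a + 1) (2 * j) := fun a j => by
    rw [hU.rel _ _ (by omega), hodd, shft_succ, shft_succ, per4, per2, alt_even, alt_even, hG1,
      hH1, Nat.add_sub_cancel, Nat.add_sub_cancel]
    exact (sub_eq_add_neg _ _).symm
  have evp : ∀ (j : ℕ) x, ev (((1 + g * g) * g) ^ j • x) = 2 ^ j * ev x := by
    intro j
    induction j with
    | zero => simp
    | succ j ih =>
      intro x
      rw [pow_succ, mul_smul, ih, mul_smul, add_smul, map_add, one_smul, mul_smul]
      simp only [evg]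
      ring
  have evs : ∀ x, ev ((1 + g * g) • x) = 2 * ev x := fun x => by
    rw [add_smul, map_add, one_smul, mul_smul, evg, evg]; ring
  refine ⟨fun k => if Even k then cycEven g U (k / 2) else cycOdd g b U (k / 2), ?_,
    ⟨fun k => ?_, fun k => ?_⟩, ?_⟩
  · simp [cycEven, pre]
  · rcases Nat.even_or_odd' k with ⟨i, rfl | rfl⟩
    · rw [if_pos (even_two_mul i), Nat.mul_div_cancel_left _ two_pos, cycEven]
      refine sub_mem (sum_mem fun x hx => hE _ _ _ ?_) ?_
      · have := hU.mem (2 * x.1) (2 * x.2)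
        rwa [← mul_add, Finset.HasAntidiagonal.mem_antidiagonal.1 hx] at this
      · cases i with
        | zero => exact zero_mem _
        | succ i =>
          refine sum_mem fun x hx => hE _ _ _ ?_
          have := hU.mem (2 * x.1 + 1) (2 * x.2 + 1)
          rw [← Finset.HasAntidiagonal.mem_antidiagonal.1 hx]
          convert this using 2
          ring
    · rw [if_neg (by simp), show (2 * i + 1) / 2 = i by omega, cycOdd]
      refine sum_mem fun x hx => hE _ _ _ (add_mem (hE _ _ _ ?_) ?_)
      · have := hU.mem (2 * x.1 + 1) (2 * x.2)
        rw [← Finset.HasAntidiagonal.mem_antidiagonal.1 hx]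
        convert this using 2
        ring
      · have := hU.mem (2 * x.1) (2 * x.2 + 1)
        rw [← Finset.HasAntidiagonal.mem_antidiagonal.1 hx]
        convert this using 2
        ring
  · rcases Nat.even_or_odd' k with ⟨i, rfl | rfl⟩
    · rw [if_neg (by simp), if_pos (even_two_mul i), Nat.mul_div_cancel_left _ two_pos,
        show (2 * i + 1) / 2 = i by omega, per4, alt_even]
      refine (delta_cycOdd (δ := δ.toAddMonoidHom) hδ hbb h10 h01 i).trans ?_
      simp only [LinearMap.sub_apply, Module.End.mul_apply, Module.End.one_apply, hG, hH]
      module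
    · rw [show 2 * i + 1 + 1 = 2 * (i + 1) by ring, if_pos (even_two_mul _), if_neg (by simp),
        Nat.mul_div_cancel_left _ two_pos, show (2 * i + 1) / 2 = i by omega, per4, alt_odd]
      refine (delta_cycEven (δ := δ.toAddMonoidHom) hδ hbb h00 h11 i).trans ?_
      simp only [LinearMap.add_apply, Module.End.mul_apply, Module.End.one_apply, hG, hH]
      match_scalars
      linear_combination (-(g * g + g * g * (g * b))) * hbb
  · refine ⟨∑ x ∈ Finset.HasAntidiagonal.antidiagonal l, (2 ^ x.2 * ev (U (2 * x.1) (2 * x.2 + 4))) -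
      ∑ x ∈ Finset.HasAntidiagonal.antidiagonal l, (2 ^ x.2 * ev (U (2 * x.1 + 1) (2 * x.2 + 3))), ?_⟩
    subst hl
    have hev : Even (2 * l + 3 + 1) := ⟨l + 2, by ring⟩
    show ev (if Even (2 * l + 3 + 1) then _ else _) = _
    rw [if_pos hev, show (2 * l + 3 + 1) / 2 = l + 1 + 1 by omega, cycEven]
    simp only [pre, map_sub, map_sum, mul_smul _ (_ ^ _), evp, evs]
    rw [Finset.Nat.sum_antidiagonal_succ', Finset.Nat.sum_antidiagonal_succ',
      Finset.Nat.sum_antidiagonal_succ', mul_sub, Finset.mul_sum, Finset.mul_sum]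
    have e1 : ∀ x : ℕ × ℕ, 2 ^ (x.2 + 1 + 1) * ev (U (2 * x.1) (2 * (x.2 + 1 + 1))) =
      4 * (2 ^ x.2 * ev (U (2 * x.1) (2 * x.2 + 4))) := fun x => by
      rw [show 2 * (x.2 + 1 + 1) = 2 * x.2 + 4 by ring]; ring
    have e2 : ∀ x : ℕ × ℕ, 2 * (2 ^ (x.2 + 1) * ev (U (2 * x.1 + 1) (2 * (x.2 + 1) + 1))) =
      4 * (2 ^ x.2 * ev (U (2 * x.1 + 1) (2 * x.2 + 3))) := fun x => by
      rw [show 2 * (x.2 + 1) + 1 = 2 * x.2 + 3 by ring]; ring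
    simp only [e1, e2]
    rw [show 2 * (l + 1 + 1) = 2 * l + 3 + 1 by ring, show 2 * (l + 1) = 2 * l + 3 - 1 by omega,
      show 2 * l + 3 - 1 + 1 = 2 * l + 3 by omega]
    simp
    ring

end

/-- The operators compatible with the resolution. -/
def compatAlg (δ : C →ₗ[Λ] C) (E : ℕ → Submodule Λ C) : Subalgebra Λ (Module.End Λ C) where
  carrier := {T | Compat δ E T}
  mul_mem' h h' := h.mul h'
  add_mem' h h' := h.add h'
  algebraMap_mem' r := ⟨fun x => by simp [Module.algebraMap_end_apply],
    fun d x h => by rw [Module.algebraMap_end_apply]; exact Submodule.smul_mem _ _ h⟩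

lemma exists_cyc_row {ev : C →ₗ[Λ] Λ} {g b : Module.End Λ C} (hg : Compat δ E g)
    (hb : Compat δ E b) (hgb : Commute g b)
    (hbb : b * b = 1) (evg : ∀ x, ev (g x) = ev x)
    (hU : IsFam m δ E (per4 g) (per2 b) U) {l : ℕ} (hl : m = 2 * l + 3) :
    ∃ V, V 0 = U 0 0 ∧ IsRow m δ E (per4 (g * b)) V ∧
      ∃ c, ev (V (m + 1)) =
        ev (U (m + 1) 0) + 2 * ev (U (m - 1) 2) - 2 * ev (U m 1) + 4 * c := by
  have hs : ({g, b} : Set (Module.End Λ C)) ⊆ compatAlg δ E := by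
    rintro x (rfl | rfl)
    exacts [hg, hb]
  have hle := Algebra.adjoin_le hs
  have hcomm : IsMulCommutative (Algebra.adjoin Λ ({g, b} : Set (Module.End Λ C))) :=
    Algebra.isMulCommutative_adjoin Λ (by
      rintro x (rfl | rfl) y (rfl | rfl)
      exacts [rfl, hgb.eq, hgb.eq.symm, rfl])
  let : CommRing (Algebra.adjoin Λ ({g, b} : Set (Module.End Λ C))) :=
    { (inferInstance : Ring (Algebra.adjoin Λ ({g, b} : Set (Module.End Λ C)))) with
      mul_comm := hcomm.is_comm.comm }
  let : Module (Algebra.adjoin Λ ({g, b} : Set (Module.End Λ C))) C :=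
    Module.compHom C (Algebra.adjoin Λ ({g, b} : Set (Module.End Λ C))).val.toRingHom
  exact exists_cyc_row_smul (R := Algebra.adjoin Λ ({g, b} : Set (Module.End Λ C)))
    (g := ⟨g, Algebra.subset_adjoin (by simp)⟩) (b := ⟨b, Algebra.subset_adjoin (by simp)⟩)
    (fun r x => (hle r.2).comm x) (fun r d x h => (hle r.2).mem d x h)
    (Subtype.ext hbb) evg (fun _ => rfl) (fun _ => rfl) hU hl

end Periodic

section Kappa
variable {m : ℕ}

lemma exists_chooser : ∃ χ : Sph m → ZMod 2, ∀ x, χ (-x) = χ x + 1 := by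
  classical
  refine ⟨fun x => if WellOrderingRel x (-x) then 0 else 1, fun x => ?_⟩
  rcases trichotomous_of WellOrderingRel x (-x) with h | h | h
  · have h' := asymm_of WellOrderingRel h
    simp [h, h']
  · exact absurd h.symm (neg_ne_self_sph x)
  · have h' := asymm_of WellOrderingRel h
    simp only [neg_neg, h, h', if_true, if_false]
    decide

lemma add_self_of_two {C : Type*} [AddCommGroup C] [Module (ZMod 2) C] (x : C) : x + x = 0 := by
  rw [← two_smul (ZMod 2), show (2 : ZMod 2) = 0 by decide, zero_smul]

lemma sub_eq_add_of_two {C : Type*} [AddCommGroup C] [Module (ZMod 2) C] (x y : C) :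
    x - y = x + y := by
  rw [sub_eq_add_neg, neg_eq_of_add_eq_zero_left (add_self_of_two y)]

/-- Periodic row of the antipode starting at the fundamental class. -/
lemma exists_sphere_row (hm : Odd m) : ∃ V : ℕ → Cx (Sph m) (ZMod 2), V 0 = ub m (ZMod 2) ∧
    IsRow m dC (filt (Sph m) (ZMod 2)) (per2 (pbC (negS m))) V := by
  have hm1 : 1 ≤ m := hm.pos
  let ι : C(Sph m, Fin 1 → Sph m) := ⟨fun x _ => x, continuous_pi fun _ => continuous_id⟩
  let a : Module.End (ZMod 2) (Cx (Fin 1 → Sph m) (ZMod 2)) := pbC (actC 1)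
  have haa : a * a = 1 := by
    ext x
    rw [Module.End.mul_apply, pbC_pbC, show (actC 1).comp (actC 1) = ContinuousMap.id _ from
      ContinuousMap.ext fun x => by
        show act 1 (act 1 x) = x
        rw [act_act, show (1 + 1 : Fin 1 → ZMod 2) = 0 by decide, act_zero],
      pbC_id, Module.End.one_apply]
  obtain ⟨w, hw, e⟩ := cohom_actC_comb (n := 1) hm 1 (1 : Fin 1 → ZMod 2)
  obtain ⟨V, h0, hV⟩ := exists_row (isRes hm1 1) (per2_compat (b := a) (pbC_compat _))
    (per2_per2 haa) (comb_mem (1 : Fin 1 → ZMod 2)) ⟨w, hw, by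
      rw [e]; rfl⟩
  have hT : ∀ k x, pbC ι (per2 a k x) = per2 (pbC (negS m)) k (pbC ι x) := by
    have hι : ∀ x, pbC ι (a x) = pbC (negS m) (pbC ι x) := fun x => by
      rw [pbC_pbC, pbC_pbC]
      congr 1
    intro k x
    rcases Nat.even_or_odd' k with ⟨l, rfl | rfl⟩
    · simp [per2, alt_even, hι]
    · simp [per2, alt_odd, hι]
  refine ⟨fun k => pbC ι (V k), ?_, fun k => pbC_mem _ _ _ (hV.mem k), fun k => ?_⟩
  · show pbC ι (V 0) = _
    rw [h0, pbC_comb]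
    simp only [Finset.univ_unique, Finset.sum_singleton, Pi.one_apply, one_smul]
    exact pbC_id _
  · rw [dC_pbC, hV.rel, hT]

lemma not_ub_mem_range (c : Cx (Sph m) (ZMod 2)) : ub m (ZMod 2) ≠ dC c := by
  intro h
  obtain ⟨ψ, rfl⟩ := mkC_surjective c
  rw [ub, dC_mk, mkC_eq] at h
  refine one_ne_zero (eq_zero_of_smul_ubar_mem (Λ := ZMod 2) m (Fin.last m) rfl 1 ψ ?_)
  rwa [one_smul, sub_last]

lemma not_invariant_ub (hm : 1 ≤ m) {v : List (Sph m) → ZMod 2}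
    (hv : v ∈ inv (Λ := ZMod 2) {fun x => -x}) (y : Cx (Sph m) (ZMod 2)) :
    ub m (ZMod 2) ≠ mkC v + dC y := by
  intro h
  have hδ : cobd v ∈ LZ (Λ := ZMod 2) univ := by
    rw [← mkC_eq_zero, ← dC_mk, eq_sub_of_add_eq h.symm, map_sub, dC_ub, dC_dC, sub_zero]
  obtain ⟨θ, -, -, ψ, -, -, hψ⟩ := antipode_invariant_cocycle (Z := Unit) (F := ∅) m (Fin.last m)
    rfl (pb Prod.fst v) (by
      rw [cobd_pb]
      have hu : UniformContinuousOn (Prod.fst : Sph m × Unit → Sph m)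
          (Prod.fst ⁻¹' sub (Fin.last m)) :=
        (ucOn_of_continuous continuous_fst).mono (subset_univ _)
      exact pb_mem_LZ (Λ := ZMod 2) hu (fun _ _ => mem_univ _) hδ)
    (mem_inv.2 fun f hf => absurd hf (by rw [onSnd, image_empty]; exact notMem_empty f))
    (by
      rw [pb_pb]
      conv_rhs => rw [← hv _ rfl, pb_pb]
      rfl)
  have h1 := pb_mem_LZ (Λ := ZMod 2) (Y := univ) (f := fun x : Sph m => (x, ()))
    (ucOn_of_continuous (by fun_prop)) (fun _ _ => by rw [sub_last]; trivial) hψ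
  let K : C(Sph m, Sph m) := ContinuousMap.const _ (pole 0)
  set t : Cx (Sph m) (ZMod 2) := mkC (pb (fun _ => ()) θ) with ht
  have h2 : mkC v = t + dC (mkC (pb (fun x : Sph m => (x, ())) ψ)) := by
    rw [← sub_eq_iff_eq_add', ht, ← map_sub, dC_mk, mkC_eq]
    rw [map_sub, map_sub, pb_pb, pb_pb, ← cobd_pb,
      show pb (Prod.fst ∘ fun x : Sph m => (x, ())) v = v from pb_id _] at h1
    exact h1
  have h3 : pbC K t = t := by
    rw [ht, pbC_mk, pb_pb]
  have h4 : pbC K (ub m (ZMod 2)) = 0 := by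
    rw [ub, pbC_mk, show pb K (ubar m (ZMod 2) m) = 0 from pb_const_ubar hm _, map_zero]
  have h5 := congrArg (pbC K) h
  rw [h4, h2, map_add, map_add, h3, ← dC_pbC, ← dC_pbC] at h5
  rw [h2] at h
  set c := mkC (pb (fun x : Sph m => (x, ())) ψ)
  refine not_ub_mem_range (c + y - (pbC K c + pbC K y)) (h.trans ?_)
  rw [map_sub, map_add, map_add, ← sub_zero (t + dC c + dC y), h5]
  abel

/-- The periodic row of the antipode detects the fundamental class. -/
lemma evC_sphere_row (hm : Odd m) {V : ℕ → Cx (Sph m) (ZMod 2)} (h0 : V 0 = ub m (ZMod 2))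
    (hV : IsRow m dC (filt (Sph m) (ZMod 2)) (per2 (pbC (negS m))) V) :
    evC (V (m + 1)) = 1 := by
  by_contra hne
  have two_eq : (2 : ZMod 2) = 0 := by decide
  have htop : V (m + 1) = 0 := by
    have := hV.mem (m + 1)
    rw [show m + 2 - (m + 1) = 1 by omega] at this
    refine eq_of_mem_filt_one this (zero_mem _) ?_
    rw [map_zero]
    exact (zmod_two_cases _).resolve_right hne
  obtain ⟨χ, hχ⟩ := exists_chooser (m := m)
  have key : ∀ i ≤ m + 1, ∃ v ∈ inv (Λ := ZMod 2) {fun x : Sph m => -x}, v [] = 0 ∧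
      ∃ y, V (m + 1 - i) = mkC v + dC y := by
    intro i
    induction i with
    | zero => exact fun _ => ⟨0, zero_mem _, rfl, 0, by simp [htop]⟩
    | succ i ih =>
      intro hi
      obtain ⟨v, hv, hv0, y, hy⟩ := ih (by omega)
      obtain ⟨k, hk⟩ : ∃ k, m + 1 - i = k + 1 := ⟨m - i, by omega⟩
      rw [show m + 1 - (i + 1) = k by omega]
      rw [hk] at hy
      have hrel := hV.rel k
      have hT : per2 (pbC (negS m)) k (V k) = V k + pbC (negS m) (V k) := by
        rcases Nat.even_or_odd' k with ⟨l, rfl | rfl⟩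
        · rw [per2, alt_even, LinearMap.sub_apply, Module.End.one_apply, sub_eq_add_of_two]
          exact add_comm _ _
        · rw [per2, alt_odd]; rfl
      rw [hT, hy, map_add, dC_dC, add_zero, dC_mk] at hrel
      have hz : mulv χ v + pb (fun x => -x) (mulv χ v) = v := by
        rw [mulv_pb, hv _ rfl]
        funext l
        cases l with
        | nil => simpa [mulv] using hv0.symm
        | cons x l =>
          simp only [Pi.add_apply, mulv_cons, Function.comp_apply, hχ]
          linear_combination χ x * v (x :: l) * two_eq
      obtain ⟨φ, hφ⟩ := mkC_surjective (V k + dC (mkC (mulv χ v)))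
      have hφ0 : φ [] = 0 := by
        have := hV.mem k
        rw [show m + 2 - k = m - k + 2 by omega] at this
        rw [← evC_mk φ, hφ, map_add, evC_dC, evC_of_mem this, add_zero]
      have hφa : mkC (pb (fun x => -x) φ) = mkC φ := by
        rw [← sub_eq_zero, sub_eq_add_of_two]
        have h1 : pbC (negS m) (mkC φ) = mkC (pb (fun x => -x) φ) := rfl
        have h2 : pbC (negS m) (mkC (mulv χ v)) = mkC (pb (fun x => -x) (mulv χ v)) := rfl
        rw [← h1, hφ, map_add, ← dC_pbC, h2, add_add_add_comm, ← map_add,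
          add_comm (pbC _ _), ← hrel, ← map_add, add_comm (pb _ _), hz, dC_mk, add_self_of_two]
      have haa : ∀ ψ : List (Sph m) → ZMod 2, pb (fun x => -x) (pb (fun x => -x) ψ) = ψ := by
        intro ψ
        rw [pb_pb]
        funext l
        simp
      refine ⟨mulv χ φ + pb (fun x => -x) (mulv χ φ), ?_, ?_, mkC (mulv χ v), ?_⟩
      · rintro f rfl
        rw [map_add, haa, add_comm]
      · simp [mulv]
      · have h1 : mkC (pb (fun x => -x) (mulv χ φ)) = mkC (mulv (χ ∘ fun x => -x) φ) := by
          rw [mulv_pb, mkC_eq, ← map_sub]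
          exact mulv_mem_LZ _ (mkC_eq.1 hφa)
        have h2 : mulv χ φ + mulv (χ ∘ fun x => -x) φ = φ := by
          funext l
          cases l with
          | nil => simpa [mulv] using hφ0.symm
          | cons x l =>
            simp only [Pi.add_apply, mulv_cons, Function.comp_apply, hχ]
            linear_combination χ x * φ (x :: l) * two_eq
        rw [map_add, h1, ← map_add, h2, hφ, add_assoc, add_self_of_two, add_zero]
  obtain ⟨v, hv, -, y, hy⟩ := key (m + 1) le_rfl
  rw [Nat.sub_self, h0] at hy
  exact not_invariant_ub hm.pos hv y hy

end Kappa

section Families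
variable {Λ Λ' C C' : Type*} [CommRing Λ] [CommRing Λ'] [AddCommGroup C] [Module Λ C]
  [AddCommGroup C'] [Module Λ' C'] {m : ℕ} {δ : C →ₗ[Λ] C} {E : ℕ → Submodule Λ C}
  {δ' : C' →ₗ[Λ'] C'} {E' : ℕ → Submodule Λ' C'} {A B : ℕ → Module.End Λ C}
  {A' B' : ℕ → Module.End Λ' C'} {U : ℕ → ℕ → C}

lemma map_shft {f : C →+ C'} (h : ∀ k x, f (A k x) = A' k (f x)) (k : ℕ) (x : C) :
    f (shft A k x) = shft A' k (f x) := by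
  cases k with
  | zero => simp [shft]
  | succ k => exact h k x

lemma IsFam.map (f : C →+ C') (hδ : ∀ x, f (δ x) = δ' (f x)) (hE : ∀ d, ∀ x ∈ E d, f x ∈ E' d)
    (hA : ∀ k x, f (A k x) = A' k (f x)) (hB : ∀ k x, f (B k x) = B' k (f x))
    (hU : IsFam m δ E A B U) : IsFam m δ' E' A' B' fun p q => f (U p q) where
  mem p q := hE _ _ (hU.mem p q)
  rel p q h := by rw [← hδ, hU.rel p q h, map_add, map_zsmul, map_shft hA, map_shft hB]

lemma map_per2 {f : C →+ C'} {a : Module.End Λ C} {a' : Module.End Λ' C'}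
    (h : ∀ x, f (a x) = a' (f x)) (k : ℕ) (x : C) : f (per2 a k x) = per2 a' k (f x) := by
  rcases Nat.even_or_odd' k with ⟨l, rfl | rfl⟩
  · simp [per2, alt_even, h]
  · simp [per2, alt_odd, h]

lemma map_per4 {f : C →+ C'} {a : Module.End Λ C} {a' : Module.End Λ' C'}
    (h : ∀ x, f (a x) = a' (f x)) (k : ℕ) (x : C) : f (per4 a k x) = per4 a' k (f x) := by
  rcases Nat.even_or_odd' k with ⟨l, rfl | rfl⟩
  · simp [per4, alt_even, h]
  · simp [per4, alt_odd, h]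

lemma IsFam.sum {ι : Type*} (s : Finset ι) (c : ι → Λ) {U : ι → ℕ → ℕ → C}
    (hU : ∀ i, IsFam m δ E A B (U i)) : IsFam m δ E A B fun p q => ∑ i ∈ s, c i • U i p q where
  mem p q := sum_mem fun i _ => Submodule.smul_mem _ _ ((hU i).mem p q)
  rel p q h := by
    simp only [map_sum, map_smul, Finset.smul_sum]
    rw [← Finset.sum_add_distrib]
    refine Finset.sum_congr rfl fun i _ => ?_
    rw [(hU i).rel p q h, smul_add, smul_comm (c i)]

end Families

section CharTwo
variable {C D : Type*} [AddCommGroup C] [Module (ZMod 2) C] [AddCommGroup D] [Module (ZMod 2) D]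
  {m : ℕ} {δ : C →ₗ[ZMod 2] C} {E : ℕ → Submodule (ZMod 2) C}
  {δ' : D →ₗ[ZMod 2] D} {E' : ℕ → Submodule (ZMod 2) D}

lemma per2_apply (a : Module.End (ZMod 2) C) (k : ℕ) (x : C) : per2 a k x = x + a x := by
  rcases Nat.even_or_odd' k with ⟨l, rfl | rfl⟩
  · rw [per2, alt_even, LinearMap.sub_apply, Module.End.one_apply, sub_eq_add_of_two]
    exact add_comm _ _
  · rw [per2, alt_odd]; rfl

lemma neg_one_zsmul_of_two (p : ℕ) (x : C) : (-1 : ℤ) ^ p • x = x := by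
  rcases Nat.even_or_odd p with h | h
  · rw [h.neg_one_pow, one_smul]
  · rw [h.neg_one_pow, neg_smul, one_smul, neg_eq_of_add_eq_zero_left (add_self_of_two x)]

/-- The family pulled back from a row along an equivariant map. -/
lemma IsRow.fam {t : Module.End (ZMod 2) D} {V : ℕ → D} (hV : IsRow m δ' E' (per2 t) V)
    (f : D →ₗ[ZMod 2] C) (hδ : ∀ x, f (δ' x) = δ (f x)) (hE : ∀ d, ∀ x ∈ E' d, f x ∈ E d)
    {a b : Module.End (ZMod 2) C} {β γ : ZMod 2} (ha : ∀ x, f x + a (f x) = β • f (x + t x))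
    (hb : ∀ x, f x + b (f x) = γ • f (x + t x)) :
    IsFam m δ E (per2 a) (per2 b)
      fun p q => (((p + q).choose p : ZMod 2) * β ^ p * γ ^ q) • f (V (p + q)) where
  mem p q := Submodule.smul_mem _ _ (hE _ _ (hV.mem _))
  rel p q h := by
    obtain ⟨k, hk⟩ := Nat.exists_eq_succ_of_ne_zero h
    have h1 : ∀ x, shft (per2 a) (p + 1) (f x) = β • f (x + t x) := fun x => by
      rw [shft_succ, per2_apply, ha]
    rw [neg_one_zsmul_of_two, map_smul, ← hδ, hk, Nat.succ_eq_add_one, hV.rel, per2_apply]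
    rcases p with _ | p <;> rcases q with _ | q
    · exact absurd rfl h
    · obtain rfl : k = q := by omega
      simp only [shft_zero, LinearMap.zero_apply, shft_succ, map_smul, per2_apply, hb, smul_smul,
        Nat.zero_add, Nat.add_sub_cancel]
      simp [pow_succ]
    · obtain rfl : k = p := by omega
      simp only [shft_zero, LinearMap.zero_apply, shft_succ, map_smul, per2_apply, ha, smul_smul,
        Nat.add_zero, Nat.add_sub_cancel]
      simp [pow_succ]
    · obtain rfl : k = p + q + 1 := by omega
      simp only [shft_succ, map_smul, per2_apply, ha, hb, smul_smul, Nat.add_sub_cancel]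
      rw [show p + (q + 1) = p + q + 1 by ring, show p + 1 + q = p + q + 1 by ring,
        ← add_smul, Nat.choose_succ_succ']
      congr 1
      push_cast
      ring

end CharTwo

section Evaluation
variable {m n : ℕ} {Λ : Type*} [CommRing Λ]

/-- The operator induced by the sign action. -/
def actE (m : ℕ) (Λ : Type*) [CommRing Λ] (b : Fin n → ZMod 2) :
    Module.End Λ (Cx (Fin n → Sph m) Λ) := pbC (actC b)

lemma actE_mul (b c : Fin n → ZMod 2) : actE m Λ b * actE m Λ c = actE m Λ (b + c) := by
  ext x
  rw [Module.End.mul_apply, actE, actE, pbC_pbC]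
  congr 2
  ext1 y
  show act c (act b y) = act (b + c) y
  rw [act_act, add_comm]

lemma actE_zero : actE m Λ (0 : Fin n → ZMod 2) = 1 := by
  ext x
  rw [actE, show actC (m := m) (0 : Fin n → ZMod 2) = ContinuousMap.id _ from
    ContinuousMap.ext fun y => act_zero y, pbC_id, Module.End.one_apply]

lemma actE_self (b : Fin n → ZMod 2) : actE m Λ b * actE m Λ b = 1 := by
  rw [actE_mul, show b + b = 0 from funext fun j => CharTwo.add_self_eq_zero (b j), actE_zero]

lemma actE_commute (b c : Fin n → ZMod 2) : Commute (actE m Λ b) (actE m Λ c) := by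
  show actE m Λ b * actE m Λ c = actE m Λ c * actE m Λ b
  rw [actE_mul, actE_mul]
  exact congrArg (actE m Λ) (add_comm b c)

lemma actE_compat (b : Fin n → ZMod 2) :
    Compat dC (filt (Fin n → Sph m) Λ) (actE m Λ b) := pbC_compat _

lemma evC_actE (b : Fin n → ZMod 2) (x : Cx (Fin n → Sph m) Λ) : evC (actE m Λ b x) = evC x := by
  rw [actE, evC_pbC]

/-- Evaluation of the family pulled back along an equivariant map to the sphere. -/
lemma exists_pulled_fam (hm : Odd m) (f : C(Fin n → Sph m, Sph m)) {b c : Fin n → ZMod 2}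
    {β γ : ZMod 2} (hb : ∀ x, f (act b x) = sg β (f x)) (hc : ∀ x, f (act c x) = sg γ (f x)) :
    ∃ U, U 0 0 = pbC f (ub m (ZMod 2)) ∧ IsFam m dC (filt (Fin n → Sph m) (ZMod 2))
      (per2 (actE m _ b)) (per2 (actE m _ c)) U ∧
      ∀ i j, i + j = m + 1 → evC (U i j) = ((m + 1).choose i : ZMod 2) * β ^ i * γ ^ j := by
  obtain ⟨V, h0, hV⟩ := exists_sphere_row hm
  have key : ∀ {b : Fin n → ZMod 2} {β : ZMod 2}, (∀ x, f (act b x) = sg β (f x)) →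
      ∀ x : Cx (Sph m) (ZMod 2), pbC f x + actE m _ b (pbC f x) = β • pbC f (x + pbC (negS m) x) := by
    intro b β hb x
    rw [actE, pbC_pbC]
    rcases zmod_two_cases β with rfl | rfl
    · rw [show f.comp (actC b) = f from ContinuousMap.ext fun x => (hb x).trans (sg_zero _),
        add_self_of_two, zero_smul]
    · rw [show f.comp (actC b) = (negS m).comp f from
        ContinuousMap.ext fun x => (hb x).trans (sg_one _), one_smul, map_add, pbC_pbC]
  refine ⟨_, ?_, hV.fam (pbC f) (fun x => (dC_pbC f x).symm) (pbC_mem f) (key hb) (key hc), ?_⟩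
  · simp [h0]
  · intro i j hij
    rw [hij, map_smul, evC_pbC, evC_sphere_row hm h0 hV, smul_eq_mul, mul_one]

lemma evC_per2 (b : Fin n → ZMod 2) (k : ℕ) (x : Cx (Fin n → Sph m) (ZMod 2)) :
    evC (shft (per2 (actE m _ b)) k x) = 0 := by
  cases k with
  | zero => simp [shft]
  | succ k => rw [shft_succ, per2_apply, map_add, evC_actE, add_self_of_two]

lemma evC_fam_unique (hm : Odd m) {b c : Fin n → ZMod 2} {U U' : ℕ → ℕ → Cx (Fin n → Sph m) (ZMod 2)}
    (hU : IsFam m dC (filt (Fin n → Sph m) (ZMod 2)) (per2 (actE m _ b)) (per2 (actE m _ c)) U)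
    (hU' : IsFam m dC (filt (Fin n → Sph m) (ZMod 2)) (per2 (actE m _ b)) (per2 (actE m _ c)) U')
    (h0 : Cohom m (U 0 0) (U' 0 0)) {i j : ℕ} (hij : i + j = m + 1) :
    evC (U i j) = evC (U' i j) := by
  obtain ⟨w, -, w', -, e⟩ := fam_unique (per2_compat (actE_compat b)) (per2_compat (actE_compat c))
    (per2_per2 (actE_self b)) (per2_per2 (actE_self c)) (per2_comm_per2 (actE_commute b c))
    (isRes hm.pos n) hU hU' h0 hij
  rw [← sub_eq_zero, ← map_sub, e, map_add, map_zsmul, evC_per2, evC_per2, smul_zero, add_zero]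

/-- Evaluation of a family with prescribed initial class. -/
lemma evC_fam (hm : Odd m) {b c : Fin n → ZMod 2} {U : ℕ → ℕ → Cx (Fin n → Sph m) (ZMod 2)}
    (hU : IsFam m dC (filt (Fin n → Sph m) (ZMod 2)) (per2 (actE m _ b)) (per2 (actE m _ c)) U)
    {p : Fin n → ZMod 2} (h0 : Cohom m (U 0 0) (comb p)) {i j : ℕ} (hij : i + j = m + 1) :
    evC (U i j) = ((m + 1).choose i : ZMod 2) * ∑ r, p r * (b r ^ i * c r ^ j) := by
  choose W hW0 hW hWe using fun r => exists_pulled_fam (b := b) (c := c) hm (prC r)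
    (fun _ => rfl) (fun _ => rfl)
  rw [evC_fam_unique hm hU (IsFam.sum Finset.univ p hW) (by simp only [hW0]; exact h0) hij,
    map_sum, Finset.mul_sum]
  refine Finset.sum_congr rfl fun r _ => ?_
  rw [map_smul, hWe r i j hij, smul_eq_mul]
  ring

lemma evC_fam_of_map (hm : Odd m) (f : C(Fin n → Sph m, Sph m)) {b c : Fin n → ZMod 2}
    {β γ : ZMod 2} (hb : ∀ x, f (act b x) = sg β (f x)) (hc : ∀ x, f (act c x) = sg γ (f x))
    {p : Fin n → ZMod 2} (h : Cohom m (pbC f (ub m (ZMod 2))) (comb p)) {i j : ℕ}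
    (hij : i + j = m + 1) :
    ((m + 1).choose i : ZMod 2) * (β ^ i * γ ^ j) =
      ((m + 1).choose i : ZMod 2) * ∑ r, p r * (b r ^ i * c r ^ j) := by
  obtain ⟨U, h0, hU, hUe⟩ := exists_pulled_fam hm f hb hc
  rw [← evC_fam hm hU (h0 ▸ h) hij, hUe i j hij, mul_assoc]

end Evaluation

section Parity
variable {m n : ℕ}

lemma per4_of_even {Λ C : Type*} [CommRing Λ] [AddCommGroup C] [Module Λ C] (g : Module.End Λ C)
    {k : ℕ} (hk : Even k) : per4 g k = g - 1 := if_pos hk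

lemma per4_of_odd {Λ C : Type*} [CommRing Λ] [AddCommGroup C] [Module Λ C] (g : Module.End Λ C)
    {k : ℕ} (hk : Odd k) : per4 g k = (1 + g * g) * (1 + g) := if_neg (Nat.not_even_iff_odd.2 hk)

lemma zmod_two_pow {k : ℕ} (hk : k ≠ 0) (x : ZMod 2) : x ^ k = x := by
  rcases zmod_two_cases x with rfl | rfl
  · exact zero_pow hk
  · exact one_pow k

lemma cast_choose_eq_one (hm : m % 4 = 1) : (((m + 1).choose (m - 1) : ℕ) : ZMod 2) = 1 := by
  obtain ⟨t, rfl⟩ : ∃ t, m = 4 * t + 1 := ⟨m / 4, by omega⟩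
  rw [Nat.add_sub_cancel, ← Nat.choose_symm_of_eq_add (show 4 * t + 1 + 1 = 2 + 4 * t by ring),
    Nat.choose_two_right, show (4 * t + 1 + 1) * (4 * t + 1 + 1 - 1) =
      2 * (2 * (4 * t ^ 2 + 3 * t) + 1) by rw [Nat.add_sub_cancel]; ring,
    Nat.mul_div_cancel_left _ two_pos]
  push_cast
  rw [show (2 : ZMod 2) = 0 from rfl]
  ring

/-- Endomorphisms of the cochain classes of a product of spheres. -/
abbrev EndC (m n : ℕ) (Λ : Type*) [CommRing Λ] := Module.End Λ (Cx (Fin n → Sph m) Λ)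

lemma red_actE (b : Fin n → ZMod 2) (x : Cx (Fin n → Sph m) ℤ) :
    red (actE m ℤ b x) = actE m (ZMod 2) b (red x) := red_pbC _ _

section
variable {Λ : Type*} [CommRing Λ]

lemma exists_per4_zero {g : EndC m n Λ} {u : Cx (Fin n → Sph m) Λ} (h : Cohom m (g u) u) :
    ∃ a ∈ filt (Fin n → Sph m) Λ (m + 1), dC a = per4 g 0 u := h

lemma exists_per2_zero {g : EndC m n Λ} {u : Cx (Fin n → Sph m) Λ} (h : Cohom m (g u) u) :
    ∃ a ∈ filt (Fin n → Sph m) Λ (m + 1), dC a = per2 g 0 u := h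

end

/-- The mod two evaluation of a family whose first operator squares to a sign action. -/
lemma evC_square_fam (hm : Odd m) {q b : Fin n → ZMod 2}
    {g : EndC m n ℤ} (hg : Compat dC (filt (Fin n → Sph m) ℤ) g)
    (hgg : g * g = actE m ℤ q) (hgb : Commute g (actE m ℤ b)) {U : ℕ → ℕ → Cx (Fin n → Sph m) ℤ}
    (hU : IsFam m dC (filt (Fin n → Sph m) ℤ) (per4 g) (per2 (actE m ℤ b)) U)
    {p : Fin n → ℤ} (h0 : U 0 0 = comb p) {i j : ℕ} (hij : 2 * i + j = m + 1) :
    ((evC (U (2 * i) j) : ℤ) : ZMod 2) = (((m + 1).choose (2 * i) : ℕ) : ZMod 2) *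
      ∑ r, ((p r : ℤ) : ZMod 2) * (q r ^ (2 * i) * b r ^ j) := by
  have hS := hU.square hg hgb
  rw [hgg] at hS
  have hR := hS.map (E' := filt (Fin n → Sph m) (ZMod 2)) (δ' := dC) red red_dC red_mem
    (map_per2 (red_actE q)) (map_per2 (red_actE b))
  have := evC_fam hm hR (p := fun r => ((p r : ℤ) : ZMod 2)) (Cohom.of_eq ?_) hij
  · rw [← this, evC_red, alt_even, Module.End.one_apply]
  · rw [← red_comb, ← h0]
    exact congrArg red (congrArg (fun f : Module.End ℤ _ => f (U 0 0)) (alt_even _ _ 0))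

variable {q B : Fin n → ZMod 2}

lemma pbC_mul_self {Λ : Type*} [CommRing Λ] {g : C(Fin n → Sph m, Fin n → Sph m)}
    (hgg : ∀ x, g (g x) = act q x) :
    (pbC g : EndC m n Λ) * pbC g = actE m Λ q := by
  ext x
  rw [Module.End.mul_apply, pbC_pbC, actE, show g.comp g = actC q from ContinuousMap.ext hgg]

lemma pbC_commute_actE {Λ : Type*} [CommRing Λ] {g : C(Fin n → Sph m, Fin n → Sph m)}
    (hgB : ∀ x, g (act B x) = act B (g x)) :
    Commute (pbC g : EndC m n Λ) (actE m Λ B) := by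
  ext x
  show pbC g (pbC (actC B) x) = pbC (actC B) (pbC g x)
  rw [pbC_pbC, pbC_pbC, show (actC B).comp g = g.comp (actC B) from
    ContinuousMap.ext fun x => (hgB x).symm]

/-- Integral form of the obstruction attached to two lifts commuting up to a sign action. -/
lemma exists_fam_of_commutator {Λ : Type*} [CommRing Λ] {l : ℕ} (hl : m = 2 * l + 3)
    (g h : C(Fin n → Sph m, Fin n → Sph m)) (hgg : ∀ x, g (g x) = act q x)
    (hgB : ∀ x, g (act B x) = act B (g x)) (hhg : ∀ x, h (g x) = act B (g (h x)))
    {p : Fin n → Λ} (hg : Cohom m (pbC g (comb p)) (comb p))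
    (hh : Cohom m (pbC h (comb p)) (comb p)) :
    ∃ U, U 0 0 = comb p ∧ IsFam m dC (filt (Fin n → Sph m) Λ) (per4 (pbC g))
      (per2 (actE m Λ B)) U ∧ ∃ c, 2 * evC (U (m - 1) 2) = 4 * c := by
  have hm : Odd m := ⟨l + 1, by omega⟩
  set G : EndC m n Λ := pbC g with hG
  set β := actE m Λ B with hβ
  have hGc : Compat dC (filt (Fin n → Sph m) Λ) G := pbC_compat g
  have hβc : Compat dC (filt (Fin n → Sph m) Λ) β := actE_compat B
  have hGG : G * G = actE m Λ q := pbC_mul_self hgg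
  have hG4 : G * G * (G * G) = 1 := by rw [hGG, actE_self]
  have hGβ : Commute G β := pbC_commute_actE hgB
  have evG : ∀ x, evC (G x) = evC x := fun x => by rw [hG, evC_pbC]
  have evβ : ∀ x, evC (β x) = evC x := evC_actE B
  have hres : IsRes m dC (filt (Fin n → Sph m) Λ) := isRes hm.pos n
  obtain ⟨U, hU0, hU⟩ := exists_fam (per4_compat hGc) (per2_compat hβc) (per4_per4 hG4)
    (per2_per2 (actE_self B)) (per4_comm_per2 hGβ) hres (comb_mem p)
    (exists_per4_zero hg) (exists_per2_zero (cohom_actC_comb hm B p))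
  refine ⟨U, hU0, hU, ?_⟩
  obtain ⟨V, hV0, hV, c, hc⟩ := exists_cyc_row (ev := evC) hGc hβc hGβ (actE_self B) evG hU hl
  have hHG : ∀ x, pbC h ((G * β) x) = G (pbC h x) := fun x => by
    show pbC h (pbC g (pbC (actC B) x)) = pbC g (pbC h x)
    rw [pbC_pbC, pbC_pbC, pbC_pbC]
    exact congrArg (fun f => pbC f x) (ContinuousMap.ext fun y => (hhg y).symm)
  have hHV : IsRow m dC (filt (Fin n → Sph m) Λ) (per4 G) fun k => pbC h (V k) :=
    ⟨fun k => pbC_mem h _ _ (hV.mem k), fun k => by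
      rw [dC_pbC, hV.rel]
      exact map_per4 (f := (pbC h : Cx (Fin n → Sph m) Λ →ₗ[Λ] _).toAddMonoidHom) hHG k (V k)⟩
  obtain ⟨w, -, hw⟩ := row_unique hres (per4_compat hGc) (per4_per4 hG4) hHV hU.row
    (by simp only [hV0, hU0]; exact hh)
  have hw' := congrArg evC hw
  rw [map_sub, evC_pbC, per4_of_odd G hm] at hw'
  simp only [Module.End.mul_apply, LinearMap.add_apply, Module.End.one_apply, map_add, evG] at hw'
  have hr := hU.rel m 2 (by omega)
  have hshft : shft (per4 G) m = G - 1 := by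
    obtain ⟨k, hk⟩ : ∃ k, k + 1 = m := ⟨2 * l + 2, by omega⟩
    exact (congrArg (shft (per4 G)) hk.symm).trans (per4_of_even G ⟨l + 1, by omega⟩)
  have hbot : U m 2 = 0 := hres.bot _ (by simpa using hU.mem m 2)
  rw [hbot, map_zero, hm.neg_one_pow, neg_smul, one_smul,
    hshft,
    show shft (per2 β) 2 = 1 + β from rfl] at hr
  have hr' := congrArg evC hr
  simp only [map_zero, map_add, map_neg, map_sub, LinearMap.add_apply, LinearMap.sub_apply,
    Module.End.one_apply, evG, evβ, sub_self, zero_add] at hr'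
  refine ⟨evC w - c, ?_⟩
  rw [show 2 - 1 = 1 from rfl] at hr'
  linear_combination hw' - hc + hr'

/-- The parity obstruction attached to two lifts commuting up to a sign action. -/
lemma sum_eq_zero_of_commutator (hm4 : m % 4 = 1) (hm7 : 7 < m)
    (g h : C(Fin n → Sph m, Fin n → Sph m)) (hgg : ∀ x, g (g x) = act q x)
    (hgB : ∀ x, g (act B x) = act B (g x)) (hhg : ∀ x, h (g x) = act B (g (h x)))
    {p : Fin n → ℤ} (hg : Cohom m (pbC g (comb p)) (comb p))
    (hh : Cohom m (pbC h (comb p)) (comb p)) :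
    ∑ j, ((p j : ℤ) : ZMod 2) * (q j * B j) = 0 := by
  obtain ⟨l, hl⟩ : ∃ l, m = 2 * l + 3 := ⟨(m - 3) / 2, by omega⟩
  obtain ⟨U, hU0, hU, c, hc⟩ := exists_fam_of_commutator hl g h hgg hgB hhg hg hh
  have := evC_square_fam ⟨l + 1, by omega⟩ (pbC_compat g) (pbC_mul_self hgg)
    (pbC_commute_actE hgB) hU hU0 (show 2 * (l + 1) + 2 = m + 1 by omega)
  have hl1 : 2 * (l + 1) = m - 1 := by omega
  rw [hl1, cast_choose_eq_one hm4, one_mul, show evC (U (m - 1) 2) = 2 * c by omega] at this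
  simp only [zmod_two_pow (show m - 1 ≠ 0 by omega), zmod_two_pow two_ne_zero] at this
  rw [← this]
  push_cast
  rw [show (2 : ZMod 2) = 0 from rfl, zero_mul]

lemma evC_fam_top {Λ : Type*} [CommRing Λ] (hm : Odd m)
    (g : C(Fin n → Sph m, Fin n → Sph m)) (hgg : ∀ x, g (g x) = act q x)
    {p : Fin n → Λ} (hg : Cohom m (pbC g (comb p)) (-comb p)) :
    ∃ U, U 0 0 = comb p ∧ IsFam m dC (filt (Fin n → Sph m) Λ) (per4 (-pbC g))
      (per2 (actE m Λ 0)) U ∧ 2 * evC (U (m + 1) 0) = 0 := by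
  set G : EndC m n Λ := -pbC g with hG
  have hGc : Compat dC (filt (Fin n → Sph m) Λ) G := (pbC_compat g).neg
  have hGG : G * G = actE m Λ q := by rw [hG, neg_mul_neg, pbC_mul_self hgg]
  have hG4 : G * G * (G * G) = 1 := by rw [hGG, actE_self]
  have hres : IsRes m dC (filt (Fin n → Sph m) Λ) := isRes hm.pos n
  have hGu : Cohom m (G (comb p)) (comb p) := by
    obtain ⟨w, hw, e⟩ := hg
    refine ⟨-w, neg_mem hw, ?_⟩
    rw [map_neg, e, hG, LinearMap.neg_apply]
    abel
  obtain ⟨U, hU0, hU⟩ := exists_fam (per4_compat hGc) (per2_compat (actE_compat 0))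
    (per4_per4 hG4) (per2_per2 (actE_self 0))
    (per4_comm_per2 (by rw [actE_zero]; exact Commute.one_right G)) hres (comb_mem p)
    (exists_per4_zero hGu) (exists_per2_zero (cohom_actC_comb hm 0 p))
  refine ⟨U, hU0, hU, ?_⟩
  have ht := congrArg evC (hU.row.top hres)
  obtain ⟨k, hk⟩ := hm
  rw [per4_of_even G ⟨k + 1, by omega⟩, LinearMap.sub_apply, map_sub,
    hG, LinearMap.neg_apply, map_neg, evC_pbC, map_zero, Module.End.one_apply] at ht
  linear_combination -ht

/-- The parity obstruction attached to a lift acting by `-1` on a class. -/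
lemma sum_eq_zero_of_neg (hm : Odd m) (g : C(Fin n → Sph m, Fin n → Sph m))
    (hgg : ∀ x, g (g x) = act q x) {p : Fin n → ℤ}
    (hg : Cohom m (pbC g (comb p)) (-comb p)) : ∑ j, ((p j : ℤ) : ZMod 2) * q j = 0 := by
  obtain ⟨U, hU0, hU, h2⟩ := evC_fam_top hm g hgg hg
  obtain ⟨k, hk⟩ := hm
  have := evC_square_fam ⟨k, hk⟩ (pbC_compat g).neg
    (by rw [neg_mul_neg]; exact pbC_mul_self hgg)
    (by rw [actE_zero]; exact Commute.one_right _) hU hU0 (show 2 * (k + 1) + 0 = m + 1 by omega)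
  rw [show 2 * (k + 1) = m + 1 by omega, show evC (U (m + 1) 0) = 0 by omega, Nat.choose_self] at this
  simpa [zmod_two_pow (show m + 1 ≠ 0 by omega)] using this.symm

end Parity

section Lifts
variable {m n : ℕ}

/-- The Veronese embedding of the sphere modulo sign. -/
def veronese (u : Sph m) : EuclideanSpace ℝ (Fin (m + 1) × Fin (m + 1)) :=
  WithLp.toLp 2 fun k => u.1 k.1 * u.1 k.2

lemma continuous_veronese : Continuous (veronese (m := m)) := by
  unfold veronese
  fun_prop

lemma veronese_neg (u : Sph m) : veronese (-u) = veronese u := by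
  simp [veronese]

lemma dist_sph_sq (u v : Sph m) : dist u v ^ 2 = 2 - 2 * ∑ k, u.1 k * v.1 k := by
  rw [Subtype.dist_eq, EuclideanSpace.dist_sq_eq]
  have : ∀ k, dist (u.1 k) (v.1 k) ^ 2 = u.1 k ^ 2 + v.1 k ^ 2 - 2 * (u.1 k * v.1 k) := fun k => by
    rw [Real.dist_eq, sq_abs]; ring
  simp only [this, Finset.sum_sub_distrib, Finset.sum_add_distrib, norm_sq_eq, ← Finset.mul_sum]
  ring

lemma dist_veronese_sq (u v : Sph m) :
    dist (veronese u) (veronese v) ^ 2 = 2 - 2 * (∑ k, u.1 k * v.1 k) ^ 2 := by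
  rw [EuclideanSpace.dist_sq_eq]
  have : ∀ k : Fin (m + 1) × Fin (m + 1), dist (veronese u k) (veronese v k) ^ 2 =
      u.1 k.1 ^ 2 * u.1 k.2 ^ 2 + v.1 k.1 ^ 2 * v.1 k.2 ^ 2 -
        2 * ((u.1 k.1 * v.1 k.1) * (u.1 k.2 * v.1 k.2)) := fun k => by
    rw [Real.dist_eq, sq_abs]; simp only [veronese]; ring
  simp only [this, Finset.sum_sub_distrib, Finset.sum_add_distrib, ← Finset.mul_sum,
    Fintype.sum_prod_type, norm_sq_eq, ← Finset.sum_mul]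
  ring

lemma dist_sg_le (u v : Sph m) : ∃ a, dist u (sg a v) ≤ dist (veronese u) (veronese v) := by
  have h0 := dist_sph_sq u v
  have h1 := dist_sph_sq u (-v)
  have h2 := dist_veronese_sq u v
  set t := ∑ k, u.1 k * v.1 k with ht
  have hn : ∑ k, u.1 k * (-v).1 k = -t := by simp [ht]
  rw [hn] at h1
  have b0 := sq_nonneg (dist u v)
  have b1 := sq_nonneg (dist u (-v))
  rcases le_total 0 t with h | h
  · exact ⟨0, le_of_sq_le_sq (by rw [sg_zero, h0, h2]; nlinarith) dist_nonneg⟩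
  · exact ⟨1, le_of_sq_le_sq (by rw [sg_one, h1, h2]; nlinarith) dist_nonneg⟩

lemma dist_sg_sg (a : ZMod 2) (u v : Sph m) : dist (sg a u) (sg a v) = dist u v := by
  rcases zmod_two_cases a with rfl | rfl
  · rfl
  · rw [sg_one, sg_one, Subtype.dist_eq, Subtype.dist_eq]
    exact dist_neg_neg _ _

lemma eq_of_dist_sg_lt {u v : Sph m} {a b : ZMod 2} (ha : dist u (sg a v) < 1)
    (hb : dist u (sg b v) < 1) : a = b := by
  have key : ∀ w : Sph m, dist u w < 1 → dist u (-w) < 1 → False := fun w h h' => by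
    have h0 := dist_sph_sq u w
    have h1 := dist_sph_sq u (-w)
    have hn : ∑ k, u.1 k * (-w).1 k = -∑ k, u.1 k * w.1 k := by simp
    rw [hn] at h1
    nlinarith [dist_nonneg (x := u) (y := w), dist_nonneg (x := u) (y := -w)]
  rcases zmod_two_cases a with rfl | rfl <;> rcases zmod_two_cases b with rfl | rfl
  exacts [rfl, (key v ha hb).elim, (key v hb ha).elim, rfl]

lemma antipodal_iff (u v : Sph m) : antipodal m u v ↔ v = u ∨ v = -u := by
  rw [antipodal, Subtype.ext_iff, Subtype.ext_iff]; rfl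

lemma mk_sg (a : ZMod 2) (u : Sph m) : (Quot.mk _ (sg a u) : RP m) = Quot.mk _ u := by
  rcases zmod_two_cases a with rfl | rfl
  · rfl
  · exact (Quot.sound ((antipodal_iff _ _).2 (Or.inr rfl))).symm

/-- The Veronese embedding of projective space. -/
def veroneseRP : RP m → EuclideanSpace ℝ (Fin (m + 1) × Fin (m + 1)) :=
  Quot.lift veronese fun u v h => by
    rcases (antipodal_iff u v).1 h with rfl | rfl
    exacts [rfl, (veronese_neg u).symm]

lemma continuous_veroneseRP : Continuous (veroneseRP (m := m)) :=
  continuous_quot_lift _ continuous_veronese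

lemma exists_sg_of_mk_eq {u v : Sph m} (h : (Quot.mk _ u : RP m) = Quot.mk _ v) :
    ∃ a, u = sg a v := by
  obtain ⟨a, ha⟩ := dist_sg_le u v
  have : veronese u = veronese v := congrArg veroneseRP h
  rw [this, dist_self] at ha
  exact ⟨a, dist_le_zero.1 ha⟩

variable {X : Type*}

/-- The mod two one-cochain measuring sign changes. -/
def signCochain (c : X → X → ZMod 2) : List X → ZMod 2
  | [x, y] => c x y
  | _ => 0

lemma signCochain_mem_supp (c : X → X → ZMod 2) : signCochain c ∈ supp (Λ := ZMod 2) 2 := by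
  rintro (_ | ⟨x, _ | ⟨y, _ | ⟨z, l⟩⟩⟩) h
  · rfl
  · rfl
  · simp at h
  · rfl

lemma cobd_signCochain_mem [PseudoMetricSpace X] {c : X → X → ZMod 2} {ε : ℝ} (hε : 0 < ε)
    (h : ∀ x y z, dist x y < ε → dist y z < ε → dist x z < ε → c x z = c x y + c y z) :
    cobd (signCochain c) ∈ LZ (Λ := ZMod 2) univ := by
  refine ⟨ε, hε, ?_⟩
  rintro (_ | ⟨x, _ | ⟨y, _ | ⟨z, _ | ⟨w, l⟩⟩⟩⟩) hl
  · rfl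
  · simp [cobd_cons, signCochain]
  · simp [cobd, cobdAux, signCochain]
  · have := h x y z (hl.2 x (by simp) y (by simp)) (hl.2 y (by simp) z (by simp))
      (hl.2 x (by simp) z (by simp))
    simp only [cobd, cobdAux, signCochain, LinearMap.coe_mk, AddHom.coe_mk, this]
    ring
  · exact cobd_mem_supp (signCochain_mem_supp c) _ (by simp)

/-- Continuous maps from a product of spheres to projective space lift to the sphere. -/
theorem exists_lift (hm : 1 < m) {φ : (Fin n → Sph m) → RP m} (hφ : Continuous φ) :
    ∃ f : C(Fin n → Sph m, Sph m), ∀ x, Quot.mk _ (f x) = φ x := by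
  classical
  let s : (Fin n → Sph m) → Sph m := fun x => (φ x).out
  have hs : ∀ x, (Quot.mk _ (s x) : RP m) = φ x := fun x => Quot.out_eq _
  have huc : UniformContinuous fun x => veronese (s x) := by
    have : (fun x => veronese (s x)) = veroneseRP ∘ φ := funext fun x => congrArg veroneseRP (hs x)
    rw [this]
    exact CompactSpace.uniformContinuous_of_continuous (continuous_veroneseRP.comp hφ)
  rw [Metric.uniformContinuous_iff] at huc
  choose c hc using fun x y => dist_sg_le (s x) (s y)
  obtain ⟨ε, hε, h⟩ := huc (1 / 2) (by norm_num)
  obtain ⟨ψ, -, ε', hε', h'⟩ := acyclic (Λ := ZMod 2) hm.le n 1 hm (signCochain c)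
    (cobd_signCochain_mem hε fun x y z hxy hyz hxz => by
      have h1 := (hc x y).trans_lt (h hxy)
      have h2 := (hc y z).trans_lt (h hyz)
      have h3 := (hc x z).trans_lt (h hxz)
      rw [← dist_sg_sg (c x y), sg_sg] at h2
      exact eq_of_dist_sg_lt (by linarith) ((dist_triangle _ _ _).trans_lt
        ((add_lt_add h1 h2).trans_le (by norm_num))))
    (signCochain_mem_supp c)
  refine ⟨⟨fun x => sg (ψ [x]) (s x), Metric.continuous_iff.2 fun x η hη => ?_⟩,
    fun x => (mk_sg _ _).trans (hs x)⟩
  obtain ⟨δ, hδ, hd⟩ := huc η hη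
  refine ⟨min δ ε', lt_min hδ hε', fun y hy => ?_⟩
  have hxy := h' [y, x] ⟨fun _ _ => mem_univ _, by
    have := hy.trans_le (min_le_right _ _)
    simp [this, dist_comm x y, hε']⟩
  have e : ψ [y] + ψ [x] = c y x := by
    have : c y x - (ψ [x] - ψ [y]) = 0 := by
      simpa [cobd, cobdAux, signCochain] using hxy
    rw [CharTwo.sub_eq_add, CharTwo.sub_eq_add] at this
    rw [add_comm, CharTwo.add_eq_zero.1 this]
  rw [← dist_sg_sg (ψ [y]), sg_sg, sg_sg, CharTwo.add_self_eq_zero, e, sg_zero]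
  exact (hc y x).trans_lt (hd (hy.trans_le (min_le_left _ _)))

lemma preconnectedSpace_sph (hm : 1 ≤ m) : PreconnectedSpace (Sph m) :=
  Subtype.preconnectedSpace (isPreconnected_sphere (by
    rw [← Module.finrank_eq_rank, finrank_euclideanSpace, Fintype.card_fin]
    exact_mod_cast (by omega : 1 < m + 1)) _ _)

lemma lift_unique (hm : 1 ≤ m) (f f' : C(Fin n → Sph m, Sph m))
    (h : ∀ x, (Quot.mk _ (f x) : RP m) = Quot.mk _ (f' x)) : ∃ a, ∀ x, f x = sg a (f' x) := by
  have := preconnectedSpace_sph hm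
  have hc : {x | f x = f' x}ᶜ = {x | f x = -f' x} := by
    ext x
    obtain ⟨a, ha⟩ := exists_sg_of_mk_eq (h x)
    rcases zmod_two_cases a with rfl | rfl
    · simp only [mem_compl_iff, Set.mem_ofPred_eq, show f x = f' x from ha, not_true, false_iff]
      exact (neg_ne_self_sph _).symm
    · simp only [mem_compl_iff, Set.mem_ofPred_eq, show f x = -f' x from ha]
      exact iff_of_true (neg_ne_self_sph _) trivial
  have hcl : IsClopen {x | f x = f' x} :=
    ⟨isClosed_eq f.continuous f'.continuous, by
      rw [← isClosed_compl_iff, hc]; exact isClosed_eq f.continuous f'.continuous.neg⟩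
  rcases isClopen_iff.1 hcl with e | e
  · refine ⟨1, fun x => ?_⟩
    have : x ∈ {x | f x = -f' x} := by rw [← hc, e]; simp
    exact this
  · refine ⟨0, fun x => ?_⟩
    have : x ∈ {x | f x = f' x} := by rw [e]; simp
    exact this

/-- The projection from a product of spheres to a product of projective spaces. -/
def projRP (x : Fin n → Sph m) : Fin n → RP m := fun j => Quot.mk _ (x j)

lemma continuous_projRP : Continuous (projRP (m := m) (n := n)) :=
  continuous_pi fun j => continuous_quot_mk.comp (continuous_apply j)

lemma projRP_act (b : Fin n → ZMod 2) (x : Fin n → Sph m) : projRP (act b x) = projRP x :=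
  funext fun _ => mk_sg _ _

theorem exists_lift_pi (hm : 1 < m) {φ : (Fin n → RP m) → (Fin n → RP m)} (hφ : Continuous φ) :
    ∃ f : C(Fin n → Sph m, Fin n → Sph m), ∀ x, projRP (f x) = φ (projRP x) := by
  choose f hf using fun j => exists_lift hm
    (((continuous_apply j).comp hφ).comp (continuous_projRP (m := m)))
  exact ⟨ContinuousMap.pi f, fun x => funext fun j => hf j x⟩

lemma lift_pi_unique (hm : 1 ≤ m) (f f' : C(Fin n → Sph m, Fin n → Sph m))
    (h : ∀ x, projRP (f x) = projRP (f' x)) : ∃ b, ∀ x, f x = act b (f' x) := by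
  choose b hb using fun j => lift_unique hm ((prC j).comp f) ((prC j).comp f')
    fun x => congrFun (h x) j
  exact ⟨b, fun x => funext fun j => hb j x⟩

end Lifts

section Linearize
variable {G R M : Type*} [AddCommGroup G] [CommRing R] [AddCommGroup M] [Module R M]

/-- On an idempotent splitting the characters `d`, a quadratic function becomes additive after
restriction to the kernel of the character. -/
lemma exists_addMonoidHom_of_idempotent (h2 : (2 : R) = 0) (hG : ∀ g : G, g + g = 0)
    (d : G →+ R) (q : G → M) (B : G → G → M) (hq : ∀ g h, q (g + h) = q g + q h + B g h)
    (hB : ∀ g h, ((1 + d g) * (1 + d h)) • B g h = 0) {e : R} {t : Set G}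
    (he : ∀ g ∈ t, d g * e = e) (he' : ∀ g ∉ t, d g * e = 0) :
    ∃ f : G →+ M, (∀ g, ∃ g', f g = e • q g') ∧ ∀ g ∉ t, f g = e • q g := by
  classical
  by_cases h0 : e = 0
  · exact ⟨0, fun g => ⟨g, by simp [h0]⟩, fun g _ => by simp [h0]⟩
  have hee : e + e = 0 := by rw [← two_mul, h2, zero_mul]
  have hadd : ∀ g h, g + h ∈ t ↔ ¬(g ∈ t ↔ h ∈ t) := fun g h => by
    have := add_mul (d g) (d h) e
    have v : ∀ x, d x * e = if x ∈ t then e else 0 := fun x => by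
      split_ifs with hx
      exacts [he x hx, he' x hx]
    rw [← map_add, v, v, v] at this
    by_cases hg : g ∈ t <;> by_cases hh : h ∈ t <;> by_cases hgh : g + h ∈ t <;>
      simp [hg, hh, hgh, h0, hee, eq_comm (a := (0 : R))] at this ⊢
  obtain ⟨k, hk⟩ : ∃ k, ∀ g ∈ t, k ∈ t := by
    rcases t.eq_empty_or_nonempty with rfl | ⟨k, hk⟩
    exacts [⟨0, by simp⟩, ⟨k, fun _ _ => hk⟩]
  let c : G → G := fun g => if g ∈ t then g + k else g
  have hc : ∀ g, c g ∉ t := fun g => by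
    by_cases hg : g ∈ t
    · simp [c, hg, hadd, hk g hg]
    · simp [c, hg]
  have hcadd : ∀ g h, c (g + h) = c g + c h := fun g h => by
    by_cases hg : g ∈ t <;> by_cases hh : h ∈ t
    · simp only [c, hadd, hg, hh, if_true, not_true, if_false]
      rw [add_add_add_comm, hG, add_zero]
    · simp only [c, hadd, hg, hh, iff_false, not_true, not_false_iff, if_true, if_false]; abel
    · simp only [c, hadd, hg, hh, false_iff, not_true, not_false_iff, if_true, if_false]; abel
    · simp only [c, hadd, hg, hh, not_true, if_false]
  have hBe : ∀ g h, g ∉ t → h ∉ t → e • B g h = 0 := fun g h hg hh => by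
    have h1 : e * ((1 + d g) * (1 + d h)) = e := by
      linear_combination (1 + d h) * he' g hg + he' h hh
    rw [← h1, mul_smul, hB, smul_zero]
  refine ⟨AddMonoidHom.mk' (fun g => e • q (c g)) fun g h => ?_, fun g => ⟨c g, rfl⟩,
    fun g hg => ?_⟩
  · rw [hcadd, hq, smul_add, smul_add, hBe _ _ (hc g) (hc h), add_zero]
  · simp [c, hg]

/-- An anisotropic quadratic function on an elementary abelian group, additive up to terms killed
by complementary idempotents, yields an injective homomorphism. -/
theorem exists_injective_addMonoidHom [Finite G] (h2 : (2 : R) = 0) (hG : ∀ g : G, g + g = 0)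
    (d : G →+ R) (hd : ∀ g, d g * d g = d g) (q : G → M) (B : G → G → M)
    (hq : ∀ g h, q (g + h) = q g + q h + B g h)
    (hB : ∀ g h, ((1 + d g) * (1 + d h)) • B g h = 0) (hdq : ∀ g, d g • q g = 0)
    (hq0 : ∀ g, q g = 0 → g = 0) :
    ∃ f : G →+ M, Function.Injective f ∧ ∀ g, f g ∈ Submodule.span R (range q) := by
  classical
  have := Fintype.ofFinite G
  let e : Finset G → R := fun t => (∏ g ∈ t, d g) * ∏ g ∈ Finset.univ \ t, (1 + d g)
  have hsum : ∑ t, e t = 1 := by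
    rw [← Finset.powerset_univ, ← Finset.prod_add]
    refine Finset.prod_eq_one fun g _ => ?_
    linear_combination d g * h2
  have he : ∀ t, ∀ g ∈ t, d g * e t = e t := fun t g hg => by
    simp only [e, ← Finset.mul_prod_erase t d hg]
    linear_combination ((∏ x ∈ t.erase g, d x) * ∏ g ∈ Finset.univ \ t, (1 + d g)) * hd g
  have he' : ∀ t, ∀ g ∉ t, d g * e t = 0 := fun t g hg => by
    have hg' : g ∈ Finset.univ \ t := by simpa using hg
    simp only [e, ← Finset.mul_prod_erase _ (fun g => 1 + d g) hg']
    linear_combination ((∏ x ∈ t, d x) * ∏ g ∈ (Finset.univ \ t).erase g, (1 + d g)) *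
      (hd g + d g * h2)
  have horth : ∀ s t, s ≠ t → e s * e t = 0 := fun s t hst => by
    obtain ⟨g, hg⟩ : ∃ g, ¬(g ∈ s ↔ g ∈ t) := by
      by_contra! h
      exact hst (Finset.ext h)
    by_cases hs : g ∈ s
    · have ht : g ∉ t := fun ht => hg ⟨fun _ => ht, fun _ => hs⟩
      rw [← he s g hs]
      linear_combination e s * he' t g ht
    · have ht : g ∈ t := by tauto
      rw [← he t g ht]
      linear_combination e t * he' s g hs
  have hidem : ∀ t, e t * e t = e t := fun t => by
    have := Finset.sum_eq_single (f := fun s => e t * e s) t (fun s _ h => horth t s h.symm)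
      (fun h => (h (Finset.mem_univ t)).elim)
    rw [← this, ← Finset.mul_sum, hsum, mul_one]
  choose f hf hf' using fun t : Finset G =>
    exists_addMonoidHom_of_idempotent h2 hG d q B hq hB (e := e t) (t := ↑t)
      (fun g hg => he t g hg) (fun g hg => he' t g hg)
  refine ⟨∑ t, f t, (injective_iff_map_eq_zero _).2 fun g hg => hq0 g ?_, fun g => ?_⟩
  · rw [AddMonoidHom.finsetSum_apply] at hg
    have hft : ∀ t, f t g = 0 := fun t => by
      have h : e t • ∑ s, f s g = e t • (0 : M) := congrArg (e t • ·) hg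
      rw [Finset.smul_sum, smul_zero] at h
      rw [Finset.sum_eq_single t (fun s _ hs => ?_) fun h => (h (Finset.mem_univ t)).elim] at h
      · obtain ⟨g', hg'⟩ := hf t g
        rwa [hg', smul_smul, hidem, ← hg'] at h
      · obtain ⟨g', hg'⟩ := hf s g
        rw [hg', smul_smul, horth t s hs.symm, zero_smul]
    rw [← one_smul R (q g), ← hsum, Finset.sum_smul]
    refine Finset.sum_eq_zero fun t _ => ?_
    by_cases ht : g ∈ t
    · rw [← he t g ht, mul_comm, mul_smul, hdq, smul_zero]
    · rw [← hf' t g ht, hft]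
  · rw [AddMonoidHom.finsetSum_apply]
    refine sum_mem fun t _ => ?_
    obtain ⟨g', hg'⟩ := hf t g
    rw [hg']
    exact Submodule.smul_mem _ _ (Submodule.subset_span (mem_range_self _))

end Linearize

section Count
variable {n r : ℕ} {E : Type*} [AddCommGroup E]

/-- An elementary abelian group acting on `n` points, together with an injection of its kernel
into the invariant sign vectors, has order at most `2 ^ n`. -/
theorem le_of_injective_invariants (π : (Fin r → ZMod 2) → Fin n → Fin n)
    (h0 : ∀ i, π 0 i = i) (hadd : ∀ e f i, π (e + f) i = π e (π f i))
    (F : {e // ∀ i, π e i = i} → Fin n → ZMod 2) (hF : Function.Injective F)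
    (hinv : ∀ g e i, F g (π e i) = F g i) : r ≤ n := by
  classical
  let S : Setoid (Fin n) := ⟨fun i j => ∃ e, π e i = j, ⟨fun i => ⟨0, h0 i⟩,
    fun {i j} ⟨e, h⟩ => ⟨e, by rw [← h, ← hadd, ZModModule.add_self, h0]⟩,
    fun {i j k} ⟨e, h⟩ ⟨f, h'⟩ => ⟨f + e, by rw [hadd, h, h']⟩⟩⟩
  have hcomm : ∀ e f i, π e (π f i) = π f (π e i) := fun e f i => by
    rw [← hadd, add_comm, hadd]
  have hrep : ∀ i, ∃ f, π f (Quotient.mk S i).out = i := fun i =>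
    Quotient.exact (s := S) (Quotient.out_eq (Quotient.mk S i))
  have hext : ∀ e f, (∀ ω : Quotient S, π e ω.out = π f ω.out) → ∀ i, π e i = π f i :=
    fun e f h i => by
      obtain ⟨k, hk⟩ := hrep i
      rw [← hk, hcomm, h, hcomm]
  let s : (Fin r → ZMod 2) → (Fin r → ZMod 2) := fun e => Function.invFun π (π e)
  have hs : ∀ e, π (s e) = π e := fun e => Function.invFun_eq ⟨e, rfl⟩
  have hker : ∀ e i, π (e + s e) i = i := fun e i => by
    rw [hadd, hs, ← hadd, ZModModule.add_self, h0]
  let Φ : (Fin r → ZMod 2) → (ω : Quotient S) → ZMod 2 × {i : Fin n // Quotient.mk S i = ω} :=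
    fun e ω => (F ⟨e + s e, hker e⟩ ω.out,
      ⟨π e ω.out, (Quotient.sound (s := S) ⟨e, rfl⟩).symm.trans (Quotient.out_eq ω)⟩)
  have hΦ : Function.Injective Φ := fun e f h => by
    have hπ : π e = π f := funext (hext e f fun ω =>
      congrArg (fun p => p.2.1) (congrFun h ω))
    have hse : s e = s f := congrArg (Function.invFun π) hπ
    have hFF : F ⟨e + s e, hker e⟩ = F ⟨f + s f, hker f⟩ := funext fun i => by
      obtain ⟨k, hk⟩ := hrep i
      rw [← hk, hinv, hinv]
      exact congrArg Prod.fst (congrFun h _)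
    have : e + s e = f + s f := congrArg Subtype.val (hF hFF)
    rw [hse] at this
    exact add_right_cancel this
  have hcard := Fintype.card_le_of_injective Φ hΦ
  have hle : ∀ ω : Quotient S, Fintype.card (ZMod 2 × {i : Fin n // Quotient.mk S i = ω}) ≤
      2 ^ Fintype.card {i : Fin n // Quotient.mk S i = ω} := fun ω => by
    rw [Fintype.card_prod, ZMod.card]
    have hpos : 0 < Fintype.card {i : Fin n // Quotient.mk S i = ω} :=
      Fintype.card_pos_iff.2 ⟨⟨ω.out, Quotient.out_eq ω⟩⟩
    obtain ⟨k, hk⟩ := Nat.exists_eq_succ_of_ne_zero hpos.ne'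
    rw [hk, pow_succ, mul_comm]
    exact Nat.mul_le_mul_right _ Nat.lt_two_pow_self
  rw [Fintype.card_fun, Fintype.card_pi, ZMod.card, Fintype.card_fin] at hcard
  have := hcard.trans (Finset.prod_le_prod' fun ω _ => hle ω)
  rw [Finset.prod_pow_eq_pow_sum, ← Fintype.card_sigma,
    Fintype.card_congr (Equiv.sigmaFiberEquiv (Quotient.mk S)), Fintype.card_fin] at this
  exact (Nat.pow_le_pow_iff_right one_lt_two).1 this

end Count

section Degree
variable {m n : ℕ}

/-- A sign-equivariant map to the sphere has the mod two degree of a projection. -/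
lemma exists_single_of_map (hm4 : m % 4 = 1) (hm7 : 7 < m) (f : C(Fin n → Sph m, Sph m))
    {σ : (Fin n → ZMod 2) → ZMod 2} (hf : ∀ b x, f (act b x) = sg (σ b) (f x))
    (hσ : ∃ b, σ b ≠ 0) {D : Fin n → ZMod 2} (h : Cohom m (pbC f (ub m (ZMod 2))) (comb D)) :
    ∃ j, D = Pi.single j 1 ∧ ∀ b, σ b = b j := by
  have hm : Odd m := Nat.odd_iff.2 (by omega)
  have hlin : ∀ b, σ b = ∑ r, D r * b r := fun b => by
    have := evC_fam_of_map hm f (hf b) (hf b) h (add_zero (m + 1))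
    simpa [zmod_two_pow (Nat.succ_ne_zero m)] using this
  have hquad : ∀ b c, σ b * σ c = ∑ r, D r * (b r * c r) := fun b c => by
    have := evC_fam_of_map hm f (hf b) (hf c) h (show m - 1 + 2 = m + 1 by omega)
    rw [cast_choose_eq_one hm4, one_mul, one_mul] at this
    simpa only [zmod_two_pow (show m - 1 ≠ 0 by omega), zmod_two_pow two_ne_zero] using this
  have hs : ∀ r, σ (Pi.single r 1) = D r := fun r => by
    simp [hlin, Pi.single_apply]
  have hz : ∀ r s, r ≠ s → D r * D s = 0 := fun r s hrs => by
    rw [← hs r, ← hs s, hquad]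
    refine Finset.sum_eq_zero fun k _ => ?_
    by_cases hk : k = r
    · rw [hk, Pi.single_eq_of_ne hrs, mul_zero, mul_zero]
    · rw [Pi.single_eq_of_ne hk, zero_mul, mul_zero]
  obtain ⟨j, hj⟩ : ∃ j, D j ≠ 0 := by
    by_contra! h0
    obtain ⟨b, hb⟩ := hσ
    exact hb (by simp [hlin, h0])
  have hj1 : D j = 1 := (zmod_two_cases (D j)).resolve_left hj
  have hD : D = Pi.single j 1 := funext fun k => by
    by_cases hk : k = j
    · rw [hk, hj1, Pi.single_eq_same]
    · rw [Pi.single_eq_of_ne hk, ← hz k j hk, hj1, mul_one]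
  exact ⟨j, hD, fun b => by simp [hlin, hD, Pi.single_apply]⟩

variable {Λ : Type*} [CommRing Λ]

lemma comb_smul (c : Λ) (p : Fin n → Λ) : comb (m := m) (c • p) = c • comb p := by
  simp [comb, mul_smul, Finset.smul_sum]

lemma comb_sum {ι : Type*} (s : Finset ι) (p : ι → Fin n → Λ) :
    comb (m := m) (∑ i ∈ s, p i) = ∑ i ∈ s, comb (p i) := by
  simp only [comb, Finset.sum_apply, Finset.sum_smul]
  exact Finset.sum_comm

lemma exists_degree (hm : 1 ≤ m) (f : C(Fin n → Sph m, Fin n → Sph m)) :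
    ∃ D : Matrix (Fin n) (Fin n) Λ, ∀ p, Cohom m (pbC f (comb p)) (comb (Matrix.vecMul p D)) := by
  choose D hD using fun j : Fin n => exists_cohom_comb (Λ := Λ) hm
    (pbC_mem ((prC j).comp f) _ _ ub_mem) (by rw [dC_pbC, dC_ub, map_zero])
  refine ⟨Matrix.of D, fun p => ?_⟩
  rw [pbC_comb, Matrix.vecMul_eq_sum, comb_sum]
  simp only [comb_smul]
  exact Cohom.sum _ fun j => (hD j).smul _

end Degree

/-- Lifts to a product of spheres of an elementary abelian group of homeomorphisms of the product
of projective spaces. -/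
structure SignedAction (m n r : ℕ) where
  lift : (Fin r → ZMod 2) → C(Fin n → Sph m, Fin n → Sph m)
  tw : (Fin r → ZMod 2) → (Fin n → ZMod 2) → (Fin n → ZMod 2)
  coc : (Fin r → ZMod 2) → (Fin r → ZMod 2) → (Fin n → ZMod 2)
  lift_zero : ∀ x, lift 0 x = x
  lift_act : ∀ e b x, lift e (act b x) = act (tw e b) (lift e x)
  lift_lift : ∀ e f x, lift e (lift f x) = act (coc e f) (lift (e + f) x)
  ne_act : ∀ e, e ≠ 0 → ∀ b x, lift e x ≠ act b x

lemma exists_signedAction {m n r : ℕ} (hm : 1 < m)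
    (ρ : (Fin r → ZMod 2) → (Fin n → RP m) → (Fin n → RP m)) (hρ0 : ∀ x, ρ 0 x = x)
    (hρadd : ∀ g h x, ρ (g + h) x = ρ g (ρ h x)) (hcont : ∀ g, Continuous (ρ g))
    (hfree : ∀ g x, ρ g x = x → g = 0) : Nonempty (SignedAction m n r) := by
  have : ∀ e, ∃ f : C(Fin n → Sph m, Fin n → Sph m), (∀ x, projRP (f x) = ρ e (projRP x)) ∧
      (e = 0 → ∀ x, f x = x) := fun e => by
    by_cases he : e = 0
    · exact ⟨ContinuousMap.id _, fun x => by rw [he, hρ0]; rfl, fun _ _ => rfl⟩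
    · obtain ⟨f, hf⟩ := exists_lift_pi hm (hcont e)
      exact ⟨f, hf, fun h => (he h).elim⟩
  choose L hL hL0 using this
  choose τ hτ using fun e b => lift_pi_unique hm.le ((L e).comp (actC b)) (L e) fun x => by
    show projRP (L e (act b x)) = _
    rw [hL, hL, projRP_act]
  choose κ hκ using fun e f => lift_pi_unique hm.le ((L e).comp (L f)) (L (e + f)) fun x => by
    show projRP (L e (L f x)) = _
    rw [hL, hL, hL, hρadd]
  exact ⟨⟨L, τ, κ, hL0 0 rfl, hτ, hκ, fun e he b x h => he (hfree e (projRP x) (by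
    rw [← hL, h, projRP_act]))⟩⟩

namespace SignedAction
variable {m n r : ℕ} (A : SignedAction m n r)

lemma tw_tw (e f b) : A.tw e (A.tw f b) = A.tw (e + f) b := by
  obtain ⟨x⟩ : Nonempty (Fin n → Sph m) := inferInstance
  refine add_left_cancel (a := A.coc e f) (act_injective (A.lift (e + f) x) ?_)
  rw [← act_act (A.coc e f) (A.tw (e + f) b), ← A.lift_act, ← A.lift_lift, A.lift_act, A.lift_act,
    A.lift_lift, act_act, add_comm]

lemma tw_zero (b) : A.tw 0 b = b := by
  obtain ⟨x⟩ : Nonempty (Fin n → Sph m) := inferInstance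
  refine act_injective x ?_
  have := A.lift_act 0 b x
  rwa [A.lift_zero, A.lift_zero, eq_comm] at this

/-- The square of a lift. -/
def sq (e : Fin r → ZMod 2) : Fin n → ZMod 2 := A.coc e e

/-- The commutator of two lifts. -/
def comm (e f : Fin r → ZMod 2) : Fin n → ZMod 2 := A.coc e f + A.coc f e

lemma vec_add_self {k : ℕ} (b : Fin k → ZMod 2) : b + b = 0 := ZModModule.add_self b

lemma lift_sq (e x) : A.lift e (A.lift e x) = act (A.sq e) x := by
  rw [A.lift_lift, vec_add_self, A.lift_zero, sq]

lemma lift_comm (e f x) : A.lift f (A.lift e x) = act (A.comm e f) (A.lift e (A.lift f x)) := by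
  rw [A.lift_lift, A.lift_lift, act_act, comm, add_comm f e, add_right_comm, vec_add_self, zero_add]

/-- The subgroup of elements whose lifts commute with all sign changes. -/
def ker : AddSubgroup (Fin r → ZMod 2) where
  carrier := {e | ∀ b, A.tw e b = b}
  zero_mem' := A.tw_zero
  add_mem' {e f} he hf b := by rw [← A.tw_tw, hf, he]
  neg_mem' {e} he := by
    rw [ZModModule.neg_eq_self]
    exact he

variable {A}

lemma lift_act_of_mem {g} (hg : g ∈ A.ker) (b x) : A.lift g (act b x) = act b (A.lift g x) := by
  rw [A.lift_act, hg]

lemma sq_add {g h} (hg : g ∈ A.ker) (hh : h ∈ A.ker) :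
    A.sq (g + h) = A.sq g + A.sq h + A.comm g h := by
  obtain ⟨x⟩ : Nonempty (Fin n → Sph m) := inferInstance
  have e : ∀ y, A.lift (g + h) y = act (A.coc g h) (A.lift g (A.lift h y)) := fun y => by
    rw [A.lift_lift, act_act, vec_add_self, act_zero]
  refine act_injective x ?_
  rw [← A.lift_sq, e, e, lift_act_of_mem hh, lift_act_of_mem hg, act_act, vec_add_self, act_zero,
    A.lift_comm g h, lift_act_of_mem hg, A.lift_sq, A.lift_sq, act_act, act_act]
  congr 1
  abel

lemma comm_add_self {g h} (hh : h ∈ A.ker) :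
    A.comm (g + h) h = A.comm g h := by
  obtain ⟨x⟩ : Nonempty (Fin n → Sph m) := inferInstance
  refine act_injective (A.lift (g + h) (A.lift h x)) ?_
  rw [← A.lift_comm]
  have e : ∀ y, A.lift (g + h) y = act (A.coc g h) (A.lift g (A.lift h y)) := fun y => by
    rw [A.lift_lift, act_act, vec_add_self, act_zero]
  rw [e, e, lift_act_of_mem hh, A.lift_comm g h, act_act, act_act, add_comm]

lemma tw_sq {g} (hg : g ∈ A.ker) (e) : A.tw e (A.sq g) = A.sq g := by
  obtain ⟨x⟩ : Nonempty (Fin n → Sph m) := inferInstance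
  refine act_injective (A.lift e x) ?_
  rw [← A.lift_act, ← A.lift_sq, A.lift_comm g e, A.lift_comm g e, lift_act_of_mem hg, act_act,
    vec_add_self, act_zero, A.lift_sq]

lemma eq_zero_of_sq {g} (hg : g ∈ A.ker) (h : A.sq g = 0) : g = 0 := by
  by_contra h0
  exact no_free_involution (A.lift g) (A.lift g).continuous
    (fun x => by rw [A.lift_sq, h, act_zero]) (lift_act_of_mem hg) (A.ne_act g h0)

end SignedAction

section Matrices
variable {n : ℕ}

lemma exists_injective_of_commuting_matrices {G : Type*} [AddCommGroup G] [Finite G]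
    (hG : ∀ g : G, g + g = 0) (d : G →+ Matrix (Fin n) (Fin n) (ZMod 2))
    (hcomm : ∀ g h, d g * d h = d h * d g) (hd : ∀ g, d g * d g = d g)
    (q : G → Fin n → ZMod 2) (B : G → G → Fin n → ZMod 2)
    (hq : ∀ g h, q (g + h) = q g + q h + B g h)
    (hB : ∀ g h, ((1 + d g) * (1 + d h)).mulVec (B g h) = 0) (hdq : ∀ g, (d g).mulVec (q g) = 0)
    (hq0 : ∀ g, q g = 0 → g = 0) (W : Submodule (ZMod 2) (Fin n → ZMod 2)) (hqW : ∀ g, q g ∈ W)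
    (hdW : ∀ g, ∀ w ∈ W, (d g).mulVec w ∈ W) :
    ∃ f : G →+ (Fin n → ZMod 2), Function.Injective f ∧ ∀ g, f g ∈ W := by
  let S := Algebra.adjoin (ZMod 2) (range d)
  have hS : IsMulCommutative S := Algebra.isMulCommutative_adjoin _ (by
    rintro _ ⟨g, rfl⟩ _ ⟨h, rfl⟩
    exact hcomm g h)
  let : CommRing S := { (inferInstance : Ring S) with mul_comm := hS.is_comm.comm }
  let : Module S (Fin n → ZMod 2) := Module.compHom _
    ((Matrix.toLinAlgEquiv' (R := ZMod 2) (n := Fin n)).toAlgHom.comp S.val).toRingHom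
  have hsmul : ∀ (s : S) (v : Fin n → ZMod 2), s • v = s.1.mulVec v := fun s v => rfl
  let d' : G →+ S := AddMonoidHom.mk' (fun g => ⟨d g, Algebra.subset_adjoin ⟨g, rfl⟩⟩)
    fun g h => Subtype.ext (map_add d g h)
  obtain ⟨f, hf, hfs⟩ := exists_injective_addMonoidHom (R := S)
    (Subtype.ext (show (2 : Matrix (Fin n) (Fin n) (ZMod 2)) = 0 from
      one_add_one_eq_two.symm.trans (ZModModule.add_self _)))
    hG d' (fun g => Subtype.ext (hd g)) q B hq hB hdq hq0
  have hSW : ∀ s ∈ S, ∀ w ∈ W, s.mulVec w ∈ W := fun s hs => by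
    induction hs using Algebra.adjoin_induction with
    | mem x hx =>
      obtain ⟨g, rfl⟩ := hx
      exact hdW g
    | algebraMap c =>
      intro w hw
      rw [Algebra.algebraMap_eq_smul_one, Matrix.smul_mulVec, Matrix.one_mulVec]
      exact W.smul_mem c hw
    | add x y _ _ hx hy =>
      intro w hw
      rw [Matrix.add_mulVec]
      exact W.add_mem (hx w hw) (hy w hw)
    | mul x y _ _ hx hy =>
      intro w hw
      rw [← Matrix.mulVec_mulVec]
      exact hx _ (hy w hw)
  refine ⟨f, hf, fun g => ?_⟩
  refine Submodule.span_induction (p := fun v _ => v ∈ W) ?_ W.zero_mem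
    (fun _ _ _ _ => W.add_mem) (fun s v _ hv => hSW s.1 s.2 v hv) (hfs g)
  rintro _ ⟨g, rfl⟩
  exact hqW g

end Matrices

namespace SignedAction
variable {m n r : ℕ} (A : SignedAction m n r)

lemma exists_degrees (hm4 : m % 4 = 1) (hm7 : 7 < m) :
    ∃ (D : (Fin r → ZMod 2) → Matrix (Fin n) (Fin n) ℤ) (π : (Fin r → ZMod 2) → Fin n → Fin n),
      (∀ e p, Cohom m (pbC (A.lift e) (comb p)) (comb (Matrix.vecMul p (D e)))) ∧
      (∀ e f, D e * D f = D (e + f)) ∧ D 0 = 1 ∧ (∀ e b i, A.tw e b i = b (π e i)) ∧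
      ∀ e i k, ((D e i k : ℤ) : ZMod 2) = (Pi.single (π e i) 1 : Fin n → ZMod 2) k := by
  have hm : Odd m := Nat.odd_iff.2 (by omega)
  choose D hD using fun e => exists_degree (Λ := ℤ) hm.pos (A.lift e)
  have hπ : ∀ e i, ∃ j, (fun k => ((D e i k : ℤ) : ZMod 2)) = Pi.single j 1 ∧
      ∀ b, A.tw e b i = b j := fun e i => by
    refine exists_single_of_map hm4 hm7 ((prC i).comp (A.lift e)) (σ := fun b => A.tw e b i)
      (fun b x => congrFun (A.lift_act e b x) i) ⟨A.tw e (Pi.single i 1), ?_⟩ ?_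
    · rw [A.tw_tw, vec_add_self, A.tw_zero, Pi.single_eq_same]
      exact one_ne_zero
    · have := (hD e (Pi.single i 1)).red
      rwa [Matrix.single_one_vecMul, red_comb, red_pbC, comb_single, red_pbC, red_ub,
        pbC_pbC] at this
  choose π hπ hπ' using hπ
  refine ⟨D, π, hD, fun e f => ?_, ?_, fun e b i => hπ' e i b, fun e i k => congrFun (hπ e i) k⟩
  · refine Matrix.ext_of_single_vecMul fun i => ?_
    rw [← Matrix.vecMul_vecMul]
    set p : Fin n → ℤ := Pi.single i 1
    refine comb_injective hm.pos (((hD f _).symm.trans ((hD e p).symm.pbC _)).trans ?_)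
    rw [pbC_pbC, show (A.lift e).comp (A.lift f) = (actC (A.coc e f)).comp (A.lift (e + f)) from
      ContinuousMap.ext (A.lift_lift e f), ← pbC_pbC]
    exact ((cohom_actC_comb hm _ p).pbC _).trans (hD _ p)
  · refine Matrix.ext_of_single_vecMul fun i => ?_
    rw [Matrix.vecMul_one]
    refine comb_injective hm.pos ((hD 0 _).symm.trans (Cohom.of_eq ?_))
    rw [show A.lift 0 = ContinuousMap.id _ from ContinuousMap.ext A.lift_zero, pbC_id]

variable {A}

lemma sum_sq_comm_eq_zero (hm4 : m % 4 = 1) (hm7 : 7 < m) {g h} (hg : g ∈ A.ker) {p : Fin n → ℤ}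
    (hpg : Cohom m (pbC (A.lift g) (comb p)) (comb p))
    (hph : Cohom m (pbC (A.lift h) (comb p)) (comb p)) :
    ∑ j, ((p j : ℤ) : ZMod 2) * (A.sq g j * A.comm g h j) = 0 :=
  sum_eq_zero_of_commutator hm4 hm7 (A.lift g) (A.lift h) (A.lift_sq g) (lift_act_of_mem hg _)
    (A.lift_comm g h) hpg hph

lemma sum_comm_eq_zero (hm4 : m % 4 = 1) (hm7 : 7 < m) {g h} (hg : g ∈ A.ker) (hh : h ∈ A.ker)
    {p : Fin n → ℤ} (hpg : Cohom m (pbC (A.lift g) (comb p)) (comb p))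
    (hph : Cohom m (pbC (A.lift h) (comb p)) (comb p)) :
    ∑ j, ((p j : ℤ) : ZMod 2) * A.comm g h j = 0 := by
  have hm : Odd m := Nat.odd_iff.2 (by omega)
  have hpgh : Cohom m (pbC (A.lift (g + h)) (comb p)) (comb p) := by
    have : A.lift (g + h) = (actC (A.coc g h)).comp ((A.lift g).comp (A.lift h)) :=
      ContinuousMap.ext fun x => by
        show _ = act _ (A.lift g (A.lift h x))
        rw [A.lift_lift, act_act, vec_add_self, act_zero]
    rw [this, ← pbC_pbC, ← pbC_pbC]
    exact ((((cohom_actC_comb hm _ p).pbC _).pbC _).trans (hpg.pbC _)).trans hph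
  have h1 := sum_sq_comm_eq_zero hm4 hm7 hg hpg hph
  have h2 := sum_sq_comm_eq_zero hm4 hm7 hh hph hpg
  have h3 := sum_sq_comm_eq_zero hm4 hm7 (add_mem hg hh) hpgh hph
  have hc : A.comm h g = A.comm g h := add_comm _ _
  rw [comm_add_self hh, sq_add hg hh] at h3
  rw [hc] at h2
  rw [← add_zero (0 : ZMod 2), ← add_zero (0 + 0 : ZMod 2)]
  nth_rw 1 [← h1]
  nth_rw 1 [← h2]
  rw [← h3, ← Finset.sum_add_distrib, ← Finset.sum_add_distrib]
  refine Finset.sum_congr rfl fun j _ => ?_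
  have hsq : A.comm g h j * A.comm g h j = A.comm g h j := by
    rw [← pow_two, zmod_two_pow two_ne_zero]
  simp only [Pi.add_apply]
  linear_combination (-((p j : ℤ) : ZMod 2)) * hsq -
    ((p j : ℤ) : ZMod 2) * (A.sq g j + A.sq h j) * A.comm g h j *
      (CharTwo.two_eq_zero : (2 : ZMod 2) = 0)

theorem rank_le (A : SignedAction m n r) (hm4 : m % 4 = 1) (hm7 : 7 < m) : r ≤ n := by
  have hm : Odd m := Nat.odd_iff.2 (by omega)
  obtain ⟨D, π, hD, hDD, hD1, hπ, hDπ⟩ := A.exists_degrees hm4 hm7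
  have hπker : ∀ g, g ∈ A.ker ↔ ∀ i, π g i = i := fun g => by
    refine ⟨fun h i => ?_, fun h b => funext fun i => by rw [hπ, h]⟩
    have := congrFun (h (Pi.single i 1)) i
    rw [hπ, Pi.single_eq_same] at this
    by_contra hne
    rw [Pi.single_eq_of_ne hne] at this
    exact zero_ne_one this
  have hΔ : ∀ g : A.ker, ∃ Δ : Matrix (Fin n) (Fin n) ℤ, D g = 1 + (2 : ℤ) • Δ := fun g => by
    have : ∀ i k, ∃ c : ℤ, D g i k = (1 : Matrix (Fin n) (Fin n) ℤ) i k + 2 * c := fun i k => by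
      have h := hDπ g i k
      rw [(hπker g).1 g.2 i, ← sub_eq_zero] at h
      have h' : ((D g i k - (1 : Matrix (Fin n) (Fin n) ℤ) i k : ℤ) : ZMod 2) = 0 := by
        rw [← h]
        simp [Matrix.one_apply, Pi.single_apply, eq_comm]
      obtain ⟨c, hc⟩ := (ZMod.intCast_zmod_eq_zero_iff_dvd _ 2).1 h'
      exact ⟨c, by push_cast at hc; linarith⟩
    choose Δ h using this
    exact ⟨Matrix.of Δ, Matrix.ext fun i k => by simp [h]⟩
  choose Δ hΔ using hΔ
  have two_inj : ∀ X Y : Matrix (Fin n) (Fin n) ℤ, (2 : ℤ) • X = (2 : ℤ) • Y → X = Y :=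
    fun X Y h => Matrix.ext fun i k => mul_left_cancel₀ (two_ne_zero (α := ℤ))
      (congrFun (congrFun h i) k)
  have hΔsq : ∀ g, Δ g * Δ g = -Δ g := fun g => by
    have h : D g * D g = 1 := by rw [hDD, vec_add_self, hD1]
    rw [hΔ] at h
    refine two_inj _ _ (two_inj _ _ ?_)
    have : (1 + (2 : ℤ) • Δ g) * (1 + (2 : ℤ) • Δ g) =
      1 + ((2 : ℤ) • (2 : ℤ) • (Δ g * Δ g) - (2 : ℤ) • (2 : ℤ) • -Δ g) := by noncomm_ring
    rw [this, add_eq_left, sub_eq_zero] at h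
    exact h
  have hΔadd : ∀ g h, Δ (g + h) = Δ g + Δ h + (2 : ℤ) • (Δ g * Δ h) := fun g h => by
    have e : D g * D h = D (g + h : A.ker) := hDD _ _
    rw [hΔ, hΔ, hΔ] at e
    refine two_inj _ _ (add_left_cancel (a := 1) (e.symm.trans ?_))
    noncomm_ring
  have hΔD : ∀ g e, Δ g * D e = D e * Δ g := fun g e => by
    have h : D g * D e = D e * D g := by rw [hDD, hDD, add_comm]
    rw [hΔ, add_mul, mul_add, one_mul, mul_one, add_right_inj] at h
    refine two_inj _ _ ?_
    rwa [smul_mul_assoc, mul_smul_comm] at h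
  have hΔΔ : ∀ g h, Δ g * Δ h = Δ h * Δ g := fun g h => by
    have e := hΔD g h
    rw [hΔ, mul_add, add_mul, one_mul, mul_one, add_right_inj, smul_mul_assoc,
      mul_smul_comm] at e
    exact two_inj _ _ e
  let red2 := (Int.castRingHom (ZMod 2)).mapMatrix (m := Fin n)
  have hred2 : ∀ X, red2 ((2 : ℤ) • X) = 0 := fun X => by
    rw [map_zsmul]
    exact Matrix.ext fun i k => by simp [show (2 : ZMod 2) = 0 from rfl]
  let d : A.ker →+ Matrix (Fin n) (Fin n) (ZMod 2) := AddMonoidHom.mk' (fun g => red2 (Δ g))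
    fun g h => by rw [hΔadd, map_add, map_add, hred2, add_zero]
  have hred2D : ∀ e v, (red2 (D e)).mulVec v = A.tw e v := fun e v => funext fun i => by
    rw [hπ]
    have : ∀ k, red2 (D e) i k = (Pi.single (π e i) 1 : Fin n → ZMod 2) k := hDπ e i
    simp [Matrix.mulVec, dotProduct, this, Pi.single_apply]
  have hfix : ∀ (g : A.ker) (p : Fin n → ℤ), Matrix.vecMul p (D g) = p →
      Cohom m (pbC (A.lift g) (comb p)) (comb p) := fun g p hp => by
    have := hD g p
    rwa [hp] at this
  have hrow : ∀ (X : Matrix (Fin n) (Fin n) ℤ) (v : Fin n → ZMod 2) i,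
      (red2 X).mulVec v i = ∑ j, ((Matrix.vecMul (Pi.single i 1) X j : ℤ) : ZMod 2) * v j :=
    fun X v i => by
      rw [Matrix.single_one_vecMul]
      rfl
  let W : Submodule (ZMod 2) (Fin n → ZMod 2) :=
    { carrier := {v | ∀ e, (red2 (D e)).mulVec v = v}
      zero_mem' := fun e => Matrix.mulVec_zero _
      add_mem' := fun {v w} hv hw e => by rw [Matrix.mulVec_add, hv, hw]
      smul_mem' := fun c v hv e => by rw [Matrix.mulVec_smul, hv] }
  have h1 : ∀ g, (1 + Δ g) * D g = 1 + Δ g := fun g => by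
    rw [hΔ, show (1 + Δ g) * (1 + (2 : ℤ) • Δ g) =
      1 + Δ g + (2 : ℤ) • (Δ g + Δ g * Δ g) by noncomm_ring, hΔsq, add_neg_cancel, smul_zero,
      add_zero]
  have h1c : ∀ g e, (1 + Δ g) * D e = D e * (1 + Δ g) := fun g e => by
    rw [add_mul, mul_add, hΔD, one_mul, mul_one]
  obtain ⟨F, hF, hFW⟩ := exists_injective_of_commuting_matrices
    (fun g : A.ker => Subtype.ext (vec_add_self g.1)) d
    (fun g h => by
      show red2 _ * red2 _ = red2 _ * red2 _
      rw [← map_mul, hΔΔ, map_mul])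
    (fun g => by
      show red2 _ * red2 _ = red2 _
      rw [← map_mul, hΔsq, map_neg, ZModModule.neg_eq_self])
    (fun g => A.sq g) (fun g h => A.comm g h) (fun g h => sq_add g.2 h.2)
    (fun g h => by
      show ((1 + red2 (Δ g)) * (1 + red2 (Δ h))).mulVec _ = 0
      rw [← map_one red2, ← map_add, ← map_add, ← map_mul]
      refine funext fun i => (hrow _ _ i).trans (sum_comm_eq_zero hm4 hm7 g.2 h.2
        (hfix g _ ?_) (hfix h _ ?_))
      · rw [Matrix.vecMul_vecMul, mul_assoc, h1c h, ← mul_assoc, h1]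
      · rw [Matrix.vecMul_vecMul, mul_assoc, h1])
    (fun g => funext fun i => (hrow _ _ i).trans (sum_eq_zero_of_neg hm (A.lift g) (A.lift_sq g) (by
      have := hD g (Matrix.vecMul (Pi.single i 1) (Δ g))
      rwa [Matrix.vecMul_vecMul, hΔ, mul_add, mul_one, mul_smul_comm, hΔsq,
        show Δ g + (2 : ℤ) • -Δ g = -Δ g by abel, Matrix.vecMul_neg, comb_neg] at this)))
    (fun g h => Subtype.ext (eq_zero_of_sq g.2 h)) W
    (fun g e => by rw [hred2D, tw_sq g.2])
    (fun g w hw e => by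
      show (red2 (D e)).mulVec ((red2 (Δ g)).mulVec w) = _
      rw [Matrix.mulVec_mulVec, ← map_mul, ← hΔD, map_mul, ← Matrix.mulVec_mulVec, hw]
      rfl)
  have hπ0 : ∀ i, π 0 i = i := (hπker 0).1 A.ker.zero_mem
  refine le_of_injective_invariants π hπ0 (fun e f i => ?_)
    (fun g => F ⟨g.1, (hπker _).2 g.2⟩) (fun g h e => ?_) fun g e i => ?_
  · by_contra hne
    have h : A.tw (f + e) (Pi.single (π e (π f i)) 1) i = 1 := by
      rw [← A.tw_tw, hπ, hπ, Pi.single_eq_same]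
    rw [hπ, add_comm, Pi.single_eq_of_ne hne] at h
    exact zero_ne_one h
  · exact Subtype.ext (congrArg (fun k : A.ker => k.1) (hF e))
  · have := congrFun (hFW ⟨g.1, (hπker _).2 g.2⟩ e) i
    rwa [hred2D, hπ] at this

end SignedAction

end ASp

theorem stmt7 (m n r : ℕ) (hm : m % 4 = 1) (hm7 : 7 < m) (hn : 1 ≤ n)
    (ρ : (Fin r → ZMod 2) → (Fin n → RP m) → (Fin n → RP m))
    (hρ0 : ∀ x, ρ 0 x = x)
    (hρadd : ∀ g h x, ρ (g + h) x = ρ g (ρ h x))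
    (hcont : ∀ g, Continuous (ρ g))
    (hfree : ∀ g x, ρ g x = x → g = 0) :
    r ≤ n := by
  obtain ⟨A⟩ := ASp.exists_signedAction (by omega) ρ hρ0 hρadd hcont hfree
  exact A.rank_le hm hm7
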